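/- arXiv:1410.2005 — 2 statements merged into one kernel-verified Lean document; each statement's English description precedes it below -/
import Mathlib

section
/- Let n and h be positive integers with n ≥ ⌊h²/4⌋ + 3, and let S ⊆ ℝ^n be a Borel measurable set symmetric about the origin with Lebesgue measure V. Then (V/2)^h ≤ ∫_{X_n} Σ_{x_1,…,x_h ∈ L∖{0}} ρ_{S',h}(x_1,…,x_h) dμ_n(L) ≤ (V/2)^h + (2·3^{⌊h²/4⌋}·(√3/2)^n + 21·5^{⌊h²/4⌋}·(1/2)^n)·(V/2+1)^h. -/
open MeasureTheory Matrix
open scoped Nat Classical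

noncomputable section

abbrev SLR (n : ℕ) := Matrix.SpecialLinearGroup (Fin n) ℝ

instance (n : ℕ) : MeasurableSpace (SLR n) :=
  MeasurableSpace.comap (fun g : SLR n => (g : Matrix (Fin n) (Fin n) ℝ))
    (inferInstanceAs (MeasurableSpace (Fin n → Fin n → ℝ)))

/-- The image of SL_n(ℤ) in SL_n(ℝ), as a subgroup. -/
def SLZ (n : ℕ) : Subgroup (SLR n) :=
  (Matrix.SpecialLinearGroup.map (Int.castRingHom ℝ)).range

/-- The space of lattices `X_n = SL_n(ℤ) \ SL_n(ℝ)` (space of right cosets). -/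
def LatSpace (n : ℕ) := Quotient (QuotientGroup.rightRel (SLZ n))

instance (n : ℕ) : MeasurableSpace (LatSpace n) :=
  inferInstanceAs (MeasurableSpace (Quotient _))

/-- The coset of `g`. -/
def latMk (n : ℕ) (g : SLR n) : LatSpace n :=
  Quotient.mk (QuotientGroup.rightRel (SLZ n)) g

/-- Right translation action of `SL_n(ℝ)` on `X_n`. -/
def rTranslate (n : ℕ) (a : SLR n) (x : LatSpace n) : LatSpace n :=
  Quotient.lift (fun g => latMk n (g * a))
    (fun g g' hgg' => Quotient.sound (QuotientGroup.rightRel_apply.mpr (by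
      have h : g' * g⁻¹ ∈ SLZ n := QuotientGroup.rightRel_apply.mp hgg'
      simpa [_root_.mul_inv_rev, mul_assoc] using h))) x

/-- The lattice `ℤ^n g` associated to `g ∈ SL_n(ℝ)`. -/
def latticeOf (n : ℕ) (g : SLR n) : Set (Fin n → ℝ) :=
  Set.range (fun m : Fin n → ℤ =>
    Matrix.vecMul (fun i => (m i : ℝ)) (g : Matrix (Fin n) (Fin n) ℝ))

/-- `S'`: the set of points of `S` whose first nonzero coordinate is positive. -/
def posHalf (n : ℕ) (S : Set (Fin n → ℝ)) : Set (Fin n → ℝ) :=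
  {x ∈ S | ∃ i : Fin n, 0 < x i ∧ ∀ j < i, x j = 0}

/-- `A` has at least `k` elements. -/
def hasAtLeast {α : Type*} (A : Set α) (k : ℕ) : Prop :=
  ∃ t : Finset α, ↑t ⊆ A ∧ t.card = k

/-- `ρ_{S',h}(L)`: the number of `h`-element subsets of `L ∩ S'`. -/
def rhoSub (n : ℕ) (S : Set (Fin n → ℝ)) (h : ℕ) (g : SLR n) : ℕ :=
  Nat.card {t : Finset (Fin n → ℝ) // ↑t ⊆ latticeOf n g ∩ posHalf n S ∧ t.card = h}

end

section LatticeSpace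

variable {n : ℕ}

theorem measurable_slr_apply (i j : Fin n) :
    Measurable fun g : SLR n => (g : Matrix (Fin n) (Fin n) ℝ) i j := by
  have h : @Measurable (SLR n) (Fin n → Fin n → ℝ) _ _
      (fun g : SLR n => (g : Matrix (Fin n) (Fin n) ℝ)) := comap_measurable _
  exact (measurable_pi_apply j).comp ((measurable_pi_apply i).comp h)

theorem measurable_to_slr {α : Type*} [MeasurableSpace α] {f : α → SLR n}
    (h : ∀ i j, Measurable fun x => (f x : Matrix (Fin n) (Fin n) ℝ) i j) : Measurable f := by
  refine measurable_comap_iff.mpr ?_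
  exact measurable_pi_lambda _ fun i => measurable_pi_lambda _ fun j => h i j

instance : MeasurableMul₂ (SLR n) where
  measurable_mul := measurable_to_slr fun i j => by
    change Measurable fun x : SLR n × SLR n =>
      ((x.1 : Matrix (Fin n) (Fin n) ℝ) * (x.2 : Matrix (Fin n) (Fin n) ℝ)) i j
    simp only [Matrix.mul_apply]
    exact Finset.measurable_sum _ fun k _ =>
      ((measurable_slr_apply i k).comp measurable_fst).mul
        ((measurable_slr_apply k j).comp measurable_snd)

instance : MeasurableInv (SLR n) where
  measurable_inv := measurable_to_slr fun i j => by
    change Measurable fun x : SLR n => adjugate (x : Matrix (Fin n) (Fin n) ℝ) i j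
    simp only [adjugate_apply, det_apply, updateRow_apply]
    refine Finset.measurable_fun_sum _ fun σ _ => ?_
    refine Measurable.const_smul ?_ _
    refine Finset.measurable_fun_prod _ fun k _ => ?_
    split_ifs
    · exact measurable_const
    · exact measurable_slr_apply _ _

instance : Countable (SLZ n) := by
  have : Countable (Matrix (Fin n) (Fin n) ℤ) :=
    inferInstanceAs (Countable (Fin n → Fin n → ℤ))
  have : Countable (SpecialLinearGroup (Fin n) ℤ) := Subtype.countable
  exact (Set.countable_range (SpecialLinearGroup.map (Int.castRingHom ℝ))).to_subtype

theorem measurable_latMk : Measurable (latMk n) := fun _ h => h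

theorem measurable_of_comp_latMk {α : Type*} [MeasurableSpace α] {f : LatSpace n → α}
    (h : Measurable fun g => f (latMk n g)) : Measurable f :=
  measurable_from_quotient.mpr h

theorem latMk_eq {g g' : SLR n} : latMk n g = latMk n g' ↔ g' * g⁻¹ ∈ SLZ n :=
  Quotient.eq.trans QuotientGroup.rightRel_apply

theorem latMk_mul_left {γ : SLR n} (h : γ ∈ SLZ n) (g : SLR n) :
    latMk n (γ * g) = latMk n g := by
  rw [eq_comm, latMk_eq]; simpa using h

/-- A representative in `SL_n(ℝ)` of a point of the space of lattices. -/
noncomputable def latRep (x : LatSpace n) : SLR n := Quotient.out x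

theorem latMk_latRep (x : LatSpace n) : latMk n (latRep x) = x := Quotient.out_eq x

theorem exists_latRep_latMk (g : SLR n) : ∃ γ ∈ SLZ n, latRep (latMk n g) = γ * g := by
  have h := latMk_eq.mp (latMk_latRep (latMk n g)).symm
  exact ⟨_, h, by group⟩

/-- A function on `SL_n(ℝ)` is invariant under left multiplication by `SL_n(ℤ)`. -/
def IsLatInvariant {α : Type*} (u : SLR n → α) : Prop :=
  ∀ γ ∈ SLZ n, ∀ g, u ((γ : SLR n) * g) = u g

theorem IsLatInvariant.latRep_latMk {α : Type*} {u : SLR n → α} (h : IsLatInvariant u) (g : SLR n) :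
    u (latRep (latMk n g)) = u g := by
  obtain ⟨γ, hγ, e⟩ := exists_latRep_latMk g
  rw [e, h γ hγ]

theorem IsLatInvariant.measurable {α : Type*} [MeasurableSpace α] {u : SLR n → α}
    (h : IsLatInvariant u) (hm : Measurable u) : Measurable fun x => u (latRep x) :=
  measurable_of_comp_latMk (by simpa only [h.latRep_latMk] using hm)

theorem rTranslate_latMk (a g : SLR n) : rTranslate n a (latMk n g) = latMk n (g * a) := rfl

theorem measurable_rTranslate (a : SLR n) : Measurable (rTranslate n a) :=
  measurable_of_comp_latMk (by
    simp only [rTranslate_latMk]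
    exact measurable_latMk.comp (measurable_mul_const a))

theorem IsLatInvariant.rTranslate {α : Type*} {u : SLR n → α} (h : IsLatInvariant u) (a : SLR n)
    (x : LatSpace n) : u (latRep (rTranslate n a x)) = u (latRep x * a) := by
  conv_lhs => rw [← latMk_latRep x]
  rw [rTranslate_latMk, h.latRep_latMk]

theorem isLatInvariant_tsum (u : SLR n → ENNReal) :
    IsLatInvariant fun g => ∑' γ : SLZ n, u ((γ : SLR n) * g) := by
  intro γ hγ g
  have h := (Equiv.mulRight (⟨γ, hγ⟩ : SLZ n)).tsum_eq fun δ : SLZ n => u ((δ : SLR n) * g)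
  simpa [mul_assoc] using h

theorem measurable_tsum_slz {u : SLR n → ENNReal} (h : Measurable u) :
    Measurable fun g => ∑' γ : SLZ n, u ((γ : SLR n) * g) :=
  Measurable.tsum fun _ => h.comp (measurable_const_mul _)

/-- The measure on `SL_n(ℝ)` obtained from a measure on the space of lattices by counting along
the `SL_n(ℤ)`-orbits. -/
noncomputable def orbitLift (μ : Measure (LatSpace n)) : Measure (SLR n) :=
  μ.bind fun x => Measure.sum fun γ : SLZ n => Measure.dirac ((γ : SLR n) * latRep x)

theorem lintegral_orbitLift (μ : Measure (LatSpace n)) {u : SLR n → ENNReal} (h : Measurable u) :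
    ∫⁻ g, u g ∂(orbitLift μ) = ∫⁻ x, ∑' γ : SLZ n, u ((γ : SLR n) * latRep x) ∂μ := by
  have key : ∀ w : SLR n → ENNReal, Measurable w → ∀ x : LatSpace n,
      ∫⁻ g, w g ∂(Measure.sum fun γ : SLZ n => Measure.dirac ((γ : SLR n) * latRep x)) =
        ∑' γ : SLZ n, w ((γ : SLR n) * latRep x) := by
    intro w hw x
    rw [lintegral_sum_measure]
    exact tsum_congr fun γ => lintegral_dirac' _ hw
  rw [orbitLift, Measure.lintegral_bind _ h.aemeasurable]
  · simp only [key u h]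
  · refine (Measure.measurable_of_measurable_coe _ fun s hs => ?_).aemeasurable
    have e : (fun x : LatSpace n =>
        (Measure.sum fun γ : SLZ n => Measure.dirac ((γ : SLR n) * latRep x)) s) =
        fun x => ∑' γ : SLZ n, s.indicator 1 ((γ : SLR n) * latRep x) := by
      funext x
      rw [← lintegral_indicator_one hs, key _ (measurable_one.indicator hs)]
    rw [e]
    exact (isLatInvariant_tsum (s.indicator 1)).measurable
      (measurable_tsum_slz (measurable_one.indicator hs))

theorem orbitLift_isMulRightInvariant (μ : Measure (LatSpace n))
    (hinv : ∀ a : SLR n, μ.map (rTranslate n a) = μ) : (orbitLift μ).IsMulRightInvariant where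
  map_mul_right_eq_self a := by
    refine Measure.ext_of_lintegral _ fun u hu => ?_
    rw [lintegral_map hu (measurable_mul_const a),
      lintegral_orbitLift μ (u := fun g => u (g * a)) (hu.comp (measurable_mul_const a)),
      lintegral_orbitLift μ hu]
    conv_rhs => rw [← hinv a]
    have hi := isLatInvariant_tsum u
    rw [lintegral_map (hi.measurable (measurable_tsum_slz hu)) (measurable_rTranslate a)]
    refine lintegral_congr fun x => ?_
    rw [hi.rTranslate]
    simp only [mul_assoc]

end LatticeSpace

section Uniqueness

variable {n : ℕ}

/-- Matrices in `SL_n(ℝ)` with all entries bounded by `k`. -/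
def slrBox (n k : ℕ) : Set (SLR n) :=
  {g | ∀ i j, |(g : Matrix (Fin n) (Fin n) ℝ) i j| ≤ k}

theorem measurableSet_slrBox (k : ℕ) : MeasurableSet (slrBox n k) := by
  have e : slrBox n k = ⋂ i, ⋂ j, {g : SLR n | |(g : Matrix (Fin n) (Fin n) ℝ) i j| ≤ k} := by
    ext g; simp [slrBox]
  rw [e]
  refine MeasurableSet.iInter fun i => MeasurableSet.iInter fun j => ?_
  exact measurableSet_le (measurable_slr_apply i j).abs measurable_const

theorem exists_mem_slrBox (g : SLR n) : ∃ k, g ∈ slrBox n k := by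
  obtain ⟨k, hk⟩ := exists_nat_ge (∑ i, ∑ j, |(g : Matrix (Fin n) (Fin n) ℝ) i j|)
  refine ⟨k, fun i j => le_trans ?_ hk⟩
  have h1 := Finset.single_le_sum (f := fun j => |(g : Matrix (Fin n) (Fin n) ℝ) i j|)
    (fun _ _ => abs_nonneg _) (Finset.mem_univ j)
  have h2 := Finset.single_le_sum (f := fun i => ∑ j, |(g : Matrix (Fin n) (Fin n) ℝ) i j|)
    (fun _ _ => Finset.sum_nonneg fun _ _ => abs_nonneg _) (Finset.mem_univ i)
  exact h1.trans h2

theorem finite_slz_inter_slrBox (k : ℕ) : {γ : SLZ n | (γ : SLR n) ∈ slrBox n k}.Finite := by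
  have h1 : (Set.univ.pi fun _ : Fin n => Set.univ.pi fun _ : Fin n =>
      Set.Icc (-(k : ℤ)) k).Finite :=
    Set.Finite.pi fun _ => Set.Finite.pi fun _ => Set.finite_Icc _ _
  have h2 : {M : SpecialLinearGroup (Fin n) ℤ | ∀ i j, |(M : Matrix (Fin n) (Fin n) ℤ) i j| ≤ k}.Finite := by
    refine Set.Finite.of_finite_image (f := fun M => (M : Matrix (Fin n) (Fin n) ℤ)) (h1.subset ?_)
      (Subtype.val_injective.injOn)
    rintro _ ⟨M, hM, rfl⟩ i - j -
    exact abs_le.mp (hM i j)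
  refine Set.Finite.of_finite_image (f := fun γ : SLZ n => (γ : SLR n)) ?_
    (Subtype.val_injective.injOn)
  refine (h2.image (SpecialLinearGroup.map (Int.castRingHom ℝ))).subset ?_
  rintro _ ⟨⟨_, M, rfl⟩, hM, rfl⟩
  refine ⟨M, fun i j => ?_, rfl⟩
  have := hM i j
  simp only [SpecialLinearGroup.map_apply_coe, RingHom.mapMatrix_apply, map_apply, eq_intCast] at this
  exact_mod_cast this

theorem finite_orbit_slrBox (k : ℕ) (g : SLR n) : {γ : SLZ n | (γ : SLR n) * g ∈ slrBox n k}.Finite := by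
  obtain ⟨l, hl⟩ := exists_mem_slrBox g⁻¹
  refine (finite_slz_inter_slrBox (n * (k * l))).subset fun γ hγ i j => ?_
  have e : (γ : SLR n) = (γ * g) * g⁻¹ := by group
  rw [e]
  change |(((((γ : SLR n) * g : SLR n) : Matrix (Fin n) (Fin n) ℝ)) *
    ((g⁻¹ : SLR n) : Matrix (Fin n) (Fin n) ℝ)) i j| ≤ _
  rw [Matrix.mul_apply]
  refine (Finset.abs_sum_le_sum_abs _ _).trans ?_
  refine (Finset.sum_le_card_nsmul _ _ ((k : ℝ) * l) fun x _ => ?_).trans ?_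
  · rw [abs_mul]
    exact mul_le_mul (hγ i x) (hl x j) (abs_nonneg _) (Nat.cast_nonneg _)
  · simp

/-- The number of translates of `g` under `SL_n(ℤ)` lying in the box of size `k`. -/
noncomputable def slrBoxCount (k : ℕ) (g : SLR n) : ENNReal :=
  ∑' γ : SLZ n, (slrBox n k).indicator 1 ((γ : SLR n) * g)

theorem slrBoxCount_ne_top (k : ℕ) (g : SLR n) : slrBoxCount k g ≠ ⊤ := by
  have hfin := finite_orbit_slrBox k g
  rw [slrBoxCount, tsum_eq_sum (s := hfin.toFinset)]
  · exact ENNReal.sum_ne_top.mpr fun γ _ => by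
      by_cases h : (γ : SLR n) * g ∈ slrBox n k <;> simp [h]
  · intro γ hγ
    have : (γ : SLR n) * g ∉ slrBox n k := by simpa using hγ
    simp [this]

theorem exists_pos_weight (n : ℕ) : ∃ p : SLR n → ENNReal, Measurable p ∧ (∀ g, p g ≠ 0) ∧
    ∀ g, ∑' γ : SLZ n, p ((γ : SLR n) * g) = 1 := by
  let w : SLR n → ENNReal := fun g =>
    ∑' k : ℕ, (2⁻¹ : ENNReal) ^ (k + 1) * ((slrBox n k).indicator 1 g / slrBoxCount k g)
  have hbm : ∀ k, Measurable ((slrBox n k).indicator (1 : SLR n → ENNReal)) := fun k =>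
    measurable_one.indicator (measurableSet_slrBox k)
  have hcm : ∀ k, Measurable (slrBoxCount (n := n) k) := fun k => measurable_tsum_slz (hbm k)
  have hci : ∀ k, IsLatInvariant (slrBoxCount (n := n) k) := fun k => isLatInvariant_tsum _
  have hwm : Measurable w :=
    Measurable.tsum fun k => ((hbm k).div (hcm k)).const_mul _
  have hw0 : ∀ g, w g ≠ 0 := by
    intro g h0
    obtain ⟨k, hk⟩ := exists_mem_slrBox g
    have h1 := ENNReal.tsum_eq_zero.mp h0 k
    simp [hk, slrBoxCount_ne_top] at h1
  let W : SLR n → ENNReal := fun g => ∑' γ : SLZ n, w ((γ : SLR n) * g)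
  have hWm : Measurable W := measurable_tsum_slz hwm
  have hWi : IsLatInvariant W := isLatInvariant_tsum _
  have hW1 : ∀ g, W g ≤ 1 := by
    intro g
    change ∑' γ : SLZ n, ∑' k : ℕ, _ ≤ _
    rw [ENNReal.tsum_comm]
    calc _ ≤ ∑' k : ℕ, (2⁻¹ : ENNReal) ^ (k + 1) := ENNReal.tsum_le_tsum fun k => ?_
      _ = 1 := ENNReal.tsum_geometric_add_one _ |>.trans (by
        rw [ENNReal.one_sub_inv_two, inv_inv]; exact ENNReal.inv_mul_cancel (by simp) (by simp))
    rw [ENNReal.tsum_mul_left]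
    refine mul_le_of_le_one_right zero_le ?_
    have : ∀ γ : SLZ n, slrBoxCount k ((γ : SLR n) * g) = slrBoxCount k g := fun γ =>
      hci k γ γ.2 g
    simp only [this, div_eq_mul_inv]
    rw [ENNReal.tsum_mul_right]
    exact ENNReal.div_self_le_one
  have hWle : ∀ g, w g ≤ W g := fun g => by
    have h := ENNReal.le_tsum (f := fun γ : SLZ n => w ((γ : SLR n) * g)) 1
    simpa using h
  have hW0 : ∀ g, W g ≠ 0 := fun g h => hw0 g (le_antisymm ((hWle g).trans h.le) zero_le)
  have hWt : ∀ g, W g ≠ ⊤ := fun g => ((hW1 g).trans_lt ENNReal.one_lt_top).ne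
  refine ⟨fun g => w g / W g, hwm.div hWm, fun g => ?_, fun g => ?_⟩
  · exact (ENNReal.div_pos (hw0 g) (hWt g)).ne'
  · have : ∀ γ : SLZ n, W ((γ : SLR n) * g) = W g := fun γ => hWi γ γ.2 g
    simp only [this, div_eq_mul_inv]
    rw [ENNReal.tsum_mul_right]
    exact ENNReal.mul_inv_cancel (hW0 g) (hWt g)

theorem sigmaFinite_of_pos_of_lintegral_ne_top {α : Type*} [MeasurableSpace α] {μ : Measure α}
    {p : α → ENNReal} (hp : Measurable p) (h0 : ∀ x, p x ≠ 0) (hi : ∫⁻ x, p x ∂μ ≠ ⊤) :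
    SigmaFinite μ := by
  refine ⟨⟨⟨fun k => {x | ((k : ENNReal) + 1)⁻¹ ≤ p x}, fun _ => trivial, fun k => ?_, ?_⟩⟩⟩
  · have h := mul_meas_ge_le_lintegral hp ((k : ENNReal) + 1)⁻¹ (μ := μ)
    refine lt_top_iff_ne_top.mpr fun ht => hi ?_
    rw [ht, ENNReal.mul_top (by simp)] at h
    exact top_le_iff.mp h
  · ext x
    simp only [Set.mem_iUnion, Set.mem_univ, iff_true]
    obtain ⟨k, hk⟩ := ENNReal.exists_inv_nat_lt (h0 x)
    refine ⟨k, le_trans ?_ hk.le⟩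
    exact ENNReal.inv_le_inv.mpr le_self_add

theorem exists_eq_smul_of_isMulRightInvariant {G : Type*} [Group G] [MeasurableSpace G]
    [MeasurableMul₂ G] [MeasurableInv G] (m₁ m₂ : Measure G) [SigmaFinite m₁] [SigmaFinite m₂]
    [m₁.IsMulRightInvariant] [m₂.IsMulRightInvariant] (h2 : m₂ ≠ 0) :
    ∃ c : ENNReal, m₁ = c • m₂ := by
  have hs : ∃ s, m₂.inv s ≠ 0 ∧ m₂.inv s ≠ ⊤ := by
    by_contra! hc
    have h3 : m₂.inv = 0 := by
      have : ∀ k, m₂.inv (spanningSets m₂.inv k) = 0 := fun k => by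
        by_contra h
        exact (measure_spanningSets_lt_top m₂.inv k).ne (hc _ h)
      rw [← Measure.measure_univ_eq_zero, ← iUnion_spanningSets m₂.inv]
      exact measure_iUnion_null this
    exact h2 (by rw [← Measure.inv_inv m₂, h3]; simp [Measure.inv])
  obtain ⟨s, h0, ht⟩ := hs
  have h := measure_eq_div_smul m₁.inv m₂.inv h0 ht
  generalize m₁.inv s / m₂.inv s = c at h
  have e : (c • m₂.inv).inv = c • m₂.inv.inv := by simp only [Measure.inv, Measure.map_smul]
  exact ⟨c, by rw [← Measure.inv_inv m₁, h, e, Measure.inv_inv]⟩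

theorem lintegral_eq_lintegral_orbitLift (μ : Measure (LatSpace n)) {p : SLR n → ENNReal}
    (hp : Measurable p) (h1 : ∀ g, ∑' γ : SLZ n, p ((γ : SLR n) * g) = 1)
    {f : LatSpace n → ENNReal} (hf : Measurable f) :
    ∫⁻ x, f x ∂μ = ∫⁻ g, f (latMk n g) * p g ∂(orbitLift μ) := by
  rw [lintegral_orbitLift μ (u := fun g => f (latMk n g) * p g) ((hf.comp measurable_latMk).mul hp)]
  refine lintegral_congr fun x => ?_
  have : ∀ γ : SLZ n, latMk n (γ * latRep x) = x := fun γ => by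
    rw [latMk_mul_left γ.2, latMk_latRep]
  simp only [this]
  rw [ENNReal.tsum_mul_left, h1, mul_one]

/-- The invariant probability measure on the space of lattices is unique. -/
theorem invariant_probability_unique (μ₁ μ₂ : Measure (LatSpace n)) [IsProbabilityMeasure μ₁]
    [IsProbabilityMeasure μ₂] (h₁ : ∀ a : SLR n, μ₁.map (rTranslate n a) = μ₁)
    (h₂ : ∀ a : SLR n, μ₂.map (rTranslate n a) = μ₂) : μ₁ = μ₂ := by
  obtain ⟨p, hpm, hp0, hp1⟩ := exists_pos_weight n
  have key : ∀ (μ : Measure (LatSpace n)) [IsProbabilityMeasure μ],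
      ∫⁻ g, p g ∂(orbitLift μ) = 1 := fun μ _ => by
    have h := lintegral_eq_lintegral_orbitLift μ hpm hp1 (f := fun _ => 1) measurable_const
    simpa using h.symm
  have s₁ : SigmaFinite (orbitLift μ₁) :=
    sigmaFinite_of_pos_of_lintegral_ne_top hpm hp0 (by rw [key]; exact ENNReal.one_ne_top)
  have s₂ : SigmaFinite (orbitLift μ₂) :=
    sigmaFinite_of_pos_of_lintegral_ne_top hpm hp0 (by rw [key]; exact ENNReal.one_ne_top)
  have i₁ := orbitLift_isMulRightInvariant μ₁ h₁
  have i₂ := orbitLift_isMulRightInvariant μ₂ h₂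
  have hne : orbitLift μ₂ ≠ 0 := fun h0 => by
    have := key μ₂
    rw [h0] at this
    simp at this
  obtain ⟨c, hc⟩ := exists_eq_smul_of_isMulRightInvariant (orbitLift μ₁) (orbitLift μ₂) hne
  have hc1 : c = 1 := by
    have h := key μ₁
    rw [hc, lintegral_smul_measure, key μ₂] at h
    simpa using h
  refine Measure.ext_of_lintegral _ fun f hf => ?_
  rw [lintegral_eq_lintegral_orbitLift μ₁ hpm hp1 hf, lintegral_eq_lintegral_orbitLift μ₂ hpm hp1 hf,
    hc, hc1, one_smul]

end Uniqueness

section Hecke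

variable {n : ℕ}

theorem exists_matrix_of_hyperplane (p : ℕ) [Fact p.Prime] (a : Fin n → ZMod p) (ha : a ≠ 0) :
    ∃ b : Matrix (Fin n) (Fin n) ℤ, b.det = p ∧
      ∀ v : Fin n → ℤ, ∑ j, (v j : ZMod p) * a j = 0 ↔ ∃ w : Fin n → ℤ, v = w ᵥ* b := by
  obtain ⟨i, hi⟩ := Function.ne_iff.mp ha
  have hi : a i ≠ 0 := hi
  choose c hc using fun j => ZMod.intCast_surjective (a j * (a i)⁻¹)
  have hca : ∀ j, (c j : ZMod p) * a i = a j := fun j => by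
    rw [hc, mul_assoc, inv_mul_cancel₀ hi, mul_one]
  let u : Fin n → ℤ := fun j => if j = i then p else -c j
  have hui : u i = p := if_pos rfl
  have huj : ∀ j, j ≠ i → u j = -c j := fun j hj => if_neg hj
  have hvm : ∀ (w : Fin n → ℤ) k,
      (w ᵥ* updateCol (1 : Matrix (Fin n) (Fin n) ℤ) i u) k = if k = i then ∑ j, w j * u j else w k := by
    intro w k
    split_ifs with hk
    · subst hk
      simp [vecMul, dotProduct, updateCol_self]
    · simp [vecMul, dotProduct, updateCol_ne hk, Matrix.one_apply]
  have hsum : ∀ w : Fin n → ℤ, ∑ j, w j * u j = w i * p - ∑ j ∈ Finset.univ.erase i, w j * c j := by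
    intro w
    rw [← Finset.add_sum_erase _ _ (Finset.mem_univ i), hui, sub_eq_add_neg, ← Finset.sum_neg_distrib]
    congr 1
    refine Finset.sum_congr rfl fun j hj => ?_
    rw [huj j (Finset.ne_of_mem_erase hj)]; ring
  have hpair : ∀ v : Fin n → ℤ, ∑ j, (v j : ZMod p) * a j =
      ((v i + ∑ j ∈ Finset.univ.erase i, v j * c j : ℤ) : ZMod p) * a i := by
    intro v
    rw [← Finset.add_sum_erase _ _ (Finset.mem_univ i)]
    push_cast
    rw [add_mul, Finset.sum_mul]
    congr 1
    refine Finset.sum_congr rfl fun j _ => ?_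
    rw [mul_assoc, hca]
  refine ⟨updateCol 1 i u, ?_, fun v => ?_⟩
  · have h := cramer_apply (1 : Matrix (Fin n) (Fin n) ℤ) u i
    rw [cramer_one] at h
    rw [← h]; exact hui
  · rw [hpair, mul_eq_zero, or_iff_left hi, ZMod.intCast_zmod_eq_zero_iff_dvd]
    constructor
    · rintro ⟨q, hq⟩
      refine ⟨Function.update v i q, ?_⟩
      funext k
      rw [hvm]
      split_ifs with hk
      · rw [hsum, Function.update_self, hk]
        have : ∑ j ∈ Finset.univ.erase i, Function.update v i q j * c j =
            ∑ j ∈ Finset.univ.erase i, v j * c j := Finset.sum_congr rfl fun j hj => by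
          rw [Function.update_of_ne (Finset.ne_of_mem_erase hj)]
        rw [this]; linarith
      · rw [Function.update_of_ne hk]
    · rintro ⟨w, rfl⟩
      refine ⟨w i, ?_⟩
      rw [hvm, if_pos rfl, hsum]
      have : ∑ j ∈ Finset.univ.erase i, (w ᵥ* updateCol (1 : Matrix (Fin n) (Fin n) ℤ) i u) j * c j =
          ∑ j ∈ Finset.univ.erase i, w j * c j := Finset.sum_congr rfl fun j hj => by
        rw [hvm, if_neg (Finset.ne_of_mem_erase hj)]
      rw [this]; ring

/-- The factor by which a sublattice of index `p` has to be scaled to have covolume one. -/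
noncomputable def heckeScale (n p : ℕ) : ℝ := (p : ℝ) ^ (-(1 / n : ℝ))

theorem heckeScale_pos {p : ℕ} (hp : 0 < p) : 0 < heckeScale n p :=
  Real.rpow_pos_of_pos (by exact_mod_cast hp) _

theorem heckeScale_pow {p : ℕ} (hp : 0 < p) (hn : 0 < n) : heckeScale n p ^ n = (p : ℝ)⁻¹ := by
  have hn' : (n : ℝ) ≠ 0 := by positivity
  rw [heckeScale, ← Real.rpow_natCast, ← Real.rpow_mul (by positivity)]
  rw [show -(1 / n : ℝ) * n = -1 by field_simp, Real.rpow_neg_one]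

theorem exists_heckeElt (p : ℕ) [hp : Fact p.Prime] (a : Fin n → ZMod p) :
    ∃ β : SLR n, a ≠ 0 → ∃ b : Matrix (Fin n) (Fin n) ℤ, b.det = p ∧
      (∀ v : Fin n → ℤ, ∑ j, (v j : ZMod p) * a j = 0 ↔ ∃ w : Fin n → ℤ, v = w ᵥ* b) ∧
      (β : Matrix (Fin n) (Fin n) ℝ) = heckeScale n p • b.map (Int.cast : ℤ → ℝ) := by
  by_cases ha : a = 0
  · exact ⟨1, fun h => absurd ha h⟩
  obtain ⟨b, hb, hb'⟩ := exists_matrix_of_hyperplane p a ha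
  obtain ⟨i, -⟩ := Function.ne_iff.mp ha
  refine ⟨⟨heckeScale n p • b.map (Int.cast : ℤ → ℝ), ?_⟩, fun _ => ⟨b, hb, hb', rfl⟩⟩
  have h := Int.cast_det (R := ℝ) b
  rw [det_smul, Fintype.card_fin, heckeScale_pow hp.out.pos i.pos]
  rw [← Int.cast_det, hb]
  have : (p : ℝ) ≠ 0 := by exact_mod_cast hp.out.ne_zero
  push_cast
  exact inv_mul_cancel₀ this

/-- A matrix taking a lattice to the rescaled sublattice of index `p` cut out by `a`. -/
noncomputable def heckeElt (p : ℕ) [Fact p.Prime] (a : Fin n → ZMod p) : SLR n :=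
  (exists_heckeElt p a).choose

theorem heckeElt_spec (p : ℕ) [Fact p.Prime] {a : Fin n → ZMod p} (ha : a ≠ 0) :
    ∃ b : Matrix (Fin n) (Fin n) ℤ, b.det = p ∧
      (∀ v : Fin n → ℤ, ∑ j, (v j : ZMod p) * a j = 0 ↔ ∃ w : Fin n → ℤ, v = w ᵥ* b) ∧
      (heckeElt p a : Matrix (Fin n) (Fin n) ℝ) = heckeScale n p • b.map (Int.cast : ℤ → ℝ) :=
  (exists_heckeElt p a).choose_spec ha

theorem map_intCast_mul (R : Type*) [CommRing R] (M N : Matrix (Fin n) (Fin n) ℤ) :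
    (M * N).map (Int.cast : ℤ → R) = M.map (Int.cast : ℤ → R) * N.map (Int.cast : ℤ → R) :=
  Matrix.map_mul (f := Int.castRingHom R)

theorem map_intCast_mulVec_mulVec {R : Type*} [CommRing R] {M N : Matrix (Fin n) (Fin n) ℤ}
    (h : M * N = 1) (a : Fin n → R) :
    M.map (Int.cast : ℤ → R) *ᵥ (N.map (Int.cast : ℤ → R) *ᵥ a) = a := by
  rw [mulVec_mulVec, ← map_intCast_mul, h]
  simp

/-- The action of `SL_n(ℤ)` on column vectors modulo `p`. -/
def slzModEquiv (p : ℕ) (γ : SpecialLinearGroup (Fin n) ℤ) :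
    (Fin n → ZMod p) ≃ (Fin n → ZMod p) where
  toFun a := (γ : Matrix (Fin n) (Fin n) ℤ).map (Int.cast : ℤ → ZMod p) *ᵥ a
  invFun a := ((γ⁻¹ : SpecialLinearGroup (Fin n) ℤ) : Matrix (Fin n) (Fin n) ℤ).map
    (Int.cast : ℤ → ZMod p) *ᵥ a
  left_inv a := map_intCast_mulVec_mulVec (congrArg Subtype.val (inv_mul_cancel γ)) a
  right_inv a := map_intCast_mulVec_mulVec (congrArg Subtype.val (mul_inv_cancel γ)) a

theorem slzModEquiv_eq_zero_iff (p : ℕ) (γ : SpecialLinearGroup (Fin n) ℤ) (a : Fin n → ZMod p) :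
    slzModEquiv p γ a = 0 ↔ a = 0 := by
  have h0 : slzModEquiv p γ 0 = 0 :=
    mulVec_zero ((γ : Matrix (Fin n) (Fin n) ℤ).map (Int.cast : ℤ → ZMod p))
  rw [← h0, (slzModEquiv p γ).apply_eq_iff_eq, h0]

theorem latMk_heckeElt_mul (p : ℕ) [hp : Fact p.Prime] (γ : SpecialLinearGroup (Fin n) ℤ)
    {a : Fin n → ZMod p} (ha : a ≠ 0) (g : SLR n) :
    latMk n (heckeElt p (slzModEquiv p γ a) * (SpecialLinearGroup.map (Int.castRingHom ℝ) γ * g)) =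
      latMk n (heckeElt p a * g) := by
  obtain ⟨b, hb, hbv, hβ⟩ := heckeElt_spec p ha
  obtain ⟨b', hb', hbv', hβ'⟩ := heckeElt_spec p ((slzModEquiv_eq_zero_iff p γ a).not.mpr ha)
  have hrow : ∀ i, ∃ w : Fin n → ℤ, (b' * (γ : Matrix (Fin n) (Fin n) ℤ)) i = w ᵥ* b := by
    intro i
    rw [← hbv]
    have h1 := (hbv' (b' i)).mpr ⟨Pi.single i 1, by rw [single_one_vecMul]; rfl⟩
    rw [← h1]
    simp only [slzModEquiv, Equiv.coe_fn_mk, Matrix.mul_apply, mulVec, dotProduct, map_apply]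
    push_cast
    simp only [Finset.sum_mul, Finset.mul_sum]
    rw [Finset.sum_comm]
    simp only [mul_assoc]
  choose w hw using hrow
  have hmul : b' * (γ : Matrix (Fin n) (Fin n) ℤ) = (Matrix.of w) * b := by
    ext i j
    rw [hw i]; rfl
  have hpz : (p : ℤ) ≠ 0 := by exact_mod_cast hp.out.ne_zero
  have hdet : (Matrix.of w).det = 1 := by
    have h := congrArg Matrix.det hmul
    rw [det_mul, det_mul, hb, hb', γ.2, mul_one] at h
    exact mul_right_cancel₀ hpz (by rw [one_mul]; exact h.symm)
  let γ' : SpecialLinearGroup (Fin n) ℤ := ⟨Matrix.of w, hdet⟩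
  have hmulR : b'.map (Int.cast : ℤ → ℝ) * (γ : Matrix (Fin n) (Fin n) ℤ).map (Int.cast : ℤ → ℝ) =
      (Matrix.of w).map (Int.cast : ℤ → ℝ) * b.map (Int.cast : ℤ → ℝ) := by
    rw [← map_intCast_mul, ← map_intCast_mul, hmul]
  have hE : heckeElt p (slzModEquiv p γ a) * SpecialLinearGroup.map (Int.castRingHom ℝ) γ =
      SpecialLinearGroup.map (Int.castRingHom ℝ) γ' * heckeElt p a := by
    apply Subtype.ext
    change (heckeElt p (slzModEquiv p γ a) : Matrix (Fin n) (Fin n) ℝ) *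
      (γ : Matrix (Fin n) (Fin n) ℤ).map (Int.cast : ℤ → ℝ) =
      (Matrix.of w).map (Int.cast : ℤ → ℝ) * (heckeElt p a : Matrix (Fin n) (Fin n) ℝ)
    rw [hβ, hβ', Matrix.smul_mul, Matrix.mul_smul, hmulR]
  rw [← mul_assoc, hE, mul_assoc, latMk_mul_left ⟨γ', rfl⟩]

/-- The average of a function over the rescaled sublattices of index `p`. -/
noncomputable def heckeAvg (p : ℕ) [Fact p.Prime] (f : LatSpace n → ENNReal) (g : SLR n) : ENNReal :=
  ((p : ENNReal) ^ n - 1)⁻¹ * ∑ a ∈ Finset.univ.erase (0 : Fin n → ZMod p),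
    f (latMk n (heckeElt p a * g))

theorem isLatInvariant_heckeAvg (p : ℕ) [Fact p.Prime] (f : LatSpace n → ENNReal) :
    IsLatInvariant (heckeAvg p f) := by
  rintro _ ⟨γ, rfl⟩ g
  rw [heckeAvg, heckeAvg]
  congr 1
  refine (Finset.sum_equiv (slzModEquiv p γ) (fun a => ?_) (fun a ha => ?_)).symm
  · simp [slzModEquiv_eq_zero_iff]
  · rw [latMk_heckeElt_mul p γ (Finset.ne_of_mem_erase ha)]

theorem measurable_heckeAvg (p : ℕ) [Fact p.Prime] {f : LatSpace n → ENNReal} (hf : Measurable f) :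
    Measurable (heckeAvg p f) :=
  (Finset.measurable_fun_sum _ fun a _ =>
    hf.comp (measurable_latMk.comp (measurable_const_mul (heckeElt p a)))).const_mul _

/-- The image of a measure under the Hecke correspondence of degree `p`. -/
noncomputable def heckeMeasure (p : ℕ) [Fact p.Prime] (μ : Measure (LatSpace n)) :
    Measure (LatSpace n) :=
  μ.bind fun x => ((p : ENNReal) ^ n - 1)⁻¹ • ∑ a ∈ Finset.univ.erase (0 : Fin n → ZMod p),
    Measure.dirac (latMk n (heckeElt p a * latRep x))

theorem lintegral_heckeMeasure (p : ℕ) [Fact p.Prime] (μ : Measure (LatSpace n))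
    {f : LatSpace n → ENNReal} (hf : Measurable f) :
    ∫⁻ x, f x ∂(heckeMeasure p μ) = ∫⁻ x, heckeAvg p f (latRep x) ∂μ := by
  have key : ∀ f : LatSpace n → ENNReal, Measurable f → ∀ x : LatSpace n,
      ∫⁻ y, f y ∂(((p : ENNReal) ^ n - 1)⁻¹ • ∑ a ∈ Finset.univ.erase (0 : Fin n → ZMod p),
        Measure.dirac (latMk n (heckeElt p a * latRep x))) = heckeAvg p f (latRep x) := by
    intro f hf x
    rw [lintegral_smul_measure, lintegral_finsetSum_measure, heckeAvg, smul_eq_mul]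
    simp only [lintegral_dirac' _ hf]
  rw [heckeMeasure, Measure.lintegral_bind _ hf.aemeasurable]
  · simp only [key f hf]
  · refine (Measure.measurable_of_measurable_coe _ fun s hs => ?_).aemeasurable
    simp only [← lintegral_indicator_one hs, key _ (measurable_one.indicator hs)]
    exact (isLatInvariant_heckeAvg p _).measurable
      (measurable_heckeAvg p (measurable_one.indicator hs))

/-- Averaging over sublattices of index `p` does not change the mean with respect to the
invariant probability measure. -/
theorem lintegral_heckeAvg (p : ℕ) [hp : Fact p.Prime] (hn : 0 < n) (μ : Measure (LatSpace n))
    [IsProbabilityMeasure μ] (hinv : ∀ a : SLR n, μ.map (rTranslate n a) = μ)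
    {f : LatSpace n → ENNReal} (hf : Measurable f) :
    ∫⁻ x, heckeAvg p f (latRep x) ∂μ = ∫⁻ x, f x ∂μ := by
  have h1 : ∀ g : SLR n, heckeAvg p (fun _ => 1) g = 1 := by
    intro g
    rw [heckeAvg, Finset.sum_const, Finset.card_erase_of_mem (Finset.mem_univ _), Finset.card_univ,
      Fintype.card_fun, ZMod.card, Fintype.card_fin, nsmul_eq_mul, mul_one]
    have hc : ((p ^ n - 1 : ℕ) : ENNReal) = (p : ENNReal) ^ n - 1 := by push_cast; rfl
    rw [hc]
    refine ENNReal.inv_mul_cancel ?_ ?_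
    · exact (tsub_pos_of_lt (by exact_mod_cast Nat.one_lt_pow hn.ne' hp.out.one_lt)).ne'
    · exact ENNReal.sub_ne_top (by simp)
  have hprob : IsProbabilityMeasure (heckeMeasure p μ) := ⟨by
    have h := lintegral_heckeMeasure p μ (f := fun _ => 1) measurable_const
    simpa [h1] using h⟩
  have hinv' : ∀ a : SLR n, (heckeMeasure p μ).map (rTranslate n a) = heckeMeasure p μ := by
    intro a
    refine Measure.ext_of_lintegral _ fun f hf => ?_
    rw [lintegral_map hf (measurable_rTranslate a),
      lintegral_heckeMeasure p μ (f := fun x => f (rTranslate n a x))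
        (hf.comp (measurable_rTranslate a)), lintegral_heckeMeasure p μ hf]
    conv_rhs => rw [← hinv a]
    have hi := isLatInvariant_heckeAvg p f
    rw [lintegral_map (hi.measurable (measurable_heckeAvg p hf)) (measurable_rTranslate a)]
    refine lintegral_congr fun x => ?_
    rw [hi.rTranslate]
    simp only [heckeAvg, rTranslate_latMk, mul_assoc]
  rw [← lintegral_heckeMeasure p μ hf, invariant_probability_unique _ μ hinv' hinv]

end Hecke

section LinearIndependence

variable {n r : ℕ}

theorem exists_det_submatrix_ne_zero {K : Type*} [Field K] {A : Matrix (Fin r) (Fin n) K}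
    (hA : LinearIndependent K A.row) : ∃ e : Fin r → Fin n, (A.submatrix id e).det ≠ 0 := by
  have hr : Module.finrank K (Submodule.span K (Set.range A.col)) = r := by
    rw [← rank_eq_finrank_span_cols, hA.rank_matrix, Fintype.card_fin]
  obtain ⟨c, hc, -, hli⟩ := Submodule.exists_fun_fin_finrank_span_eq K (Set.range A.col)
  choose e he using hc
  refine ⟨fun i => e (Fin.cast hr.symm i), fun h0 => ?_⟩
  have h1 : LinearIndependent K (fun i : Fin r => c (Fin.cast hr.symm i)) :=
    hli.comp _ (Fin.cast_injective _)
  have h2 : (A.submatrix id fun i => e (Fin.cast hr.symm i)).col =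
      fun i : Fin r => c (Fin.cast hr.symm i) := by
    funext i
    rw [← he]
    rfl
  rw [← h2, Matrix.linearIndependent_cols_iff_isUnit, Matrix.isUnit_iff_isUnit_det, h0] at h1
  exact not_isUnit_zero h1

theorem linearIndependent_of_det_submatrix_ne_zero {K : Type*} [Field K]
    {A : Matrix (Fin r) (Fin n) K} (e : Fin r → Fin n) (h : (A.submatrix id e).det ≠ 0) :
    LinearIndependent K A.row := by
  have h1 : LinearIndependent K (A.submatrix id e).row := by
    rw [Matrix.linearIndependent_rows_iff_isUnit, Matrix.isUnit_iff_isUnit_det]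
    exact h.isUnit
  exact LinearIndependent.of_comp (LinearMap.funLeft K K e) h1

theorem ae_linearIndependent (h : r ≤ n) :
    ∀ᵐ X : Fin r → Fin n → ℝ, LinearIndependent ℝ X := by
  induction r with
  | zero => exact Filter.Eventually.of_forall fun X => linearIndependent_empty_type
  | succ r ih =>
    have ih := ih (by omega)
    have hmp := volume_preserving_piFinSuccAbove (fun _ : Fin (r + 1) => Fin n → ℝ) 0
    have hopen : MeasurableSet {X : Fin (r + 1) → Fin n → ℝ | LinearIndependent ℝ X} :=
      isOpen_setOfPred_linearIndependent.measurableSet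
    let s : Set ((Fin n → ℝ) × (Fin r → Fin n → ℝ)) :=
      (MeasurableEquiv.piFinSuccAbove (fun _ : Fin (r + 1) => Fin n → ℝ) 0).symm ⁻¹'
        {X | LinearIndependent ℝ X}ᶜ
    have hs : MeasurableSet s := (MeasurableEquiv.measurable _) hopen.compl
    have hsz : volume s = 0 := by
      rw [Measure.volume_eq_prod, Measure.prod_apply_symm hs]
      rw [lintegral_eq_zero_iff (measurable_measure_prodMk_right hs)]
      filter_upwards [ih] with v hv
      have hne : Submodule.span ℝ (Set.range v) ≠ ⊤ := by
        intro ht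
        have := finrank_span_eq_card hv
        rw [ht, finrank_top, Module.finrank_fin_fun, Fintype.card_fin] at this
        omega
      refine measure_mono_null ?_ (Measure.addHaar_submodule volume _ hne)
      intro x hx
      by_contra hx'
      refine hx ?_
      have := linearIndependent_finCons.mpr ⟨hv, hx'⟩
      simpa [MeasurableEquiv.piFinSuccAbove, Fin.consEquiv] using this
    have := hmp.measure_preimage hs.nullMeasurableSet
    rw [hsz] at this
    refine measure_mono_null ?_ this
    intro X hX
    rw [Set.mem_preimage, Set.mem_preimage, MeasurableEquiv.symm_apply_apply]
    exact hX

theorem card_ker_mod (p : ℕ) [hp : Fact p.Prime] (A : Matrix (Fin r) (Fin n) (ZMod p))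
    (hA : LinearIndependent (ZMod p) A.row) :
    (Finset.univ.filter fun a : Fin n → ZMod p => A *ᵥ a = 0).card = p ^ (n - r) := by
  have h1 : Module.finrank (ZMod p) (LinearMap.ker A.mulVecLin) = n - r := by
    have h2 := A.mulVecLin.finrank_range_add_finrank_ker
    have h3 : Module.finrank (ZMod p) A.mulVecLin.range = r := by
      have := hA.rank_matrix
      rwa [Fintype.card_fin] at this
    rw [h3, Module.finrank_fin_fun] at h2
    omega
  have h2 := Module.card_eq_pow_finrank (K := ZMod p) (V := LinearMap.ker A.mulVecLin)
  rw [h1, ZMod.card] at h2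
  rw [← h2, Fintype.card_subtype]
  congr 1
  ext a
  simp

end LinearIndependence

section TupleOrbits

variable {n r : ℕ}

theorem linearIndependent_mod (p : ℕ) [hp : Fact p.Prime] {N : Fin r → Fin n → ℤ} {B : ℝ}
    (hN : LinearIndependent ℝ (fun i j => (N i j : ℝ))) (hB : ∀ i j, |(N i j : ℝ)| ≤ B)
    (hp' : r ! * B ^ r < p) :
    LinearIndependent (ZMod p) (Matrix.of fun i j => (N i j : ZMod p)).row := by
  obtain ⟨e, he⟩ := exists_det_submatrix_ne_zero
    (A := (Matrix.of fun i j => (N i j : ℝ))) hN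
  refine linearIndependent_of_det_submatrix_ne_zero e fun h0 => ?_
  let D : Matrix (Fin r) (Fin r) ℤ := Matrix.of fun i j => N i (e j)
  have h1 : (D.det : ZMod p) = 0 := by
    have := (Int.castRingHom (ZMod p)).map_det D
    rw [eq_intCast] at this
    rw [this, ← h0]
    rfl
  have h2 : (D.det : ℝ) ≠ 0 := by
    have := (Int.castRingHom ℝ).map_det D
    rw [eq_intCast] at this
    rw [this]
    exact he
  have h3 : |(D.det : ℝ)| ≤ r ! * B ^ r := by
    have := (Int.castRingHom ℝ).map_det D
    rw [eq_intCast] at this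
    rw [this]
    have h4 := Matrix.det_le (A := (Int.castRingHom ℝ).mapMatrix D) (abv := AbsoluteValue.abs)
      (x := B) (fun i j => hB i (e j))
    simpa using h4
  rw [ZMod.intCast_zmod_eq_zero_iff_dvd] at h1
  have h5 : (p : ℤ) ≤ |D.det| := Int.le_of_dvd (abs_pos.mpr (by exact_mod_cast h2))
    ((dvd_abs _ _).mpr h1)
  have h6 : (p : ℝ) ≤ |(D.det : ℝ)| := by exact_mod_cast h5
  linarith

theorem lintegral_comp_floor (K : (Fin r → Fin n → ℤ) → ENNReal) :
    ∫⁻ x : Fin r → Fin n → ℝ, K (fun i j => ⌊x i j⌋) = ∑' N, K N := by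
  have hF : Measurable fun (x : Fin r → Fin n → ℝ) (i : Fin r) (j : Fin n) => ⌊x i j⌋ := by
    refine measurable_pi_lambda _ fun i => measurable_pi_lambda _ fun j => ?_
    exact Int.measurable_floor.comp ((measurable_pi_apply j).comp (measurable_pi_apply i))
  rw [← lintegral_map (μ := volume) (f := K) (measurable_of_countable _) hF, lintegral_countable']
  refine tsum_congr fun N => ?_
  rw [Measure.map_apply hF (measurableSet_singleton _)]
  have : (fun (x : Fin r → Fin n → ℝ) (i : Fin r) (j : Fin n) => ⌊x i j⌋) ⁻¹' {N} =
      Set.univ.pi fun i => Set.univ.pi fun j => Set.Ico (N i j : ℝ) (N i j + 1) := by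
    ext x
    simp [funext_iff, Int.floor_eq_iff]
  rw [this, volume_pi_pi]
  simp [volume_pi_pi]

theorem lintegral_comp_smul_pi {H : (Fin r → Fin n → ℝ) → ENNReal} (hH : Measurable H) {t : ℝ}
    (ht : 0 < t) :
    ENNReal.ofReal t ^ (r * n) * ∫⁻ x, H (t • x) = ∫⁻ x, H x := by
  have h1 : Measurable fun x : Fin r → Fin n → ℝ => t • x := measurable_const_smul t
  rw [← lintegral_map hH h1, Measure.map_addHaar_smul volume ht.ne', lintegral_smul_measure,
    smul_eq_mul, ← mul_assoc, ← ENNReal.ofReal_pow ht.le, ← ENNReal.ofReal_mul (by positivity)]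
  have h2 : Module.finrank ℝ (Fin r → Fin n → ℝ) = r * n := by simp [Module.finrank_pi_fintype]
  rw [h2, abs_of_pos (by positivity), mul_inv_cancel₀ (by positivity)]
  simp

theorem tendsto_riemann_sum {H : (Fin r → Fin n → ℝ) → ENNReal} (hm : Measurable H)
    {C : ENNReal} (hC : C ≠ ⊤) (hHC : ∀ X, H X ≤ C) {R : ℝ}
    (hR : ∀ X, H X ≠ 0 → ∀ i j, |X i j| ≤ R) (hcont : ∀ᵐ X, ContinuousAt H X)
    {t : ℕ → ℝ} (ht : ∀ k, 0 < t k) (ht0 : Filter.Tendsto t Filter.atTop (nhds 0)) :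
    Filter.Tendsto (fun k => ENNReal.ofReal (t k) ^ (r * n) *
      ∑' N : Fin r → Fin n → ℤ, H (fun i j => t k * N i j)) Filter.atTop
      (nhds (∫⁻ X, H X)) := by
  let F : ℕ → (Fin r → Fin n → ℝ) → (Fin r → Fin n → ℝ) :=
    fun k x i j => t k * ⌊(t k)⁻¹ * x i j⌋
  have hFm : ∀ k, Measurable (F k) := by
    intro k
    refine measurable_pi_lambda _ fun i => measurable_pi_lambda _ fun j => ?_
    have h1 : Measurable fun x : Fin r → Fin n → ℝ => ⌊(t k)⁻¹ * x i j⌋ := by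
      refine Int.measurable_floor.comp ?_
      have h2 : Measurable fun x : Fin r → Fin n → ℝ => x i j :=
        (measurable_pi_apply j).comp (measurable_pi_apply i)
      exact h2.const_mul _
    exact ((measurable_from_top (f := fun z : ℤ => (z : ℝ))).comp h1).const_mul _
  have h1 : ∀ k, ENNReal.ofReal (t k) ^ (r * n) *
      ∑' N : Fin r → Fin n → ℤ, H (fun i j => t k * N i j) = ∫⁻ x, H (F k x) := by
    intro k
    rw [← lintegral_comp_smul_pi (H := fun x => H (F k x)) (hm.comp (hFm k)) (ht k),
      ← lintegral_comp_floor fun N => H (fun i j => t k * N i j)]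
    congr 1
    refine lintegral_congr fun x => ?_
    simp only [F, Pi.smul_apply, smul_eq_mul, inv_mul_cancel_left₀ (ht k).ne']
  simp only [h1]
  have hclose : ∀ k x i j, |F k x i j - x i j| ≤ t k := by
    intro k x i j
    have ha := Int.floor_le ((t k)⁻¹ * x i j)
    have hb := Int.lt_floor_add_one ((t k)⁻¹ * x i j)
    have hx : x i j = t k * ((t k)⁻¹ * x i j) := by rw [mul_inv_cancel_left₀ (ht k).ne']
    have := ht k
    rw [abs_le]
    simp only [F]
    constructor <;> nlinarith
  let box : Set (Fin r → Fin n → ℝ) :=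
    Set.univ.pi fun _ => Set.univ.pi fun _ => Set.Icc (-(R + 1)) (R + 1)
  have hbox : MeasurableSet box :=
    MeasurableSet.univ_pi fun _ => MeasurableSet.univ_pi fun _ => measurableSet_Icc
  refine tendsto_lintegral_filter_of_dominated_convergence (box.indicator fun _ => C) ?_ ?_ ?_ ?_
  · exact Filter.Eventually.of_forall fun k => hm.comp (hFm k)
  · filter_upwards [ht0.eventually (gt_mem_nhds one_pos)] with k hk
    refine Filter.Eventually.of_forall fun x => ?_
    by_cases h0 : H (F k x) = 0
    · rw [h0]; exact zero_le
    · rw [Set.indicator_of_mem]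
      · exact hHC _
      · intro i _ j _
        have h2 := abs_le.mp (hR _ h0 i j)
        have h3 := abs_le.mp (hclose k x i j)
        constructor <;> linarith
  · rw [lintegral_indicator_const hbox]
    refine ENNReal.mul_ne_top hC ?_
    simp only [box]
    rw [volume_pi_pi]
    simp only [volume_pi_pi, Real.volume_Icc]
    exact ENNReal.prod_ne_top fun i _ => ENNReal.prod_ne_top fun j _ => ENNReal.ofReal_ne_top
  · filter_upwards [hcont] with x hx
    refine hx.tendsto.comp ?_
    refine tendsto_pi_nhds.mpr fun i => tendsto_pi_nhds.mpr fun j => ?_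
    rw [tendsto_iff_norm_sub_tendsto_zero]
    exact squeeze_zero (fun _ => norm_nonneg _) (fun k => hclose k x i j) ht0

end TupleOrbits

section HeckeTuples

variable {n r : ℕ}

/-- The tuple of row vectors obtained by multiplying every vector of a tuple by a matrix. -/
def rowMul (A : Matrix (Fin n) (Fin n) ℝ) (X : Fin r → Fin n → ℝ) : Fin r → Fin n → ℝ :=
  fun i => X i ᵥ* A

/-- The real tuple underlying an integral tuple. -/
def castMat (N : Fin r → Fin n → ℤ) : Fin r → Fin n → ℝ := fun i j => N i j

theorem rowMul_mul (A B : Matrix (Fin n) (Fin n) ℝ) (X : Fin r → Fin n → ℝ) :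
    rowMul (A * B) X = rowMul B (rowMul A X) := by
  funext i
  simp [rowMul, vecMul_vecMul]

theorem rowMul_smul_left (A : Matrix (Fin n) (Fin n) ℝ) (t : ℝ) (X : Fin r → Fin n → ℝ) :
    rowMul (t • A) X = t • rowMul A X := by
  funext i
  simp [rowMul, vecMul_smul]

theorem continuous_rowMul (A : Matrix (Fin n) (Fin n) ℝ) :
    Continuous (rowMul A : (Fin r → Fin n → ℝ) → _) :=
  continuous_pi fun i => (continuous_apply i).matrix_vecMul continuous_const

theorem measurable_rowMul_left (X : Fin r → Fin n → ℝ) :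
    Measurable fun g : SLR n => rowMul (g : Matrix (Fin n) (Fin n) ℝ) X := by
  refine measurable_pi_lambda _ fun i => measurable_pi_lambda _ fun j => ?_
  change Measurable fun g : SLR n => ∑ k, X i k * (g : Matrix (Fin n) (Fin n) ℝ) k j
  exact Finset.measurable_fun_sum _ fun k _ => (measurable_slr_apply k j).const_mul _

theorem linearIndependent_rowMul {A : Matrix (Fin n) (Fin n) ℝ} (hA : A.det ≠ 0)
    {X : Fin r → Fin n → ℝ} :
    LinearIndependent ℝ (rowMul A X) ↔ LinearIndependent ℝ X := by
  have hinj : Function.Injective A.vecMulLinear :=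
    Matrix.vecMul_injective_of_isUnit (A.isUnit_iff_isUnit_det.mpr hA.isUnit)
  exact LinearMap.linearIndependent_iff A.vecMulLinear (LinearMap.ker_eq_bot.mpr hinj)

theorem measurePreserving_rowMul {A : Matrix (Fin n) (Fin n) ℝ} (hA : A.det = 1) :
    MeasurePreserving (rowMul A : (Fin r → Fin n → ℝ) → _) := by
  suffices hs : MeasurePreserving (fun x : Fin n → ℝ => x ᵥ* A) volume volume from
    volume_preserving_pi fun _ : Fin r => hs
  have h : Measure.map (toLin' Aᵀ) volume = _ :=
    Real.map_matrix_volume_pi_eq_smul_volume_pi (by simp [hA])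
  have h2 : (fun x : Fin n → ℝ => x ᵥ* A) = toLin' Aᵀ := by
    funext x
    simp [mulVec_transpose]
  rw [h2]
  refine ⟨LinearMap.continuous_on_pi (toLin' Aᵀ) |>.measurable, ?_⟩
  rw [h]
  simp [hA]

/-- The sum of a function over all linearly independent `r`-tuples in the lattice `ℤ^n g`. -/
noncomputable def latSum (G : (Fin r → Fin n → ℝ) → ENNReal) (g : SLR n) : ENNReal :=
  ∑' N : Fin r → Fin n → ℤ, if LinearIndependent ℝ (castMat N) then
    G (rowMul (g : Matrix (Fin n) (Fin n) ℝ) (castMat N)) else 0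

theorem tsum_linearIndependent_rowMul {b : Matrix (Fin n) (Fin n) ℤ} (hb : b.det ≠ 0)
    (H : (Fin r → Fin n → ℝ) → ENNReal) :
    (∑' N : Fin r → Fin n → ℤ, if LinearIndependent ℝ (castMat N) then
      H (rowMul (b.map (Int.cast : ℤ → ℝ)) (castMat N)) else 0) =
    ∑' N : Fin r → Fin n → ℤ, if LinearIndependent ℝ (castMat N) ∧
      ∀ i, ∃ w : Fin n → ℤ, N i = w ᵥ* b then H (castMat N) else 0 := by
  let q : (Fin r → Fin n → ℤ) → (Fin r → Fin n → ℤ) := fun N i => N i ᵥ* b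
  have hbR : (b.map (Int.cast : ℤ → ℝ)).det ≠ 0 := by
    have := (Int.castRingHom ℝ).map_det b
    rw [eq_intCast] at this
    change ((Int.castRingHom ℝ).mapMatrix b).det ≠ 0
    rw [← this]
    exact_mod_cast hb
  have hinj : Function.Injective q := by
    intro N N' h
    funext i
    have := congrFun h i
    have h2 : (N i - N' i) ᵥ* b = 0 := by rw [sub_vecMul, sub_eq_zero]; exact this
    exact sub_eq_zero.mp (eq_zero_of_vecMul_eq_zero hb h2)
  have hq : ∀ N, castMat (q N) = rowMul (b.map (Int.cast : ℤ → ℝ)) (castMat N) := by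
    intro N
    funext i j
    simp [castMat, q, rowMul, vecMul, dotProduct]
  refine Eq.trans ?_ (hinj.tsum_eq (f := fun N : Fin r → Fin n → ℤ =>
    if LinearIndependent ℝ (castMat N) ∧
      ∀ i, ∃ w : Fin n → ℤ, N i = w ᵥ* b then H (castMat N) else 0) ?_)
  · refine tsum_congr fun N => ?_
    rw [hq, linearIndependent_rowMul hbR]
    have : ∀ i, ∃ w : Fin n → ℤ, q N i = w ᵥ* b := fun i => ⟨N i, rfl⟩
    by_cases hA : LinearIndependent ℝ (castMat N) <;> simp [hA, this]
  · intro N hN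
    have h1 : ∀ i, ∃ w : Fin n → ℤ, N i = w ᵥ* b := by
      by_contra h
      exact hN (if_neg fun h' => h (And.right h'))
    choose w hw using h1
    exact ⟨w, funext fun i => (hw i).symm⟩

theorem isLatInvariant_latSum (G : (Fin r → Fin n → ℝ) → ENNReal) :
    IsLatInvariant (latSum G) := by
  rintro _ ⟨γ, rfl⟩ g
  have h := tsum_linearIndependent_rowMul (b := (γ : Matrix (Fin n) (Fin n) ℤ))
    (by rw [γ.det_coe]; exact one_ne_zero)
    (fun X => G (rowMul (g : Matrix (Fin n) (Fin n) ℝ) X))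
  have h1 : ∀ (N : Fin r → Fin n → ℤ) (i : Fin r), ∃ w : Fin n → ℤ,
      N i = w ᵥ* (γ : Matrix (Fin n) (Fin n) ℤ) := by
    intro N i
    refine ⟨N i ᵥ* ((γ⁻¹ : SpecialLinearGroup (Fin n) ℤ) : Matrix (Fin n) (Fin n) ℤ), ?_⟩
    rw [vecMul_vecMul]
    have : ((γ⁻¹ : SpecialLinearGroup (Fin n) ℤ) : Matrix (Fin n) (Fin n) ℤ) * γ = 1 :=
      congrArg Subtype.val (inv_mul_cancel γ)
    rw [this, vecMul_one]
  simp only [h1, implies_true, and_true, ← rowMul_mul] at h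
  exact h

theorem measurable_latSum {G : (Fin r → Fin n → ℝ) → ENNReal} (hG : Measurable G) :
    Measurable (latSum G) := by
  refine Measurable.tsum fun N => ?_
  by_cases h : LinearIndependent ℝ (castMat N)
  · simp only [h, if_true]
    exact hG.comp (measurable_rowMul_left _)
  · simp [h]

theorem heckeAvg_latSum (p : ℕ) [hp : Fact p.Prime] (G : (Fin r → Fin n → ℝ) → ENNReal)
    (g : SLR n) :
    heckeAvg p (fun x => latSum G (latRep x)) g = ((p : ENNReal) ^ n - 1)⁻¹ *
      ∑' N : Fin r → Fin n → ℤ, if LinearIndependent ℝ (castMat N) then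
        (((Finset.univ.filter fun a : Fin n → ZMod p =>
          (Matrix.of fun i j => (N i j : ZMod p)) *ᵥ a = 0).card - 1 : ℕ) : ENNReal) *
          G (rowMul (g : Matrix (Fin n) (Fin n) ℝ) (heckeScale n p • castMat N)) else 0 := by
  have h1 : ∀ a ∈ Finset.univ.erase (0 : Fin n → ZMod p),
      latSum G (latRep (latMk n (heckeElt p a * g))) =
      ∑' N : Fin r → Fin n → ℤ, if (Matrix.of fun i j => (N i j : ZMod p)) *ᵥ a = 0 then
        (if LinearIndependent ℝ (castMat N) then
          G (rowMul (g : Matrix (Fin n) (Fin n) ℝ) (heckeScale n p • castMat N)) else 0)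
        else 0 := by
    intro a ha
    obtain ⟨b, hb, hbv, hβ⟩ := heckeElt_spec p (Finset.ne_of_mem_erase ha)
    rw [(isLatInvariant_latSum G).latRep_latMk]
    have h2 : ∀ X : Fin r → Fin n → ℝ,
        rowMul ((heckeElt p a * g : SLR n) : Matrix (Fin n) (Fin n) ℝ) X =
        rowMul (g : Matrix (Fin n) (Fin n) ℝ)
          (heckeScale n p • rowMul (b.map (Int.cast : ℤ → ℝ)) X) := by
      intro X
      change rowMul ((heckeElt p a : Matrix (Fin n) (Fin n) ℝ) *
        (g : Matrix (Fin n) (Fin n) ℝ)) X = _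
      rw [rowMul_mul, hβ, rowMul_smul_left]
    simp only [latSum, h2]
    rw [tsum_linearIndependent_rowMul (b := b)
      (by rw [hb]; exact_mod_cast hp.out.ne_zero)
      (fun X => G (rowMul (g : Matrix (Fin n) (Fin n) ℝ) (heckeScale n p • X)))]
    refine tsum_congr fun N => ?_
    have h3 : (∀ i, ∃ w : Fin n → ℤ, N i = w ᵥ* b) ↔
        (Matrix.of fun i j => (N i j : ZMod p)) *ᵥ a = 0 := by
      rw [funext_iff]
      exact forall_congr' fun i => (hbv (N i)).symm
    by_cases hA : LinearIndependent ℝ (castMat N) <;>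
      by_cases hB : (Matrix.of fun i j => (N i j : ZMod p)) *ᵥ a = 0 <;> simp [hA, hB, h3]
  rw [heckeAvg, Finset.sum_congr rfl h1,
    ← Summable.tsum_finsetSum fun _ _ => ENNReal.summable]
  congr 1
  refine tsum_congr fun N => ?_
  by_cases hA : LinearIndependent ℝ (castMat N)
  · simp only [hA, if_true]
    rw [← Finset.sum_filter, Finset.sum_const, nsmul_eq_mul, Finset.filter_erase,
      Finset.card_erase_of_mem]
    simp
  · simp [hA]

end HeckeTuples

section HeckeLimits

variable {n r : ℕ}

theorem tendsto_heckeScale (hn : 0 < n) {p : ℕ → ℕ} (hp : Filter.Tendsto p Filter.atTop Filter.atTop) :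
    Filter.Tendsto (fun k => heckeScale n (p k)) Filter.atTop (nhds 0) := by
  have h : (0 : ℝ) < 1 / n := by positivity
  exact (tendsto_rpow_neg_atTop h).comp (tendsto_natCast_atTop_atTop.comp hp)

theorem exists_bound_of_rowMul (g : SLR n) (R : ℝ) : ∃ R' : ℝ, 0 ≤ R' ∧ ∀ X : Fin r → Fin n → ℝ,
    (∀ i j, |rowMul (g : Matrix (Fin n) (Fin n) ℝ) X i j| ≤ R) → ∀ i j, |X i j| ≤ R' := by
  let a : Matrix (Fin n) (Fin n) ℝ := ((g⁻¹ : SLR n) : Matrix (Fin n) (Fin n) ℝ)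
  have ha : (g : Matrix (Fin n) (Fin n) ℝ) * a = 1 := congrArg Subtype.val (mul_inv_cancel g)
  refine ⟨|R| * ∑ k, ∑ j, |a k j|, by positivity, fun X hX i j => ?_⟩
  have h1 : X i j = ∑ k, rowMul (g : Matrix (Fin n) (Fin n) ℝ) X i k * a k j := by
    have : rowMul a (rowMul (g : Matrix (Fin n) (Fin n) ℝ) X) = X := by
      rw [← rowMul_mul, ha]
      funext i
      simp [rowMul]
    conv_lhs => rw [← this]
    rfl
  rw [h1, Finset.mul_sum]
  refine (Finset.abs_sum_le_sum_abs _ _).trans (Finset.sum_le_sum fun k _ => ?_)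
  rw [abs_mul]
  refine mul_le_mul ((hX i k).trans (le_abs_self R)) ?_ (abs_nonneg _) (abs_nonneg _)
  exact Finset.single_le_sum (f := fun j => |a k j|) (fun _ _ => abs_nonneg _) (Finset.mem_univ j)

theorem linearIndependent_pos_smul {t : ℝ} (ht : 0 < t) (X : Fin r → Fin n → ℝ) :
    LinearIndependent ℝ (t • X) ↔ LinearIndependent ℝ X := by
  have := LinearIndependent.units_smul_iff (w := fun _ : Fin r => Units.mk0 t ht.ne') (v := X)
  exact this

/-- The ratio of the number of nonzero solutions of `r` independent linear equations modulo `p`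
to the number of all nonzero vectors, normalized by `p ^ r`. -/
noncomputable def heckeRatio (n r p : ℕ) : ℝ :=
  (1 - ((p : ℝ)⁻¹) ^ (n - r)) / (1 - ((p : ℝ)⁻¹) ^ n)

theorem heckeRatio_eq {p : ℕ} (hp : p.Prime) (hr : r < n) :
    ((p : ENNReal) ^ n - 1)⁻¹ * ((p ^ (n - r) - 1 : ℕ) : ENNReal) =
      ENNReal.ofReal (heckeRatio n r p) * ENNReal.ofReal (heckeScale n p) ^ (r * n) := by
  have hp1 : (1 : ℝ) < p := by exact_mod_cast hp.one_lt
  have hpos := heckeScale_pos (n := n) hp.pos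
  have hq : (p : ℝ)⁻¹ < 1 := inv_lt_one_of_one_lt₀ hp1
  have hq0 : (0 : ℝ) ≤ (p : ℝ)⁻¹ := by positivity
  have hn1 : (1 : ℝ) < (p : ℝ) ^ n := one_lt_pow₀ hp1 (by omega)
  have hr1 : (1 : ℝ) ≤ (p : ℝ) ^ (n - r) := one_le_pow₀ hp1.le
  have hratio : 0 ≤ heckeRatio n r p := by
    refine div_nonneg ?_ ?_ <;> exact sub_nonneg.mpr (pow_le_one₀ hq0 hq.le)
  rw [← ENNReal.ofReal_pow hpos.le, ← ENNReal.ofReal_mul hratio, mul_comm r n, pow_mul,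
    heckeScale_pow hp.pos (by omega)]
  have h1 : (p : ENNReal) ^ n - 1 = ENNReal.ofReal ((p : ℝ) ^ n - 1) := by
    rw [ENNReal.ofReal_sub _ zero_le_one, ENNReal.ofReal_pow (by positivity)]
    simp
  have h2 : ((p ^ (n - r) - 1 : ℕ) : ENNReal) = ENNReal.ofReal ((p : ℝ) ^ (n - r) - 1) := by
    rw [← ENNReal.ofReal_natCast, Nat.cast_sub (Nat.one_le_pow _ _ hp.pos)]
    simp
  rw [h1, h2, ← ENNReal.ofReal_inv_of_pos (by linarith), ← ENNReal.ofReal_mul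
    (inv_nonneg.mpr (by linarith))]
  congr 1
  have h3 : (p : ℝ) ^ n = (p : ℝ) ^ (n - r) * (p : ℝ) ^ r := by
    rw [← pow_add]
    congr 1
    omega
  have hp0 : (p : ℝ) ≠ 0 := by positivity
  rw [heckeRatio, inv_pow, inv_pow, inv_pow]
  have h4 : (p : ℝ) ^ (n - r) * (p : ℝ) ^ r - 1 ≠ 0 := by rw [← h3]; linarith
  have h5 : 1 - ((p : ℝ) ^ (n - r) * (p : ℝ) ^ r)⁻¹ ≠ 0 := by
    rw [← h3]
    have := inv_lt_one_of_one_lt₀ hn1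
    linarith
  rw [h3]
  field_simp

theorem tendsto_heckeRatio (hr : r < n) {p : ℕ → ℕ}
    (hp : Filter.Tendsto p Filter.atTop Filter.atTop) :
    Filter.Tendsto (fun k => ENNReal.ofReal (heckeRatio n r (p k))) Filter.atTop (nhds 1) := by
  have h0 : Filter.Tendsto (fun k => ((p k : ℝ))⁻¹) Filter.atTop (nhds 0) :=
    tendsto_inv_atTop_zero.comp (tendsto_natCast_atTop_atTop.comp hp)
  have h1 : ∀ m, 0 < m → Filter.Tendsto (fun k => 1 - ((p k : ℝ))⁻¹ ^ m) Filter.atTop (nhds 1) := by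
    intro m hm
    have := (h0.pow m).const_sub 1
    rwa [zero_pow hm.ne', sub_zero] at this
  have h2 := ENNReal.tendsto_ofReal ((h1 (n - r) (by omega)).div (h1 n (by omega)) one_ne_zero)
  simpa [heckeRatio] using h2

theorem tendsto_heckeAvg_latSum (hr : r < n) {G : (Fin r → Fin n → ℝ) → ENNReal}
    (hG : Continuous G) {C : ENNReal} (hC : C ≠ ⊤) (hGC : ∀ X, G X ≤ C) {R : ℝ}
    (hR : ∀ X, G X ≠ 0 → ∀ i j, |X i j| ≤ R) (g : SLR n) {p : ℕ → ℕ}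
    (hp : ∀ k, Fact (p k).Prime) (hpt : Filter.Tendsto p Filter.atTop Filter.atTop) :
    Filter.Tendsto (fun k => heckeAvg (p k) (fun x => latSum G (latRep x)) g) Filter.atTop
      (nhds (∫⁻ X, G X)) := by
  have hn : 0 < n := by omega
  have hdet : (g : Matrix (Fin n) (Fin n) ℝ).det = 1 := g.2
  have hcr := continuous_rowMul (r := r) (g : Matrix (Fin n) (Fin n) ℝ)
  let H : (Fin r → Fin n → ℝ) → ENNReal := fun X => if LinearIndependent ℝ X then
    G (rowMul (g : Matrix (Fin n) (Fin n) ℝ) X) else 0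
  have hopen : IsOpen {X : Fin r → Fin n → ℝ | LinearIndependent ℝ X} :=
    isOpen_setOfPred_linearIndependent
  have hHm : Measurable H :=
    Measurable.ite hopen.measurableSet (hG.comp hcr).measurable measurable_const
  have hHC : ∀ X, H X ≤ C := by
    intro X
    simp only [H]
    split_ifs
    · exact hGC _
    · exact zero_le
  obtain ⟨R', hR'0, hR'⟩ := exists_bound_of_rowMul (r := r) g R
  have hHR : ∀ X, H X ≠ 0 → ∀ i j, |X i j| ≤ R' := by
    intro X hX
    refine hR' X (hR _ fun h0 => hX ?_)
    simp [H, h0]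
  have hHcont : ∀ᵐ X, ContinuousAt H X := by
    filter_upwards [ae_linearIndependent (n := n) (r := r) hr.le] with X hX
    refine (hG.comp hcr).continuousAt.congr ?_
    filter_upwards [hopen.mem_nhds hX] with Y hY
    exact (if_pos hY).symm
  have hHint : ∫⁻ X, H X = ∫⁻ X, G X := by
    rw [← (measurePreserving_rowMul hdet).lintegral_comp hG.measurable]
    refine lintegral_congr_ae ?_
    filter_upwards [ae_linearIndependent (n := n) (r := r) hr.le] with X hX
    exact if_pos hX
  have htpos : ∀ k, 0 < heckeScale n (p k) := fun k => heckeScale_pos (hp k).out.pos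
  have ht0 := tendsto_heckeScale hn hpt
  have hmain := tendsto_riemann_sum hHm hC hHC hHR hHcont htpos ht0
  have hmain := ENNReal.Tendsto.mul (tendsto_heckeRatio hr hpt) (Or.inl one_ne_zero) hmain
    (Or.inr ENNReal.one_ne_top)
  rw [one_mul, hHint] at hmain
  refine hmain.congr' ?_
  have hsmall : ∀ᶠ k in Filter.atTop,
      r ! * R' ^ r * heckeScale n (p k) ^ (n - r) < 1 := by
    have := (ht0.pow (n - r)).const_mul (r ! * R' ^ r)
    rw [zero_pow (by omega), mul_zero] at this
    exact this.eventually (gt_mem_nhds one_pos)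
  filter_upwards [hsmall] with k hk
  have := hp k
  rw [heckeAvg_latSum, ← mul_assoc, ← heckeRatio_eq (hp k).out hr, mul_assoc]
  congr 1
  rw [← ENNReal.tsum_mul_left]
  refine tsum_congr fun N => ?_
  have hNH : H (fun i j => heckeScale n (p k) * N i j) =
      if LinearIndependent ℝ (castMat N) then
        G (rowMul (g : Matrix (Fin n) (Fin n) ℝ) (heckeScale n (p k) • castMat N)) else 0 := by
    change (if LinearIndependent ℝ (heckeScale n (p k) • castMat N) then _ else _) = _
    rw [linearIndependent_pos_smul (htpos k)]
    rfl
  by_cases h0 : H (fun i j => heckeScale n (p k) * N i j) = 0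
  · rw [h0, mul_zero]
    rw [h0] at hNH
    split_ifs at hNH ⊢ with hLI
    · rw [← hNH, mul_zero]
    · rfl
  · have hbd := hHR _ h0
    rw [hNH] at h0 ⊢
    split_ifs at h0 ⊢ with hLI
    · congr 2
      have hB : ∀ i j, |(N i j : ℝ)| ≤ R' / heckeScale n (p k) := by
        intro i j
        have := hbd i j
        rw [abs_mul, abs_of_pos (htpos k)] at this
        rwa [le_div_iff₀ (htpos k), mul_comm]
      have hlt : r ! * (R' / heckeScale n (p k)) ^ r < p k := by
        have hpow := heckeScale_pow (n := n) (hp k).out.pos hn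
        have hsplit : heckeScale n (p k) ^ n =
            heckeScale n (p k) ^ (n - r) * heckeScale n (p k) ^ r := by
          rw [← pow_add]
          congr 1
          omega
        have hp0 : (0 : ℝ) < p k := by exact_mod_cast (hp k).out.pos
        have hpk : (p k : ℝ) = (heckeScale n (p k) ^ (n - r) * heckeScale n (p k) ^ r)⁻¹ := by
          rw [← hsplit, hpow, inv_inv]
        have h1 := pow_pos (htpos k) r
        have h2 := pow_pos (htpos k) (n - r)
        rw [hpk, div_pow, ← mul_div_assoc, div_lt_iff₀ h1]
        rw [mul_inv, mul_assoc, inv_mul_cancel₀ h1.ne', mul_one, ← one_div, lt_div_iff₀ h2]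
        exact hk
      have := linearIndependent_mod (p k) hLI hB hlt
      rw [← card_ker_mod (p k) _ this]
    · exact absurd rfl h0

theorem lintegral_latSum_of_continuous (hr : r < n) {G : (Fin r → Fin n → ℝ) → ENNReal}
    (hG : Continuous G) {C : ENNReal} (hC : C ≠ ⊤) (hGC : ∀ X, G X ≤ C) {R : ℝ}
    (hR : ∀ X, G X ≠ 0 → ∀ i j, |X i j| ≤ R) (μ : Measure (LatSpace n)) [IsProbabilityMeasure μ]
    (hinv : ∀ a : SLR n, μ.map (rTranslate n a) = μ) :
    ∫⁻ x, latSum G (latRep x) ∂μ = ∫⁻ X, G X := by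
  choose p hpk hpp using Nat.exists_infinite_primes
  have hp : ∀ k, Fact (p k).Prime := fun k => ⟨hpp k⟩
  have hpt : Filter.Tendsto p Filter.atTop Filter.atTop :=
    Filter.tendsto_atTop_mono hpk Filter.tendsto_id
  have hlim := fun x : LatSpace n =>
    tendsto_heckeAvg_latSum hr hG hC hGC hR (latRep x) hp hpt
  have hn : 0 < n := by omega
  let f : LatSpace n → ENNReal := fun x => latSum G (latRep x)
  have hf : Measurable f := (isLatInvariant_latSum G).measurable (measurable_latSum hG.measurable)
  have hmeas : ∀ {u : LatSpace n → ENNReal} (k), Measurable u →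
      Measurable fun x => heckeAvg (p k) u (latRep x) := fun k hu =>
    (isLatInvariant_heckeAvg (p k) _).measurable (measurable_heckeAvg (p k) hu)
  refine le_antisymm ?_ ?_
  · have htrunc : ∀ K : ℕ, ∫⁻ x, min (f x) K ∂μ ≤ ∫⁻ X, G X := by
      intro K
      have hfK : Measurable fun x => min (f x) (K : ENNReal) := hf.min measurable_const
      have h1 : ∀ k, ∫⁻ x, min (f x) K ∂μ ≤
          ∫⁻ x, min (heckeAvg (p k) f (latRep x)) K ∂μ := by
        intro k
        rw [← lintegral_heckeAvg (p k) hn μ hinv hfK]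
        refine lintegral_mono fun x => le_min ?_ ?_
        · refine mul_le_mul_right (Finset.sum_le_sum fun a _ => min_le_left _ _) _
        · refine (mul_le_mul_right (Finset.sum_le_sum fun a _ => min_le_right _ _) _).trans ?_
          rw [Finset.sum_const, Finset.card_erase_of_mem (Finset.mem_univ _), Finset.card_univ,
            Fintype.card_fun, ZMod.card, Fintype.card_fin, nsmul_eq_mul, ← mul_assoc]
          have hc : ((p k ^ n - 1 : ℕ) : ENNReal) = (p k : ENNReal) ^ n - 1 := by push_cast; rfl
          rw [← hc]
          exact mul_le_of_le_one_left zero_le (ENNReal.inv_mul_le_one _)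
      have h2 : Filter.Tendsto (fun k => ∫⁻ x, min (heckeAvg (p k) f (latRep x)) K ∂μ)
          Filter.atTop (nhds (∫⁻ _, min (∫⁻ X, G X) K ∂μ)) := by
        refine tendsto_lintegral_of_dominated_convergence (fun _ => (K : ENNReal)) ?_ ?_ ?_ ?_
        · exact fun k => (hmeas k hf).min measurable_const
        · exact fun k => Filter.Eventually.of_forall fun x => min_le_right _ _
        · simp
        · exact Filter.Eventually.of_forall fun x => (hlim x).min tendsto_const_nhds
      refine (ge_of_tendsto' h2 h1).trans ?_
      simp
    have hsup : ∀ x, f x = ⨆ K : ℕ, min (f x) K := by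
      intro x
      rw [← inf_iSup_eq, ENNReal.iSup_natCast, inf_top_eq]
    change ∫⁻ x, f x ∂μ ≤ _
    rw [lintegral_congr hsup, lintegral_iSup]
    · exact iSup_le htrunc
    · exact fun K => hf.min measurable_const
    · exact fun a b hab x => min_le_min le_rfl (by exact_mod_cast hab)
  · have h1 := lintegral_liminf_le (μ := μ) (u := Filter.atTop) (fun k => hmeas k hf)
    have h2 : ∀ x, Filter.liminf (fun k => heckeAvg (p k) f (latRep x)) Filter.atTop =
        ∫⁻ X, G X := fun x => (hlim x).liminf_eq
    simp only [h2, lintegral_heckeAvg _ hn μ hinv hf] at h1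
    simpa using h1

end HeckeLimits

section MeanValue

variable {n r : ℕ}

/-- The mean counting measure of linearly independent `r`-tuples of lattice vectors. -/
noncomputable def tupleMeasure (r : ℕ) (μ : Measure (LatSpace n)) : Measure (Fin r → Fin n → ℝ) :=
  μ.bind fun x => Measure.sum fun N : Fin r → Fin n → ℤ =>
    if LinearIndependent ℝ (castMat N) then
      Measure.dirac (rowMul (latRep x : Matrix (Fin n) (Fin n) ℝ) (castMat N)) else 0

theorem lintegral_tupleMeasure (μ : Measure (LatSpace n)) {G : (Fin r → Fin n → ℝ) → ENNReal}
    (hG : Measurable G) :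
    ∫⁻ X, G X ∂(tupleMeasure r μ) = ∫⁻ x, latSum G (latRep x) ∂μ := by
  have key : ∀ G : (Fin r → Fin n → ℝ) → ENNReal, Measurable G → ∀ x : LatSpace n,
      ∫⁻ X, G X ∂(Measure.sum fun N : Fin r → Fin n → ℤ =>
        if LinearIndependent ℝ (castMat N) then
          Measure.dirac (rowMul (latRep x : Matrix (Fin n) (Fin n) ℝ) (castMat N)) else 0) =
        latSum G (latRep x) := by
    intro G hG x
    rw [lintegral_sum_measure, latSum]
    refine tsum_congr fun N => ?_
    split_ifs
    · rw [lintegral_dirac' _ hG]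
    · simp
  have hmeas : Measurable fun x : LatSpace n => Measure.sum fun N : Fin r → Fin n → ℤ =>
      if LinearIndependent ℝ (castMat N) then
        Measure.dirac (rowMul (latRep x : Matrix (Fin n) (Fin n) ℝ) (castMat N)) else 0 := by
    refine Measure.measurable_of_measurable_coe _ fun s hs => ?_
    have h1 : Measurable (s.indicator (1 : (Fin r → Fin n → ℝ) → ENNReal)) :=
      measurable_one.indicator hs
    have := (isLatInvariant_latSum _).measurable (measurable_latSum h1)
    convert this using 1
    funext x
    rw [← key _ h1, lintegral_indicator_one hs]
  rw [tupleMeasure, Measure.lintegral_bind hmeas.aemeasurable hG.aemeasurable]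
  exact lintegral_congr (key G hG)

theorem abs_apply_le_of_norm_le {X : Fin r → Fin n → ℝ} {R : ℝ} (h : ‖X‖ ≤ R) (i j) :
    |X i j| ≤ R :=
  ((norm_le_pi_norm (X i) j).trans (norm_le_pi_norm X i)).trans h

theorem tupleMeasure_eq_volume (hr : r < n) (μ : Measure (LatSpace n)) [IsProbabilityMeasure μ]
    (hinv : ∀ a : SLR n, μ.map (rTranslate n a) = μ) : tupleMeasure r μ = volume := by
  have hfin : IsFiniteMeasureOnCompacts (tupleMeasure r μ) := by
    refine ⟨fun K hK => ?_⟩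
    obtain ⟨R, hR0, hR⟩ := hK.isBounded.exists_pos_norm_le
    have hcont : Continuous fun X : Fin r → Fin n → ℝ => ENNReal.ofReal (R + 1 - ‖X‖) :=
      ENNReal.continuous_ofReal.comp (by fun_prop)
    have hle : ∀ X : Fin r → Fin n → ℝ,
        ENNReal.ofReal (R + 1 - ‖X‖) ≤ ENNReal.ofReal (R + 1) := fun X =>
      ENNReal.ofReal_le_ofReal (by linarith [norm_nonneg X])
    have hsupp : ∀ X : Fin r → Fin n → ℝ, ENNReal.ofReal (R + 1 - ‖X‖) ≠ 0 → ‖X‖ ≤ R + 1 := by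
      intro X hX
      rw [Ne, ENNReal.ofReal_eq_zero, not_le] at hX
      linarith
    have h := lintegral_latSum_of_continuous hr hcont ENNReal.ofReal_ne_top hle
      (R := R + 1) (fun X hX => abs_apply_le_of_norm_le (hsupp X hX)) μ hinv
    rw [← lintegral_tupleMeasure μ hcont.measurable] at h
    calc tupleMeasure r μ K = ∫⁻ X in K, 1 ∂(tupleMeasure r μ) := by simp
      _ ≤ ∫⁻ X in K, ENNReal.ofReal (R + 1 - ‖X‖) ∂(tupleMeasure r μ) := by
        refine setLIntegral_mono' hK.measurableSet fun X hX => ?_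
        rw [← ENNReal.ofReal_one]
        exact ENNReal.ofReal_le_ofReal (by linarith [hR X hX])
      _ ≤ ∫⁻ X, ENNReal.ofReal (R + 1 - ‖X‖) ∂(tupleMeasure r μ) := setLIntegral_le_lintegral _ _
      _ = ∫⁻ X : Fin r → Fin n → ℝ, ENNReal.ofReal (R + 1 - ‖X‖) := h
      _ ≤ ∫⁻ X in Metric.closedBall (0 : Fin r → Fin n → ℝ) (R + 1), ENNReal.ofReal (R + 1) := by
        rw [← lintegral_indicator Metric.isClosed_closedBall.measurableSet]
        refine lintegral_mono fun X => ?_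
        by_cases h0 : ENNReal.ofReal (R + 1 - ‖X‖) = 0
        · simp only [h0]
          exact zero_le
        · rw [Set.indicator_of_mem (mem_closedBall_zero_iff.mpr (hsupp X h0))]
          exact hle X
      _ < ⊤ := by
        rw [setLIntegral_const]
        exact ENNReal.mul_lt_top ENNReal.ofReal_lt_top
          (isCompact_closedBall _ _).measure_lt_top
  have hreg : (volume : Measure (Fin r → Fin n → ℝ)).Regular :=
    Measure.Regular.of_sigmaCompactSpace_of_isLocallyFiniteMeasure _
  refine Measure.ext_of_integral_eq_on_compactlySupported_nnreal fun f => ?_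
  have hfc : Continuous fun X => (f X : ENNReal) := ENNReal.continuous_coe.comp f.continuous
  have hcs : HasCompactSupport fun X => (f X : ℝ) := f.hasCompactSupport.comp_left rfl
  obtain ⟨C, hC⟩ := hcs.exists_bound_of_continuous (NNReal.continuous_coe.comp f.continuous)
  obtain ⟨R, -, hR⟩ := f.hasCompactSupport.isBounded.exists_pos_norm_le
  have h := lintegral_latSum_of_continuous hr hfc (C := ENNReal.ofReal C) ENNReal.ofReal_ne_top
    (fun X => by
      rw [← ENNReal.ofReal_coe_nnreal]
      refine ENNReal.ofReal_le_ofReal ?_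
      simpa using hC X)
    (R := R) (fun X hX => abs_apply_le_of_norm_le
      (hR X (subset_tsupport _ (by simpa using hX)))) μ hinv
  rw [← lintegral_tupleMeasure μ hfc.measurable] at h
  have hfr : Continuous fun X => (f X : ℝ) := NNReal.continuous_coe.comp f.continuous
  have hf0 : ∀ ν : Measure (Fin r → Fin n → ℝ), 0 ≤ᵐ[ν] fun X => (f X : ℝ) := fun ν =>
    Filter.Eventually.of_forall fun _ => NNReal.coe_nonneg _
  rw [integral_eq_lintegral_of_nonneg_ae (hf0 _) hfr.aestronglyMeasurable,
    integral_eq_lintegral_of_nonneg_ae (hf0 _) hfr.aestronglyMeasurable]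
  simp only [ENNReal.ofReal_coe_nnreal]
  rw [h]

theorem lintegral_latSum (hr : r < n) (μ : Measure (LatSpace n)) [IsProbabilityMeasure μ]
    (hinv : ∀ a : SLR n, μ.map (rTranslate n a) = μ) {G : (Fin r → Fin n → ℝ) → ENNReal}
    (hG : Measurable G) : ∫⁻ x, latSum G (latRep x) ∂μ = ∫⁻ X, G X := by
  rw [← lintegral_tupleMeasure μ hG, tupleMeasure_eq_volume hr μ hinv]

end MeanValue

section TupleShapes

variable {n r h : ℕ}

/-- The integral vectors in the rational column space of an integral matrix. -/
def satColSpace (m : Matrix (Fin h) (Fin n) ℤ) : Submodule ℤ (Fin h → ℤ) where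
  carrier := {v | ∃ w : Fin n → ℚ, ∀ i, (v i : ℚ) = ∑ l, (m i l : ℚ) * w l}
  add_mem' := by
    rintro v v' ⟨w, hw⟩ ⟨w', hw'⟩
    exact ⟨w + w', fun i => by simp [hw, hw', mul_add, Finset.sum_add_distrib]⟩
  zero_mem' := ⟨0, by simp⟩
  smul_mem' := by
    rintro c v ⟨w, hw⟩
    refine ⟨(c : ℚ) • w, fun i => ?_⟩
    simp only [Pi.smul_apply, smul_eq_mul, Int.cast_mul, hw, Finset.mul_sum]
    exact Finset.sum_congr rfl fun l _ => by ring

/-- The columns of `B` generate the group of integral solutions of `d v = K v_e`, which has index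
`d` under projection to the coordinates `e`. -/
structure IsTupleShape (e : Fin r → Fin h) (d : ℕ) (K : Matrix (Fin h) (Fin r) ℤ)
    (B : Matrix (Fin h) (Fin r) ℤ) : Prop where
  det_eq : |(B.submatrix e id).det| = d
  smul_eq : (d : ℤ) • B = K * B.submatrix e id
  exists_eq : ∀ v : Fin h → ℤ, (d : ℤ) • v = K *ᵥ (v ∘ e) → ∃ w, v = B *ᵥ w

theorem mul_adjugate_submatrix_apply {R : Type*} [CommRing R] (B : Matrix (Fin h) (Fin r) R)
    (e : Fin r → Fin h) (i : Fin h) (k : Fin r) :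
    (B * (B.submatrix e id).adjugate) i k =
      (B.submatrix (Function.update e k i) id).det := by
  have h1 : B.submatrix (Function.update e k i) id = (B.submatrix e id).updateRow k (B i) := by
    ext a b
    by_cases hk : a = k
    · subst hk
      simp
    · simp [hk]
  rw [h1, ← cramer_transpose_apply, cramer_eq_adjugate_mulVec, ← adjugate_transpose,
    mulVec_transpose]
  rfl

theorem linearIndependent_rat_of_basis (m : Matrix (Fin h) (Fin n) ℤ)
    (b : Module.Basis (Fin r) ℤ (satColSpace m)) :
    LinearIndependent ℚ (fun j i => ((b j : Fin h → ℤ) i : ℚ)) := by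
  rw [← LinearIndependent.iff_fractionRing (R := ℤ)]
  have h1 : LinearIndependent ℤ (fun j => (b j : Fin h → ℤ)) :=
    b.linearIndependent.map' (satColSpace m).subtype (Submodule.ker_subtype _)
  let c : (Fin h → ℤ) →ₗ[ℤ] (Fin h → ℚ) :=
    { toFun := fun v i => (v i : ℚ)
      map_add' := fun v w => by ext; simp
      map_smul' := fun k v => by ext; simp }
  refine h1.map' c (LinearMap.ker_eq_bot.mpr fun v w hvw => ?_)
  funext i
  have : (v i : ℚ) = w i := congrFun hvw i
  exact_mod_cast this

theorem linearIndependent_mul_iff {A : Matrix (Fin r) (Fin r) ℝ} (hA : A.det ≠ 0)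
    (N : Matrix (Fin r) (Fin n) ℝ) :
    LinearIndependent ℝ (A * N).row ↔ LinearIndependent ℝ N.row := by
  have key : ∀ {A : Matrix (Fin r) (Fin r) ℝ}, A.det ≠ 0 → ∀ {N : Matrix (Fin r) (Fin n) ℝ},
      LinearIndependent ℝ N.row → LinearIndependent ℝ (A * N).row := by
    intro A hA N hN
    rw [← vecMul_injective_iff] at hN ⊢
    have h1 : Function.Injective A.vecMul :=
      vecMul_injective_iff_isUnit.mpr (A.isUnit_iff_isUnit_det.mpr hA.isUnit)
    have := hN.comp h1
    intro v w hvw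
    refine this ?_
    simpa [vecMul_vecMul] using hvw
  refine ⟨fun hAN => ?_, key hA⟩
  have h1 := key (A := A⁻¹) (A.isUnit_nonsing_inv_det hA.isUnit).ne_zero hAN
  rwa [nonsing_inv_mul_cancel_left _ _ hA.isUnit] at h1

theorem exists_maximal_minor (B : Matrix (Fin h) (Fin r) ℤ)
    (hB : LinearIndependent ℚ (fun j i => (B i j : ℚ))) :
    ∃ e : Fin r ↪o Fin h, (B.submatrix e id).det ≠ 0 ∧
      ∀ f : Fin r → Fin h, |(B.submatrix f id).det| ≤ |(B.submatrix e id).det| := by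
  obtain ⟨f₀, hf₀⟩ := exists_det_submatrix_ne_zero (A := fun j i => (B i j : ℚ)) hB
  have hf₀' : (B.submatrix f₀ id).det ≠ 0 := by
    intro h0
    refine hf₀ ?_
    have := (Int.castRingHom ℚ).map_det (B.submatrix f₀ id)
    rw [h0, map_zero, ← det_transpose] at this
    exact this.symm
  have : Nonempty (Fin r → Fin h) := ⟨f₀⟩
  obtain ⟨f, hf⟩ := Finite.exists_max (fun f : Fin r → Fin h => |(B.submatrix f id).det|)
  have hfd : (B.submatrix f id).det ≠ 0 := by
    have := (abs_pos.mpr hf₀').trans_le (hf f₀)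
    exact abs_pos.mp this
  have hinj : Function.Injective f := by
    intro a b hab
    by_contra hne
    exact hfd (det_zero_of_row_eq hne (by funext k; simp [hab]))
  have hsort : |(B.submatrix (f ∘ Tuple.sort f) id).det| = |(B.submatrix f id).det| := by
    have h1 : B.submatrix (f ∘ Tuple.sort f) id =
        (B.submatrix f id).submatrix (Tuple.sort f) id := rfl
    rw [h1, det_permute, abs_mul]
    rcases Int.units_eq_one_or (Equiv.Perm.sign (Tuple.sort f)) with h2 | h2 <;> simp [h2]
  refine ⟨OrderEmbedding.ofStrictMono (f ∘ Tuple.sort f)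
    ((Tuple.monotone_sort f).strictMono_of_injective
      (hinj.comp (Tuple.sort f).injective)), ?_, fun g => ?_⟩
  · change (B.submatrix (f ∘ Tuple.sort f) id).det ≠ 0
    rw [← abs_pos, hsort]
    exact abs_pos.mpr hfd
  · change _ ≤ |(B.submatrix (f ∘ Tuple.sort f) id).det|
    rw [hsort]
    exact hf g

theorem intCast_map_mul {p : ℕ} (A : Matrix (Fin h) (Fin r) ℤ) (N : Matrix (Fin r) (Fin p) ℤ) :
    (A * N).map (Int.cast : ℤ → ℝ) = A.map (Int.cast : ℤ → ℝ) * N.map (Int.cast : ℤ → ℝ) := by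
  ext i j
  simp [mul_apply]

theorem det_map_intCast (A : Matrix (Fin r) (Fin r) ℤ) :
    (A.map (Int.cast : ℤ → ℝ)).det = A.det := by
  have := (Int.castRingHom ℝ).map_det A
  exact this.symm

theorem mem_satColSpace_of_smul {m : Matrix (Fin h) (Fin n) ℤ} {d : ℤ} (hd : d ≠ 0)
    {v : Fin h → ℤ} (hv : d • v ∈ satColSpace m) : v ∈ satColSpace m := by
  obtain ⟨w, hw⟩ := hv
  refine ⟨(d : ℚ)⁻¹ • w, fun i => ?_⟩
  have h1 : (d : ℚ) * v i = ∑ l, (m i l : ℚ) * w l := by simpa using hw i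
  have hd' : (d : ℚ) ≠ 0 := by exact_mod_cast hd
  calc (v i : ℚ) = (d : ℚ)⁻¹ * (d * v i) := by field_simp
    _ = _ := by
      rw [h1, Finset.mul_sum]
      refine Finset.sum_congr rfl fun l _ => ?_
      simp only [Pi.smul_apply, smul_eq_mul]
      ring

theorem exists_isTupleShape (m : Matrix (Fin h) (Fin n) ℤ) :
    ∃ (r : ℕ) (e : Fin r ↪o Fin h) (d : ℕ) (K B : Matrix (Fin h) (Fin r) ℤ), 0 < d ∧
      IsTupleShape e d K B ∧ (∀ i k, |K i k| ≤ d) ∧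
      (∀ j k, K (e j) k = if j = k then (d : ℤ) else 0) ∧
      (d : ℤ) • m = K * m.submatrix e id ∧
      LinearIndependent ℝ (castMat (m.submatrix e id)) := by
  obtain ⟨r, ⟨b⟩⟩ := Submodule.nonempty_basis_of_pid (Pi.basisFun ℤ (Fin h)) (satColSpace m)
  let B : Matrix (Fin h) (Fin r) ℤ := Matrix.of fun i j => (b j : Fin h → ℤ) i
  have hBsum : ∀ w : Fin r → ℤ, B *ᵥ w = ((∑ j, w j • b j : satColSpace m) : Fin h → ℤ) := by
    intro w
    funext i
    simp [B, mulVec, dotProduct, mul_comm]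
  have hB : ∀ v ∈ satColSpace m, ∃ w, v = B *ᵥ w := by
    intro v hv
    refine ⟨b.repr ⟨v, hv⟩, ?_⟩
    rw [hBsum, b.sum_repr]
  have hBmem : ∀ w, B *ᵥ w ∈ satColSpace m := by
    intro w
    rw [hBsum]
    exact Subtype.property _
  obtain ⟨e, he0, hemax⟩ := exists_maximal_minor B (linearIndependent_rat_of_basis m b)
  set Δ : ℤ := (B.submatrix e id).det with hΔ
  have hd : (Δ.natAbs : ℤ) = |Δ| := Int.natCast_natAbs Δ
  let K : Matrix (Fin h) (Fin r) ℤ := Δ.sign • (B * (B.submatrix e id).adjugate)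
  have hKB : K * B.submatrix e id = (Δ.natAbs : ℤ) • B := by
    simp only [K, Matrix.smul_mul, Matrix.mul_assoc, adjugate_mul]
    rw [← hΔ, Matrix.mul_smul, Matrix.mul_one, smul_smul, Int.sign_mul_self_eq_abs, hd]
  have hcol : ∀ l, ∃ w, (fun i => m i l) = B *ᵥ w := by
    intro l
    refine hB _ ⟨Pi.single l 1, fun i => ?_⟩
    simp [Pi.single_apply]
  choose N hN using hcol
  have hmN : m = B * (Matrix.of fun j l => N l j) := by
    ext i l
    exact congrFun (hN l) i
  have hmeN : m.submatrix e id = B.submatrix e id * (Matrix.of fun j l => N l j) := by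
    conv_lhs => rw [hmN]
    rfl
  have hdm : (Δ.natAbs : ℤ) • m = K * m.submatrix e id := by
    rw [hmeN, ← Matrix.mul_assoc, hKB, Matrix.smul_mul, ← hmN]
  refine ⟨r, e, Δ.natAbs, K, B, Int.natAbs_pos.mpr he0, ⟨hd.symm, hKB.symm, ?_⟩, ?_, ?_, hdm, ?_⟩
  · intro v hv
    refine hB v (mem_satColSpace_of_smul (d := (Δ.natAbs : ℤ)) (by simpa using he0) ?_)
    rw [hv]
    simp only [K, smul_mulVec, ← mulVec_mulVec]
    exact Submodule.smul_mem _ _ (hBmem _)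
  · intro i k
    have h1 : |Δ.sign| = 1 := by
      rcases lt_trichotomy Δ 0 with h | h | h
      · simp [Int.sign_eq_neg_one_of_neg h]
      · exact absurd h he0
      · simp [Int.sign_eq_one_of_pos h]
    simp only [K, Matrix.smul_apply, smul_eq_mul, abs_mul, h1, one_mul, hd]
    rw [mul_adjugate_submatrix_apply]
    exact hemax _
  · intro j k
    have h1 : (B * (B.submatrix e id).adjugate) (e j) k =
        (B.submatrix e id * (B.submatrix e id).adjugate) j k := rfl
    simp only [K, Matrix.smul_apply, smul_eq_mul, h1, mul_adjugate, ← hΔ, one_apply]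
    by_cases hjk : j = k <;> simp [hjk]
  · change LinearIndependent ℝ ((m.submatrix e id).map (Int.cast : ℤ → ℝ)).row
    rw [hmeN, intCast_map_mul]
    refine (linearIndependent_mul_iff ?_ _).mpr ?_
    · rw [det_map_intCast]
      exact_mod_cast he0
    choose W hW using fun j => (b j).2
    let WR : Matrix (Fin n) (Fin r) ℝ := Matrix.of fun l j => (W j l : ℝ)
    have hBW : B.map (Int.cast : ℤ → ℝ) = m.map (Int.cast : ℤ → ℝ) * WR := by
      ext i j
      have := hW j i
      simp only [map_apply, mul_apply, WR, Matrix.of_apply, B]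
      exact_mod_cast this
    have hunit : IsUnit ((B.submatrix e id).map (Int.cast : ℤ → ℝ)) := by
      rw [isUnit_iff_isUnit_det, det_map_intCast]
      have : (Δ : ℝ) ≠ 0 := by exact_mod_cast he0
      exact this.isUnit
    have hNW : (Matrix.of fun j l => N l j).map (Int.cast : ℤ → ℝ) * WR = 1 := by
      refine hunit.mul_left_cancel ?_
      rw [← Matrix.mul_assoc, ← intCast_map_mul, ← hmeN, Matrix.mul_one]
      ext i j
      exact (congrFun (congrFun hBW (e i)) j).symm
    rw [← vecMul_injective_iff]
    intro v w hvw
    have := congrArg (fun u => u ᵥ* WR) hvw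
    simpa only [vecMul_vecMul, hNW, vecMul_one] using this

end TupleShapes

section YoungInequality

variable {n : ℕ}

theorem hasDerivAt_integral_Iic {f : ℝ → ℝ} (hf : Continuous f) (hi : Integrable f) (x : ℝ) :
    HasDerivAt (fun x => ∫ t in Set.Iic x, f t) (f x) x := by
  have h : ∀ y, ∫ t in Set.Iic y, f t = (∫ t in Set.Iic 0, f t) + ∫ t in (0 : ℝ)..y, f t := by
    intro y
    rw [← intervalIntegral.integral_Iic_sub_Iic hi.integrableOn hi.integrableOn]
    ring
  rw [funext h]
  exact (intervalIntegral.integral_hasDerivAt_right (hf.intervalIntegrable _ _)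
    (hf.stronglyMeasurableAtFilter _ _) hf.continuousAt).const_add _

theorem strictMono_integral_Iic {f : ℝ → ℝ} (hf : Continuous f) (hi : Integrable f)
    (hpos : ∀ x, 0 < f x) : StrictMono (fun x => ∫ t in Set.Iic x, f t) :=
  strictMono_of_hasDerivAt_pos (fun x => hasDerivAt_integral_Iic hf hi x) hpos

theorem tendsto_integral_Iic_atTop {f : ℝ → ℝ} (hi : Integrable f) :
    Filter.Tendsto (fun x => ∫ t in Set.Iic x, f t) Filter.atTop (nhds (∫ t, f t)) :=
  (aecover_Iic Filter.tendsto_id).integral_tendsto_of_countably_generated hi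

theorem tendsto_integral_Iic_atBot {f : ℝ → ℝ} (hi : Integrable f) :
    Filter.Tendsto (fun x => ∫ t in Set.Iic x, f t) Filter.atBot (nhds 0) := by
  have h := ((aecover_Ioi (μ := volume) (α := ℝ)
    Filter.tendsto_id).integral_tendsto_of_countably_generated hi).const_sub (∫ t, f t)
  rw [sub_self] at h
  refine h.congr fun x => ?_
  rw [← intervalIntegral.integral_Iic_add_Ioi (b := x) hi.integrableOn hi.integrableOn]
  simp

theorem integral_Iic_mem_Ioo {f : ℝ → ℝ} (hf : Continuous f) (hi : Integrable f)
    (hpos : ∀ x, 0 < f x) (x : ℝ) : ∫ t in Set.Iic x, f t ∈ Set.Ioo 0 (∫ t, f t) := by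
  have hm := strictMono_integral_Iic hf hi hpos
  constructor
  · exact (hm.monotone.le_of_tendsto (tendsto_integral_Iic_atBot hi) (x - 1)).trans_lt
      (hm (by linarith))
  · exact (hm (by linarith : x < x + 1)).trans_le
      (hm.monotone.ge_of_tendsto (tendsto_integral_Iic_atTop hi) (x + 1))

theorem exists_integral_Iic_eq {f : ℝ → ℝ} (hf : Continuous f) (hi : Integrable f)
    {y : ℝ} (hy : y ∈ Set.Ioo 0 (∫ t, f t)) : ∃ x, ∫ t in Set.Iic x, f t = y := by
  have hc : Continuous (fun x => ∫ t in Set.Iic x, f t) :=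
    continuous_iff_continuousAt.mpr fun x => (hasDerivAt_integral_Iic hf hi x).continuousAt
  have h0 := ((tendsto_integral_Iic_atBot hi).eventually_lt_const hy.1).exists
  have h1 := ((tendsto_integral_Iic_atTop hi).eventually_const_lt hy.2).exists
  obtain ⟨a, ha⟩ := h0
  obtain ⟨b, hb⟩ := h1
  exact mem_range_of_exists_le_of_exists_ge hc ⟨a, ha.le⟩ ⟨b, hb.le⟩

/-- Monotone transport between positive continuous densities of equal mass on the line. -/
theorem exists_transport {f g : ℝ → ℝ} (hf : Continuous f) (hfi : Integrable f)
    (hfpos : ∀ x, 0 < f x) (hg : Continuous g) (hgi : Integrable g) (hgpos : ∀ x, 0 < g x)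
    (hfg : ∫ t, f t = ∫ t, g t) :
    ∃ T : ℝ → ℝ, StrictMono T ∧ ∀ x, HasDerivAt T (f x / g (T x)) x := by
  have hgm := strictMono_integral_Iic hg hgi hgpos
  have hfm := strictMono_integral_Iic hf hfi hfpos
  have hex : ∀ y, ∃ x, y ∈ Set.Ioo 0 (∫ t, g t) → ∫ t in Set.Iic x, g t = y := by
    intro y
    by_cases hy : y ∈ Set.Ioo 0 (∫ t, g t)
    · obtain ⟨x, hx⟩ := exists_integral_Iic_eq hg hgi hy
      exact ⟨x, fun _ => hx⟩
    · exact ⟨0, fun h => absurd h hy⟩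
  choose I hI using hex
  have hIm : StrictMonoOn I (Set.Ioo 0 (∫ t, g t)) := by
    intro a ha b hb hab
    rw [← hgm.lt_iff_lt]
    simpa [hI a ha, hI b hb] using hab
  have hmem : ∀ x, ∫ t in Set.Iic x, f t ∈ Set.Ioo 0 (∫ t, g t) := fun x => by
    rw [← hfg]
    exact integral_Iic_mem_Ioo hf hfi hfpos x
  refine ⟨fun x => I (∫ t in Set.Iic x, f t), ?_, fun x => ?_⟩
  · intro a b hab
    exact hIm (hmem a) (hmem b) (hfm hab)
  · have himg : I '' Set.Ioo 0 (∫ t, g t) = Set.univ := by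
      refine Set.eq_univ_of_forall fun t => ?_
      have ht := integral_Iic_mem_Ioo hg hgi hgpos t
      exact ⟨_, ht, hgm.injective (hI _ ht)⟩
    have hnhds : Set.Ioo 0 (∫ t, g t) ∈ nhds (∫ t in Set.Iic x, f t) :=
      Ioo_mem_nhds (hmem x).1 (hmem x).2
    have hcont : ContinuousAt I (∫ t in Set.Iic x, f t) :=
      hIm.continuousAt_of_image_mem_nhds hnhds (by rw [himg]; exact Filter.univ_mem)
    have hd : HasDerivAt I (g (I (∫ t in Set.Iic x, f t)))⁻¹ (∫ t in Set.Iic x, f t) :=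
      HasDerivAt.of_local_left_inverse hcont (hasDerivAt_integral_Iic hg hgi _)
        (hgpos _).ne' (Filter.mem_of_superset hnhds fun y hy => hI y hy)
    have := hd.comp x (hasDerivAt_integral_Iic hf hfi x)
    rw [div_eq_inv_mul]
    exact this

theorem lintegral_gaussian {b : ℝ} (hb : 0 < b) :
    ∫⁻ x : ℝ, ENNReal.ofReal (Real.exp (-b * x ^ 2)) = ENNReal.ofReal (√(Real.pi / b)) := by
  rw [← integral_gaussian b, ofReal_integral_eq_lintegral_ofReal (integrable_exp_neg_mul_sq hb)
    (Filter.Eventually.of_forall fun x => (Real.exp_pos _).le)]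

theorem lintegral_gaussian_plane :
    ∫⁻ p : ℝ × ℝ, ENNReal.ofReal
      (Real.exp (-(4 * Real.pi / 9) * (p.1 ^ 2 - p.1 * p.2 + p.2 ^ 2))) =
      ENNReal.ofReal (3 * √3 / 2) := by
  have hpi := Real.pi_pos
  rw [Measure.volume_eq_prod, lintegral_prod_symm _ (by fun_prop)]
  have h : ∀ y : ℝ, ∫⁻ x : ℝ, ENNReal.ofReal
      (Real.exp (-(4 * Real.pi / 9) * (x ^ 2 - x * y + y ^ 2))) =
      ENNReal.ofReal (3 / 2) * ENNReal.ofReal (Real.exp (-(Real.pi / 3) * y ^ 2)) := by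
    intro y
    have h1 : ∀ x : ℝ, ENNReal.ofReal
      (Real.exp (-(4 * Real.pi / 9) * (x ^ 2 - x * y + y ^ 2))) =
      ENNReal.ofReal (Real.exp (-(4 * Real.pi / 9) * (x - y / 2) ^ 2)) *
        ENNReal.ofReal (Real.exp (-(Real.pi / 3) * y ^ 2)) := by
      intro x
      rw [← ENNReal.ofReal_mul (Real.exp_pos _).le, ← Real.exp_add]
      ring_nf
    simp_rw [h1]
    rw [lintegral_mul_const _ (by fun_prop),
      lintegral_sub_right_eq_self
        (fun x : ℝ => ENNReal.ofReal (Real.exp (-(4 * Real.pi / 9) * x ^ 2))) (y / 2),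
      lintegral_gaussian (by positivity)]
    congr 2
    rw [show Real.pi / (4 * Real.pi / 9) = (3 / 2) ^ 2 by field_simp; norm_num,
      Real.sqrt_sq (by norm_num)]
  simp only [h]
  rw [lintegral_const_mul _ (by fun_prop), lintegral_gaussian (by positivity),
    ← ENNReal.ofReal_mul (by norm_num), show Real.pi / (Real.pi / 3) = 3 by field_simp]
  congr 1
  ring

theorem three_mul_rpow_le {a b c : ℝ} (ha : 0 ≤ a) (hb : 0 ≤ b) (hc : 0 ≤ c) :
    3 * (a * b * c) ^ (2 / 3 : ℝ) ≤ (a + c) * (b + c) - c * c := by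
  have h := Real.geom_mean_le_arith_mean3_weighted (w₁ := 1 / 3) (w₂ := 1 / 3) (w₃ := 1 / 3)
    (by norm_num) (by norm_num) (by norm_num) (mul_nonneg ha hb) (mul_nonneg ha hc)
    (mul_nonneg hb hc) (by norm_num)
  rw [← Real.mul_rpow (by positivity) (by positivity), ← Real.mul_rpow (by positivity)
    (by positivity), show a * b * (a * c) * (b * c) = (a * b * c) ^ (2 : ℝ) by
      rw [Real.rpow_two]; ring, ← Real.rpow_mul (by positivity)] at h
  norm_num at h
  linarith

theorem transport_exponent_le {u v w x y z : ℝ} (hx : 0 < x) (hy : 0 < y) (hz : 0 < z) :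
    (x * Real.exp (-Real.pi * u ^ 2) * (y * Real.exp (-Real.pi * v ^ 2)) *
      (z * Real.exp (-Real.pi * w ^ 2))) ^ (2 / 3 : ℝ) ≤
    (1 / 3) * (|(x + z) * (y + z) - z * z| *
      Real.exp (-(4 * Real.pi / 9) * ((u + w) ^ 2 - (u + w) * (v + w) + (v + w) ^ 2))) := by
  have h1 := three_mul_rpow_le hx.le hy.le hz.le
  have h2 : x * Real.exp (-Real.pi * u ^ 2) * (y * Real.exp (-Real.pi * v ^ 2)) *
      (z * Real.exp (-Real.pi * w ^ 2)) =
      (x * y * z) * Real.exp (-Real.pi * (u ^ 2 + v ^ 2 + w ^ 2)) := by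
    rw [show -Real.pi * (u ^ 2 + v ^ 2 + w ^ 2) =
      -Real.pi * u ^ 2 + -Real.pi * v ^ 2 + -Real.pi * w ^ 2 by ring, Real.exp_add, Real.exp_add]
    ring
  rw [h2, Real.mul_rpow (by positivity) (Real.exp_pos _).le, ← Real.exp_mul, ← mul_assoc]
  refine mul_le_mul ?_ (Real.exp_le_exp.mpr ?_) (Real.exp_pos _).le (by positivity)
  · linarith [le_abs_self ((x + z) * (y + z) - z * z)]
  · nlinarith [mul_nonneg Real.pi_pos.le (sq_nonneg (u + v - w))]

theorem lintegral_young_normalized {f g k : ℝ → ℝ} (hf : Continuous f) (hfi : Integrable f)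
    (hfpos : ∀ x, 0 < f x) (hf1 : ∫ x, f x = 1) (hg : Continuous g) (hgi : Integrable g)
    (hgpos : ∀ x, 0 < g x) (hg1 : ∫ x, g x = 1) (hk : Continuous k) (hki : Integrable k)
    (hkpos : ∀ x, 0 < k x) (hk1 : ∫ x, k x = 1) :
    ∫⁻ p : ℝ × ℝ, ENNReal.ofReal ((f p.1 * g p.2 * k (p.1 + p.2)) ^ (2 / 3 : ℝ)) ≤
      ENNReal.ofReal (√3 / 2) := by
  have hpi := Real.pi_pos
  have hγ : Continuous fun x : ℝ => Real.exp (-Real.pi * x ^ 2) := by fun_prop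
  have hγi := integrable_exp_neg_mul_sq hpi
  have hγpos : ∀ x : ℝ, 0 < Real.exp (-Real.pi * x ^ 2) := fun x => Real.exp_pos _
  have hγ1 : ∫ x : ℝ, Real.exp (-Real.pi * x ^ 2) = 1 := by
    rw [integral_gaussian, div_self hpi.ne', Real.sqrt_one]
  obtain ⟨T₁, hm₁, hd₁⟩ := exists_transport hf hfi hfpos hγ hγi hγpos (hf1.trans hγ1.symm)
  obtain ⟨T₂, hm₂, hd₂⟩ := exists_transport hg hgi hgpos hγ hγi hγpos (hg1.trans hγ1.symm)
  obtain ⟨T₃, hm₃, hd₃⟩ := exists_transport hk hki hkpos hγ hγi hγpos (hk1.trans hγ1.symm)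
  set D₁ : ℝ → ℝ := fun x => f x / Real.exp (-Real.pi * T₁ x ^ 2) with hD₁
  set D₂ : ℝ → ℝ := fun x => g x / Real.exp (-Real.pi * T₂ x ^ 2) with hD₂
  set D₃ : ℝ → ℝ := fun x => k x / Real.exp (-Real.pi * T₃ x ^ 2) with hD₃
  let Ψ : ℝ × ℝ → ℝ × ℝ := fun p => (T₁ p.1 + T₃ (p.1 + p.2), T₂ p.2 + T₃ (p.1 + p.2))
  let Ψ' : ℝ × ℝ → (ℝ × ℝ →L[ℝ] ℝ × ℝ) := fun p =>
    LinearMap.toContinuousLinearMap (Matrix.toLin (Module.Basis.finTwoProd ℝ)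
      (Module.Basis.finTwoProd ℝ)
      !![D₁ p.1 + D₃ (p.1 + p.2), D₃ (p.1 + p.2); D₃ (p.1 + p.2), D₂ p.2 + D₃ (p.1 + p.2)])
  have hΨ : ∀ p, HasFDerivAt Ψ (Ψ' p) p := by
    intro p
    have e : HasFDerivAt (fun p : ℝ × ℝ => p.1 + p.2)
        (ContinuousLinearMap.fst ℝ ℝ ℝ + ContinuousLinearMap.snd ℝ ℝ ℝ) p :=
      hasFDerivAt_fst.add hasFDerivAt_snd
    have e₃ : HasFDerivAt (fun p : ℝ × ℝ => T₃ (p.1 + p.2)) _ p :=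
      (hd₃ (p.1 + p.2)).comp_hasFDerivAt p e
    have efst : HasFDerivAt (fun p : ℝ × ℝ => p.1) (ContinuousLinearMap.fst ℝ ℝ ℝ) p :=
      hasFDerivAt_fst
    have esnd : HasFDerivAt (fun p : ℝ × ℝ => p.2) (ContinuousLinearMap.snd ℝ ℝ ℝ) p :=
      hasFDerivAt_snd
    have e₁ : HasFDerivAt (fun p : ℝ × ℝ => T₁ p.1) _ p :=
      (hd₁ p.1).comp_hasFDerivAt p efst
    have e₂ : HasFDerivAt (fun p : ℝ × ℝ => T₂ p.2) _ p :=
      (hd₂ p.2).comp_hasFDerivAt p esnd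
    refine ((e₁.add e₃).prodMk (e₂.add e₃)).congr_fderiv ?_
    simp only [Ψ', Matrix.toLin_finTwoProd_toContinuousLinearMap]
    ext <;> simp [hD₁, hD₂, hD₃]
  have hdet : ∀ p, (Ψ' p).det =
      (D₁ p.1 + D₃ (p.1 + p.2)) * (D₂ p.2 + D₃ (p.1 + p.2)) -
        D₃ (p.1 + p.2) * D₃ (p.1 + p.2) := by
    intro p
    simp only [Ψ', LinearMap.det_toContinuousLinearMap, LinearMap.det_toLin,
      Matrix.det_fin_two_of]
  have hinj : Function.Injective Ψ := by
    rintro ⟨x, y⟩ ⟨x', y'⟩ h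
    simp only [Ψ, Prod.mk.injEq] at h
    obtain ⟨h1, h2⟩ := h
    have hs : x + y = x' + y' := by
      rcases lt_trichotomy (x + y) (x' + y') with hlt | heq | hlt
      · have := hm₃ hlt
        have a1 := hm₁.lt_iff_lt.mp (by linarith : T₁ x' < T₁ x)
        have a2 := hm₂.lt_iff_lt.mp (by linarith : T₂ y' < T₂ y)
        linarith
      · exact heq
      · have := hm₃ hlt
        have a1 := hm₁.lt_iff_lt.mp (by linarith : T₁ x < T₁ x')
        have a2 := hm₂.lt_iff_lt.mp (by linarith : T₂ y < T₂ y')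
        linarith
    rw [hs] at h1 h2
    rw [hm₁.injective (add_right_cancel h1), hm₂.injective (add_right_cancel h2)]
  have hrec : ∀ (u a : ℝ), u = u / Real.exp a * Real.exp a := fun u a =>
    (div_mul_cancel₀ _ (Real.exp_pos a).ne').symm
  calc ∫⁻ p : ℝ × ℝ, ENNReal.ofReal ((f p.1 * g p.2 * k (p.1 + p.2)) ^ (2 / 3 : ℝ))
      ≤ ∫⁻ p : ℝ × ℝ, ENNReal.ofReal (1 / 3) * (ENNReal.ofReal |(Ψ' p).det| * ENNReal.ofReal
        (Real.exp (-(4 * Real.pi / 9) *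
          ((Ψ p).1 ^ 2 - (Ψ p).1 * (Ψ p).2 + (Ψ p).2 ^ 2)))) := by
        refine lintegral_mono fun p => ?_
        rw [← ENNReal.ofReal_mul (abs_nonneg _), ← ENNReal.ofReal_mul (by norm_num), hdet]
        refine ENNReal.ofReal_le_ofReal ?_
        have := transport_exponent_le (u := T₁ p.1) (v := T₂ p.2) (w := T₃ (p.1 + p.2))
          (x := D₁ p.1) (y := D₂ p.2) (z := D₃ (p.1 + p.2))
          (div_pos (hfpos _) (Real.exp_pos _)) (div_pos (hgpos _) (Real.exp_pos _))
          (div_pos (hkpos _) (Real.exp_pos _))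
        simp only [hD₁, hD₂, hD₃, ← hrec] at this ⊢
        exact this
    _ = ENNReal.ofReal (1 / 3) * ∫⁻ p in Ψ '' Set.univ, ENNReal.ofReal
        (Real.exp (-(4 * Real.pi / 9) * (p.1 ^ 2 - p.1 * p.2 + p.2 ^ 2))) := by
        rw [lintegral_const_mul' _ _ ENNReal.ofReal_ne_top,
          lintegral_image_eq_lintegral_abs_det_fderiv_mul volume MeasurableSet.univ
            (fun p _ => (hΨ p).hasFDerivWithinAt) hinj.injOn, Measure.restrict_univ]
    _ ≤ ENNReal.ofReal (1 / 3) * ENNReal.ofReal (3 * √3 / 2) := by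
        gcongr
        rw [← lintegral_gaussian_plane]
        exact setLIntegral_le_lintegral _ _
    _ = ENNReal.ofReal (√3 / 2) := by
        rw [← ENNReal.ofReal_mul (by norm_num)]
        congr 1
        ring

theorem lintegral_young_continuous {f g k : ℝ → ℝ} (hf : Continuous f) (hfi : Integrable f)
    (hfpos : ∀ x, 0 < f x) (hg : Continuous g) (hgi : Integrable g)
    (hgpos : ∀ x, 0 < g x) (hk : Continuous k) (hki : Integrable k) (hkpos : ∀ x, 0 < k x) :
    ∫⁻ p : ℝ × ℝ, ENNReal.ofReal ((f p.1 * g p.2 * k (p.1 + p.2)) ^ (2 / 3 : ℝ)) ≤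
      ENNReal.ofReal (√3 / 2 * ((∫ x, f x) * (∫ x, g x) * ∫ x, k x) ^ (2 / 3 : ℝ)) := by
  have hintegral : ∀ {f : ℝ → ℝ}, Continuous f → Integrable f → (∀ x, 0 < f x) → 0 < ∫ x, f x := by
    intro f hf hfi hpos
    have := integral_Iic_mem_Ioo hf hfi hpos 0
    exact this.1.trans this.2
  have hF := hintegral hf hfi hfpos
  have hG := hintegral hg hgi hgpos
  have hK := hintegral hk hki hkpos
  set A := ∫ x, f x
  set B := ∫ x, g x
  set C := ∫ x, k x
  have hone : ∀ {f : ℝ → ℝ} {A : ℝ}, 0 < A → ∫ x, f x = A → ∫ x, f x / A = 1 := by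
    intro f A hA h
    rw [integral_div, h, div_self hA.ne']
  have h := lintegral_young_normalized (hf.div_const A) (hfi.div_const A)
    (fun x => div_pos (hfpos x) hF) (hone hF rfl) (hg.div_const B) (hgi.div_const B)
    (fun x => div_pos (hgpos x) hG) (hone hG rfl) (hk.div_const C) (hki.div_const C)
    (fun x => div_pos (hkpos x) hK) (hone hK rfl)
  have heq : ∀ p : ℝ × ℝ, ENNReal.ofReal ((f p.1 * g p.2 * k (p.1 + p.2)) ^ (2 / 3 : ℝ)) =
      ENNReal.ofReal ((A * B * C) ^ (2 / 3 : ℝ)) *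
      ENNReal.ofReal ((f p.1 / A * (g p.2 / B) * (k (p.1 + p.2) / C)) ^ (2 / 3 : ℝ)) := by
    intro p
    have h1 := hfpos p.1
    have h2 := hgpos p.2
    have h3 := hkpos (p.1 + p.2)
    rw [← ENNReal.ofReal_mul (by positivity), ← Real.mul_rpow (by positivity) (by positivity)]
    congr 2
    field_simp
  simp_rw [heq]
  rw [lintegral_const_mul' _ _ ENNReal.ofReal_ne_top, mul_comm (√3 / 2),
    ENNReal.ofReal_mul (by positivity)]
  gcongr

theorem exists_seq_continuous_approx {F : ℝ → ENNReal} (hF : Measurable F)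
    (hFi : ∫⁻ x, F x ≠ ⊤) :
    ∃ f : ℕ → ℝ → ℝ, (∀ j, Continuous (f j)) ∧ (∀ j, Integrable (f j)) ∧ (∀ j x, 0 < f j x) ∧
      Filter.Tendsto (fun j => ∫ x, f j x) Filter.atTop (nhds (∫⁻ x, F x).toReal) ∧
      ∀ᵐ x, Filter.Tendsto (fun j => f j x) Filter.atTop (nhds (F x).toReal) := by
  have hi := integrable_toReal_of_lintegral_ne_top hF.aemeasurable hFi
  have hex : ∀ j : ℕ, ∃ g : ℝ → ℝ, HasCompactSupport g ∧
      ∫⁻ x, ‖(F x).toReal - g x‖ₑ ≤ ((j : ENNReal) + 1)⁻¹ ∧ Continuous g ∧ Integrable g :=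
    fun j => hi.exists_hasCompactSupport_lintegral_sub_le (by simp)
  choose g _ hgl hgc hgi using hex
  set e : ℝ → ℝ := fun x => Real.exp (-Real.pi * x ^ 2) with he
  have hec : Continuous e := by fun_prop
  have hepos : ∀ x, 0 < e x := fun x => Real.exp_pos _
  have hei : Integrable e := integrable_exp_neg_mul_sq Real.pi_pos
  have he1 : ∫⁻ x, ‖e x‖ₑ = 1 := by
    have := lintegral_gaussian Real.pi_pos
    rw [div_self Real.pi_ne_zero, Real.sqrt_one, ENNReal.ofReal_one] at this
    rw [← this]
    refine lintegral_congr fun x => ?_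
    rw [Real.enorm_of_nonneg (hepos x).le]
  set f : ℕ → ℝ → ℝ := fun j x => |g j x| + ((j : ℝ) + 1)⁻¹ * e x with hf
  have hfc : ∀ j, Continuous (f j) := fun j => (hgc j).abs.add (hec.const_mul _)
  have hfi : ∀ j, Integrable (f j) := fun j => (hgi j).abs.add (hei.const_mul _)
  have hfpos : ∀ j x, 0 < f j x := fun j x =>
    add_pos_of_nonneg_of_pos (abs_nonneg _) (mul_pos (by positivity) (hepos x))
  have hbound : ∀ j, ∫⁻ x, ‖f j x - (F x).toReal‖ₑ ≤ ((j : ENNReal) + 1)⁻¹ + ((j : ENNReal) + 1)⁻¹ := by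
    intro j
    have hpt : ∀ x, ‖f j x - (F x).toReal‖ₑ ≤
        ‖(F x).toReal - g j x‖ₑ + ((j : ENNReal) + 1)⁻¹ * ‖e x‖ₑ := by
      intro x
      have hc : ((j : ENNReal) + 1)⁻¹ * ‖e x‖ₑ = ‖((j : ℝ) + 1)⁻¹ * e x‖ₑ := by
        rw [enorm_mul, Real.enorm_of_nonneg (by positivity : (0 : ℝ) ≤ ((j : ℝ) + 1)⁻¹),
          ENNReal.ofReal_inv_of_pos (by positivity), ENNReal.ofReal_add (by positivity) one_pos.le,
          ENNReal.ofReal_natCast, ENNReal.ofReal_one]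
      rw [hc, show f j x - (F x).toReal =
        (|g j x| - |(F x).toReal|) + ((j : ℝ) + 1)⁻¹ * e x by
          rw [abs_of_nonneg ENNReal.toReal_nonneg]; simp only [hf]; ring]
      refine (enorm_add_le _ _).trans ?_
      gcongr
      rw [enorm_sub_rev, Real.enorm_eq_ofReal_abs, Real.enorm_eq_ofReal_abs]
      exact ENNReal.ofReal_le_ofReal (abs_abs_sub_abs_le _ _)
    refine (lintegral_mono hpt).trans ?_
    rw [lintegral_add_right _ (by fun_prop), lintegral_const_mul _ (by fun_prop), he1, mul_one]
    gcongr
    exact hgl j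
  have hlim0 : Filter.Tendsto (fun j : ℕ => ((j : ENNReal) + 1)⁻¹ + ((j : ENNReal) + 1)⁻¹)
      Filter.atTop (nhds 0) := by
    have h1 : Filter.Tendsto (fun j : ℕ => ((j : ENNReal) + 1)⁻¹) Filter.atTop (nhds 0) := by
      have := (Filter.tendsto_add_atTop_iff_nat 1).mpr ENNReal.tendsto_inv_nat_nhds_zero
      simpa using this
    simpa using h1.add h1
  have hL1 : Filter.Tendsto (fun j => ∫⁻ x, ‖f j x - (F x).toReal‖ₑ) Filter.atTop (nhds 0) :=
    tendsto_of_tendsto_of_tendsto_of_le_of_le tendsto_const_nhds hlim0 (fun _ => zero_le) hbound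
  have hintegral := tendsto_integral_of_L1 _ hi.aestronglyMeasurable
    (Filter.Eventually.of_forall hfi) hL1
  have hmeas : TendstoInMeasure volume f Filter.atTop fun x => (F x).toReal := by
    refine tendstoInMeasure_of_tendsto_eLpNorm one_ne_zero
      (fun j => (hfi j).aestronglyMeasurable) hi.aestronglyMeasurable ?_
    simp_rw [eLpNorm_one_eq_lintegral_enorm]
    exact hL1
  obtain ⟨ns, hns, hae⟩ := hmeas.exists_seq_tendsto_ae
  refine ⟨fun j => f (ns j), fun j => hfc _, fun j => hfi _, fun j => hfpos _, ?_, hae⟩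
  rw [integral_toReal hF.aemeasurable (ae_lt_top hF hFi)] at hintegral
  exact hintegral.comp hns.tendsto_atTop

theorem ae_prod_add {p : ℝ → Prop} (h : ∀ᵐ x, p x) : ∀ᵐ q : ℝ × ℝ, p (q.1 + q.2) := by
  have hq : Measure.QuasiMeasurePreserving (fun q : ℝ × ℝ => q.1 + q.2) (volume.prod volume)
      volume :=
    Measure.quasiMeasurePreserving_snd.comp
      (measurePreserving_prod_add (volume : Measure ℝ) volume).quasiMeasurePreserving
  exact hq.ae h

theorem ae_prod_fst {p : ℝ → Prop} (h : ∀ᵐ x, p x) : ∀ᵐ q : ℝ × ℝ, p q.1 :=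
  Measure.quasiMeasurePreserving_fst.ae h

theorem ae_prod_snd {p : ℝ → Prop} (h : ∀ᵐ x, p x) : ∀ᵐ q : ℝ × ℝ, p q.2 :=
  Measure.quasiMeasurePreserving_snd.ae h

theorem lintegral_young_of_ne_top {F G K : ℝ → ENNReal} (hF : Measurable F) (hG : Measurable G)
    (hK : Measurable K) (hFi : ∫⁻ x, F x ≠ ⊤) (hGi : ∫⁻ x, G x ≠ ⊤) (hKi : ∫⁻ x, K x ≠ ⊤) :
    ∫⁻ p : ℝ × ℝ, (F p.1 * G p.2 * K (p.1 + p.2)) ^ (2 / 3 : ℝ) ≤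
      ENNReal.ofReal (√3 / 2) * ((∫⁻ x, F x) * (∫⁻ x, G x) * ∫⁻ x, K x) ^ (2 / 3 : ℝ) := by
  obtain ⟨f, hfc, hfi, hfpos, hfl, hfae⟩ := exists_seq_continuous_approx hF hFi
  obtain ⟨g, hgc, hgi, hgpos, hgl, hgae⟩ := exists_seq_continuous_approx hG hGi
  obtain ⟨k, hkc, hki, hkpos, hkl, hkae⟩ := exists_seq_continuous_approx hK hKi
  have hofReal : ∀ {a b c : ENNReal}, a ≠ ⊤ → b ≠ ⊤ → c ≠ ⊤ →
      ENNReal.ofReal ((a.toReal * b.toReal * c.toReal) ^ (2 / 3 : ℝ)) =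
        (a * b * c) ^ (2 / 3 : ℝ) := by
    intro a b c ha hb hc
    rw [← ENNReal.ofReal_rpow_of_nonneg (by positivity) (by norm_num),
      ← ENNReal.toReal_mul, ← ENNReal.toReal_mul, ENNReal.ofReal_toReal]
    exact ENNReal.mul_ne_top (ENNReal.mul_ne_top ha hb) hc
  have hlim : Filter.Tendsto (fun j => ENNReal.ofReal
      (√3 / 2 * ((∫ x, f j x) * (∫ x, g j x) * ∫ x, k j x) ^ (2 / 3 : ℝ))) Filter.atTop
      (nhds (ENNReal.ofReal (√3 / 2) *
        ((∫⁻ x, F x) * (∫⁻ x, G x) * ∫⁻ x, K x) ^ (2 / 3 : ℝ))) := by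
    rw [← hofReal hFi hGi hKi, ← ENNReal.ofReal_mul (by positivity)]
    exact ENNReal.tendsto_ofReal ((((hfl.mul hgl).mul hkl).rpow_const
      (Or.inr (by norm_num))).const_mul _)
  have hae : ∀ᵐ p : ℝ × ℝ, (F p.1 * G p.2 * K (p.1 + p.2)) ^ (2 / 3 : ℝ) =
      Filter.liminf (fun j => ENNReal.ofReal
        ((f j p.1 * g j p.2 * k j (p.1 + p.2)) ^ (2 / 3 : ℝ))) Filter.atTop := by
    filter_upwards [ae_prod_fst (ae_lt_top hF hFi), ae_prod_snd (ae_lt_top hG hGi),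
      ae_prod_add (ae_lt_top hK hKi), ae_prod_fst hfae, ae_prod_snd hgae, ae_prod_add hkae]
      with p h1 h2 h3 h4 h5 h6
    rw [← hofReal h1.ne h2.ne h3.ne]
    exact (ENNReal.tendsto_ofReal (((h4.mul h5).mul h6).rpow_const
      (Or.inr (by norm_num)))).liminf_eq.symm
  rw [lintegral_congr_ae hae, ← hlim.liminf_eq]
  refine (lintegral_liminf_le fun j => ?_).trans (Filter.liminf_le_liminf
    (Filter.Eventually.of_forall fun j => lintegral_young_continuous (hfc j) (hfi j) (hfpos j)
      (hgc j) (hgi j) (hgpos j) (hkc j) (hki j) (hkpos j)))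
  have h1 := (hfc j).measurable
  have h2 := (hgc j).measurable
  have h3 := (hkc j).measurable
  fun_prop

/-- Sharp Young inequality on the line for the exponents `3/2, 3/2, 3/2`. -/
theorem lintegral_young_line {F G K : ℝ → ENNReal} (hF : Measurable F) (hG : Measurable G)
    (hK : Measurable K) :
    ∫⁻ x, ∫⁻ y, (F x * G y * K (x + y)) ^ (2 / 3 : ℝ) ≤
      ENNReal.ofReal (√3 / 2) * ((∫⁻ x, F x) * (∫⁻ x, G x) * ∫⁻ x, K x) ^ (2 / 3 : ℝ) := by
  have hm : Measurable fun p : ℝ × ℝ => (F p.1 * G p.2 * K (p.1 + p.2)) ^ (2 / 3 : ℝ) := by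
    fun_prop
  rw [← lintegral_prod (fun p : ℝ × ℝ => (F p.1 * G p.2 * K (p.1 + p.2)) ^ (2 / 3 : ℝ))
    hm.aemeasurable, ← Measure.volume_eq_prod]
  have hzero : ∀ {H : ℝ → ENNReal}, Measurable H → ∫⁻ x, H x = 0 → ∀ᵐ x, H x = 0 :=
    fun hH h => (lintegral_eq_zero_iff hH).mp h
  by_cases h0 : (∫⁻ x, F x) * (∫⁻ x, G x) * ∫⁻ x, K x = 0
  · have hz : ∀ᵐ p : ℝ × ℝ, F p.1 * G p.2 * K (p.1 + p.2) = 0 := by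
      rw [mul_eq_zero, mul_eq_zero] at h0
      rcases h0 with (h | h) | h
      · filter_upwards [ae_prod_fst (hzero hF h)] with p hp
        rw [hp, zero_mul, zero_mul]
      · filter_upwards [ae_prod_snd (hzero hG h)] with p hp
        rw [hp, mul_zero, zero_mul]
      · filter_upwards [ae_prod_add (hzero hK h)] with p hp
        rw [hp, mul_zero]
    have hz' : ∀ᵐ p : ℝ × ℝ, (F p.1 * G p.2 * K (p.1 + p.2)) ^ (2 / 3 : ℝ) = 0 := by
      filter_upwards [hz] with p hp
      rw [hp, ENNReal.zero_rpow_of_pos (by norm_num)]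
    rw [lintegral_congr_ae hz', lintegral_zero]
    exact zero_le
  by_cases htop : (∫⁻ x, F x) * (∫⁻ x, G x) * ∫⁻ x, K x = ⊤
  · rw [htop, ENNReal.top_rpow_of_pos (by norm_num), ENNReal.mul_top]
    · exact le_top
    · rw [Ne, ENNReal.ofReal_eq_zero, not_le]
      positivity
  · have hFG := left_ne_zero_of_mul h0
    have hF0 := left_ne_zero_of_mul hFG
    have hG0 := right_ne_zero_of_mul hFG
    have hK0 := right_ne_zero_of_mul h0
    have hFGt : (∫⁻ x, F x) * (∫⁻ x, G x) ≠ ⊤ := fun h => htop (by rw [h, ENNReal.top_mul hK0])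
    refine lintegral_young_of_ne_top hF hG hK (fun h => hFGt (by rw [h, ENNReal.top_mul hG0]))
      (fun h => hFGt (by rw [h, ENNReal.mul_top hF0]))
      (fun h => htop (by rw [h, ENNReal.mul_top hFG]))

theorem piFinSuccAbove_zero_symm_apply (p : ℝ × (Fin n → ℝ)) :
    (MeasurableEquiv.piFinSuccAbove (fun _ : Fin (n + 1) => ℝ) 0).symm p = Fin.cons p.1 p.2 := by
  change Fin.insertNth (α := fun _ : Fin (n + 1) => ℝ) 0 p.1 p.2 = _
  exact Fin.insertNth_zero' p.1 p.2

theorem lintegral_fin_succ {F : (Fin (n + 1) → ℝ) → ENNReal} (hF : Measurable F) :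
    ∫⁻ x, F x = ∫⁻ a : ℝ, ∫⁻ y : Fin n → ℝ, F (Fin.cons a y) := by
  have h := (volume_preserving_piFinSuccAbove (fun _ : Fin (n + 1) => ℝ) 0).symm
  rw [← h.lintegral_comp hF, Measure.volume_eq_prod, lintegral_prod]
  · simp only [piFinSuccAbove_zero_symm_apply]
  · exact (hF.comp (MeasurableEquiv.measurable _)).aemeasurable

theorem measurable_fin_cons_comp {F : (Fin (n + 1) → ℝ) → ENNReal} (hF : Measurable F) :
    Measurable fun p : ℝ × (Fin n → ℝ) => F (Fin.cons p.1 p.2) := by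
  have := hF.comp (MeasurableEquiv.piFinSuccAbove (fun _ : Fin (n + 1) => ℝ) 0).symm.measurable
  simpa only [Function.comp_def, piFinSuccAbove_zero_symm_apply] using this

theorem fin_cons_add (a b : ℝ) (x y : Fin n → ℝ) :
    (Fin.cons a x : Fin (n + 1) → ℝ) + Fin.cons b y = Fin.cons (a + b) (x + y) := by
  ext i
  refine Fin.cases ?_ (fun j => ?_) i <;> simp

/-- Sharp Young inequality on `ℝⁿ` for the exponents `3/2, 3/2, 3/2`. -/
theorem lintegral_young : ∀ {n : ℕ} {F G K : (Fin n → ℝ) → ENNReal}, Measurable F →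
    Measurable G → Measurable K →
    ∫⁻ x, ∫⁻ y, (F x * G y * K (x + y)) ^ (2 / 3 : ℝ) ≤
      ENNReal.ofReal ((√3 / 2) ^ n) *
        ((∫⁻ x, F x) * (∫⁻ x, G x) * ∫⁻ x, K x) ^ (2 / 3 : ℝ)
  | 0, F, G, K, _, _, _ => by
    have hv : volume (Set.univ : Set (Fin 0 → ℝ)) = 1 := by simp [volume_pi]
    simp only [lintegral_unique, hv, mul_one, pow_zero, ENNReal.ofReal_one, one_mul]
    refine le_of_eq ?_
    congr 3
    exact Subsingleton.elim _ _
  | n + 1, F, G, K, hF, hG, hK => by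
    have mF := measurable_fin_cons_comp hF
    have mG := measurable_fin_cons_comp hG
    have mK := measurable_fin_cons_comp hK
    have m4 : Measurable fun q : (ℝ × (Fin n → ℝ)) × (ℝ × (Fin n → ℝ)) =>
        (F (Fin.cons q.1.1 q.1.2) * G (Fin.cons q.2.1 q.2.2) *
          K (Fin.cons (q.1.1 + q.2.1) (q.1.2 + q.2.2))) ^ (2 / 3 : ℝ) := by
      have h1 : Measurable fun q : (ℝ × (Fin n → ℝ)) × (ℝ × (Fin n → ℝ)) =>
        F (Fin.cons q.1.1 q.1.2) := mF.comp measurable_fst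
      have h2 : Measurable fun q : (ℝ × (Fin n → ℝ)) × (ℝ × (Fin n → ℝ)) =>
        G (Fin.cons q.2.1 q.2.2) := mG.comp measurable_snd
      have h3 : Measurable fun q : (ℝ × (Fin n → ℝ)) × (ℝ × (Fin n → ℝ)) =>
        K (Fin.cons (q.1.1 + q.2.1) (q.1.2 + q.2.2)) :=
          mK.comp (f := fun q : (ℝ × (Fin n → ℝ)) × (ℝ × (Fin n → ℝ)) =>
            (q.1.1 + q.2.1, q.1.2 + q.2.2)) (by fun_prop)
      exact ((h1.mul h2).mul h3).pow_const _
    have mtot : Measurable fun p : (Fin (n + 1) → ℝ) × (Fin (n + 1) → ℝ) =>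
        (F p.1 * G p.2 * K (p.1 + p.2)) ^ (2 / 3 : ℝ) := by fun_prop
    calc ∫⁻ x, ∫⁻ y, (F x * G y * K (x + y)) ^ (2 / 3 : ℝ)
        = ∫⁻ a : ℝ, ∫⁻ x : Fin n → ℝ, ∫⁻ b : ℝ, ∫⁻ y : Fin n → ℝ,
          (F (Fin.cons a x) * G (Fin.cons b y) * K (Fin.cons (a + b) (x + y))) ^ (2 / 3 : ℝ) := by
          rw [lintegral_fin_succ mtot.lintegral_prod_right']
          refine lintegral_congr fun a => lintegral_congr fun x => ?_
          refine (lintegral_fin_succ (mtot.comp measurable_prodMk_left)).trans ?_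
          simp only [fin_cons_add, Function.comp]
      _ = ∫⁻ a : ℝ, ∫⁻ b : ℝ, ∫⁻ x : Fin n → ℝ, ∫⁻ y : Fin n → ℝ,
          (F (Fin.cons a x) * G (Fin.cons b y) * K (Fin.cons (a + b) (x + y))) ^ (2 / 3 : ℝ) := by
          refine lintegral_congr fun a => lintegral_lintegral_swap ?_
          refine Measurable.aemeasurable ?_
          have : Measurable fun q : ((Fin n → ℝ) × ℝ) × (Fin n → ℝ) =>
              (F (Fin.cons a q.1.1) * G (Fin.cons q.1.2 q.2) *
                K (Fin.cons (a + q.1.2) (q.1.1 + q.2))) ^ (2 / 3 : ℝ) :=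
            m4.comp (f := fun q : ((Fin n → ℝ) × ℝ) × (Fin n → ℝ) =>
              ((a, q.1.1), (q.1.2, q.2))) (by fun_prop)
          exact this.lintegral_prod_right'
      _ ≤ ∫⁻ a : ℝ, ∫⁻ b : ℝ, ENNReal.ofReal ((√3 / 2) ^ n) *
          ((∫⁻ x : Fin n → ℝ, F (Fin.cons a x)) * (∫⁻ y : Fin n → ℝ, G (Fin.cons b y)) *
            ∫⁻ y : Fin n → ℝ, K (Fin.cons (a + b) y)) ^ (2 / 3 : ℝ) := by
          gcongr with a b
          exact lintegral_young (mF.comp measurable_prodMk_left) (mG.comp measurable_prodMk_left)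
            (mK.comp measurable_prodMk_left)
      _ ≤ ENNReal.ofReal ((√3 / 2) ^ n) * (ENNReal.ofReal (√3 / 2) *
          ((∫⁻ a : ℝ, ∫⁻ x : Fin n → ℝ, F (Fin.cons a x)) *
          (∫⁻ a : ℝ, ∫⁻ x : Fin n → ℝ, G (Fin.cons a x)) *
          (∫⁻ a : ℝ, ∫⁻ x : Fin n → ℝ, K (Fin.cons a x))) ^ (2 / 3 : ℝ)) := by
          simp_rw [lintegral_const_mul' _ _ ENNReal.ofReal_ne_top]
          gcongr
          exact lintegral_young_line mF.lintegral_prod_right' mG.lintegral_prod_right'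
            mK.lintegral_prod_right'
      _ = _ := by
          rw [lintegral_fin_succ hF, lintegral_fin_succ hG, lintegral_fin_succ hK, ← mul_assoc,
            ← ENNReal.ofReal_mul (by positivity), pow_succ]

theorem lintegral_smul_of_abs_eq_one {s : ℝ} (hs : |s| = 1) (F : (Fin n → ℝ) → ENNReal) :
    ∫⁻ x, F (s • x) = ∫⁻ x, F x := by
  rcases eq_or_eq_neg_of_abs_eq hs with rfl | rfl
  · simp
  · simpa using lintegral_neg_eq_self F

theorem lintegral_triple_le {P : Set (Fin n → ℝ)} (hP : MeasurableSet P) {s t : ℝ} (hs : |s| = 1)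
    (ht : |t| = 1) (z : Fin n → ℝ) :
    ∫⁻ a, ∫⁻ b, (if a ∈ P ∧ b ∈ P ∧ s • a + t • b + z ∈ P then 1 else 0) ≤
      ENNReal.ofReal ((√3 / 2) ^ n) * (volume P * volume P) := by
  have hs2 : s * s = 1 := by rw [← abs_mul_abs_self, hs, one_mul]
  have ht2 : t * t = 1 := by rw [← abs_mul_abs_self, ht, one_mul]
  set I : (Fin n → ℝ) → ENNReal := P.indicator 1 with hI
  have mI : Measurable I := measurable_one.indicator hP
  have hvol : ∫⁻ x, I x = volume P := lintegral_indicator_one hP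
  have h := lintegral_young (F := fun x => I (s • x)) (G := fun x => I (t • x))
    (K := fun x => I (x + z)) (by fun_prop) (by fun_prop) (by fun_prop)
  rw [lintegral_smul_of_abs_eq_one hs, lintegral_smul_of_abs_eq_one ht,
    lintegral_add_right_eq_self I z, hvol] at h
  have hpow : (volume P * volume P * volume P) ^ (2 / 3 : ℝ) = volume P * volume P := by
    rw [show volume P * volume P * volume P = volume P ^ (3 : ℝ) by
      rw [show (3 : ℝ) = ((3 : ℕ) : ℝ) by norm_num, ENNReal.rpow_natCast]; ring,
      ← ENNReal.rpow_mul, show (3 : ℝ) * (2 / 3) = ((2 : ℕ) : ℝ) by norm_num,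
      ENNReal.rpow_natCast, sq]
  rw [hpow] at h
  refine le_trans (le_of_eq ?_) h
  rw [← lintegral_smul_of_abs_eq_one hs]
  refine lintegral_congr fun x => ?_
  rw [← lintegral_smul_of_abs_eq_one ht]
  refine lintegral_congr fun y => ?_
  rw [smul_smul, smul_smul, hs2, ht2, one_smul, one_smul]
  by_cases h1 : s • x ∈ P <;> by_cases h2 : t • y ∈ P <;> by_cases h3 : x + y + z ∈ P <;>
    simp [hI, h1, h2, h3]

end YoungInequality

section ShapeIntegrals

variable {n r h : ℕ}

/-- The tuple of the linear combinations of a tuple given by the rows of a matrix. -/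
def leftMul (A : Matrix (Fin h) (Fin r) ℝ) (Y : Fin r → Fin n → ℝ) : Fin h → Fin n → ℝ :=
  fun i => ∑ k, A i k • Y k

theorem leftMul_mul {p : ℕ} (A : Matrix (Fin h) (Fin r) ℝ) (B : Matrix (Fin r) (Fin p) ℝ)
    (Y : Fin p → Fin n → ℝ) : leftMul (A * B) Y = leftMul A (leftMul B Y) := by
  funext i
  simp only [leftMul, mul_apply, Finset.sum_smul, Finset.smul_sum, smul_smul]
  exact Finset.sum_comm

theorem measurable_leftMul (A : Matrix (Fin h) (Fin r) ℝ) :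
    Measurable (leftMul A : (Fin r → Fin n → ℝ) → _) := by
  refine measurable_pi_lambda _ fun i => ?_
  exact Finset.measurable_sum _ fun k _ => (measurable_pi_apply k).const_smul (A i k)

theorem lintegral_comp_leftMul {A : Matrix (Fin r) (Fin r) ℝ} (hA : A.det ≠ 0)
    {H : (Fin r → Fin n → ℝ) → ENNReal} (hH : Measurable H) :
    ∫⁻ Y, H (leftMul A Y) = ENNReal.ofReal (|A.det|⁻¹ ^ n) * ∫⁻ Y, H Y := by
  let f : (Fin r → Fin n → ℝ) →ₗ[ℝ] (Fin r → Fin n → ℝ) :=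
    { toFun := leftMul A
      map_add' := fun X Y => by
        funext i
        simp [leftMul, Finset.sum_add_distrib]
      map_smul' := fun c X => by
        funext i
        simp only [leftMul, Pi.smul_apply, Finset.smul_sum, RingHom.id_apply]
        exact Finset.sum_congr rfl fun k _ => smul_comm _ _ _ }
  let σ : (Fin n → Fin r → ℝ) ≃ₗ[ℝ] (Fin r → Fin n → ℝ) :=
    { toFun := fun X i j => X j i
      invFun := fun X i j => X j i
      left_inv := fun _ => rfl
      right_inv := fun _ => rfl
      map_add' := fun _ _ => rfl
      map_smul' := fun _ _ => rfl }
  have hf : f = σ.toLinearMap ∘ₗ (LinearMap.pi fun j => (toLin' A) ∘ₗ LinearMap.proj j) ∘ₗ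
      σ.symm.toLinearMap := by
    refine LinearMap.ext fun X => ?_
    funext i j
    simp [f, σ, leftMul, mulVec, dotProduct]
  have hdet : LinearMap.det f = A.det ^ n := by
    rw [hf, LinearMap.det_conj, LinearMap.det_pi]
    simp
  have hmap := Measure.map_linearMap_addHaar_eq_smul_addHaar
    (volume : Measure (Fin r → Fin n → ℝ)) (f := f) (by rw [hdet]; exact pow_ne_zero _ hA)
  change ∫⁻ Y, H (f Y) = _
  have h1 : ∫⁻ Y, H Y ∂(Measure.map f volume) = ∫⁻ Y, H (f Y) :=
    lintegral_map hH (measurable_leftMul A)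
  rw [← h1, hmap, hdet, lintegral_smul_measure, abs_inv, abs_pow, inv_pow]
  rfl

/-- The indicator of the tuples of pairwise distinct points of `P`. -/
noncomputable def injIndicator (P : Set (Fin n → ℝ)) (X : Fin h → Fin n → ℝ) : ENNReal :=
  if (∀ i, X i ∈ P) ∧ Function.Injective X then 1 else 0

theorem measurable_injIndicator {P : Set (Fin n → ℝ)} (hP : MeasurableSet P) :
    Measurable (injIndicator P : (Fin h → Fin n → ℝ) → ENNReal) := by
  refine Measurable.ite ?_ measurable_const measurable_const
  refine MeasurableSet.inter ?_ ?_
  · have : {X : Fin h → Fin n → ℝ | ∀ i, X i ∈ P} = ⋂ i, (fun X => X i) ⁻¹' P := by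
      ext; simp
    change MeasurableSet {X : Fin h → Fin n → ℝ | ∀ i, X i ∈ P}
    rw [this]
    exact MeasurableSet.iInter fun i => measurable_pi_apply i hP
  · have : {X : Fin h → Fin n → ℝ | Function.Injective X} =
        ⋂ i, ⋂ j, {X | X i = X j → i = j} := by
      ext; simp [Function.Injective]
    change MeasurableSet {X : Fin h → Fin n → ℝ | Function.Injective X}
    rw [this]
    refine MeasurableSet.iInter fun i => MeasurableSet.iInter fun j => ?_
    by_cases hij : i = j
    · simp [hij]
    · simp only [hij, imp_false]
      exact (measurableSet_eq_fun (measurable_pi_apply i) (measurable_pi_apply j)).compl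

theorem leftMul_apply_of_row {A : Matrix (Fin h) (Fin r) ℝ} {i : Fin h} {j : Fin r} {c : ℝ}
    (hA : ∀ k, A i k = if j = k then c else 0) (Y : Fin r → Fin n → ℝ) :
    leftMul A Y i = c • Y j := by
  simp [leftMul, hA, ite_smul]

theorem lintegral_box (P : Set (Fin n → ℝ)) (hP : MeasurableSet P) :
    ∫⁻ Y : Fin r → Fin n → ℝ, (if ∀ j, Y j ∈ P then 1 else 0) = volume P ^ r := by
  have h1 : (fun Y : Fin r → Fin n → ℝ => if ∀ j, Y j ∈ P then (1 : ENNReal) else 0) =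
      (Set.univ.pi fun _ => P).indicator 1 := by
    funext Y
    by_cases h : ∀ j, Y j ∈ P <;> simp [Set.indicator, h]
  rw [h1, lintegral_indicator_one (MeasurableSet.univ_pi fun _ => hP), volume_pi_pi]
  simp

theorem lintegral_injIndicator_leftMul_le {P : Set (Fin n → ℝ)} (hP : MeasurableSet P)
    {A : Matrix (Fin h) (Fin r) ℝ} {e : Fin r → Fin h}
    (hA : ∀ j k, A (e j) k = if j = k then 1 else 0) :
    ∫⁻ Y, injIndicator P (leftMul A Y : Fin h → Fin n → ℝ) ≤ volume P ^ r := by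
  rw [← lintegral_box P hP]
  refine lintegral_mono fun Y => ?_
  simp only [injIndicator]
  by_cases h1 : (∀ i, (leftMul A Y : Fin h → Fin n → ℝ) i ∈ P) ∧ Function.Injective (leftMul A Y)
  · have : ∀ j, Y j ∈ P := fun j => by
      have := h1.1 (e j)
      rwa [leftMul_apply_of_row (hA j), one_smul] at this
    simp [this, h1]
  · simp [h1]

theorem lintegral_box_inter_le {P : Set (Fin n → ℝ)} (hP : MeasurableSet P)
    {c : Fin r → ℝ} {k l : Fin r} (hkl : k ≠ l) (hk : |c k| = 1) (hl : |c l| = 1) :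
    ∫⁻ Y : Fin r → Fin n → ℝ, (if (∀ j, Y j ∈ P) ∧ ∑ j, c j • Y j ∈ P then 1 else 0) ≤
      ENNReal.ofReal ((√3 / 2) ^ n) * volume P ^ r := by
  have hm1 : MeasurableSet {Y : Fin r → Fin n → ℝ | ∀ j, Y j ∈ P} := by
    have : {Y : Fin r → Fin n → ℝ | ∀ j, Y j ∈ P} = ⋂ i, (fun X => X i) ⁻¹' P := by
      ext; simp
    rw [this]
    exact MeasurableSet.iInter fun i => measurable_pi_apply i hP
  have hm2 : MeasurableSet {Y : Fin r → Fin n → ℝ | ∑ j, c j • Y j ∈ P} :=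
    (Finset.measurable_sum _ fun j _ => (measurable_pi_apply j).const_smul (c j) :
      Measurable fun Y : Fin r → Fin n → ℝ => ∑ j, c j • Y j) hP
  have hm12 : Measurable fun Y : Fin r → Fin n → ℝ =>
      if (∀ j, Y j ∈ P) ∧ ∑ j, c j • Y j ∈ P then (1 : ENNReal) else 0 :=
    Measurable.ite (hm1.inter hm2) measurable_const measurable_const
  have hm3 : Measurable fun Y : Fin r → Fin n → ℝ => ENNReal.ofReal ((√3 / 2) ^ n) *
      if ∀ j, Y j ∈ P then (1 : ENNReal) else 0 :=
    (Measurable.ite hm1 measurable_const measurable_const).const_mul _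
  rw [← lintegral_box P hP, ← lintegral_const_mul _
    (Measurable.ite hm1 measurable_const measurable_const)]
  refine lintegral_le_of_lmarginal_le {k, l} hm12 hm3 fun x => ?_
  rw [lmarginal_insert _ hm12 (by simpa using hkl), lmarginal_insert _ hm3 (by simpa using hkl)]
  simp only [lmarginal_singleton]
  let u : (Fin n → ℝ) → (Fin n → ℝ) → Fin r → Fin n → ℝ := fun a b =>
    Function.update (Function.update x k a) l b
  have huk : ∀ a b, u a b k = a := fun a b => by simp [u, hkl]
  have hul : ∀ a b, u a b l = b := fun a b => by simp [u]
  have huo : ∀ a b j, j ≠ k → j ≠ l → u a b j = x j := fun a b j h1 h2 => by simp [u, h1, h2]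
  change ∫⁻ a, ∫⁻ b, (if (∀ j, u a b j ∈ P) ∧ ∑ j, c j • u a b j ∈ P then 1 else 0) ≤
    ∫⁻ a, ∫⁻ b, ENNReal.ofReal ((√3 / 2) ^ n) * (if ∀ j, u a b j ∈ P then 1 else 0)
  obtain ⟨Q, hQ⟩ : ∃ Q : Prop, Q ↔ ∀ j, j ≠ k → j ≠ l → x j ∈ P := ⟨_, Iff.rfl⟩
  have hall : ∀ a b, (∀ j, u a b j ∈ P) ↔ (a ∈ P ∧ b ∈ P ∧ Q) := by
    intro a b
    rw [hQ]
    constructor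
    · intro hh
      exact ⟨huk a b ▸ hh k, hul a b ▸ hh l, fun j h1 h2 => huo a b j h1 h2 ▸ hh j⟩
    · rintro ⟨h1, h2, h3⟩ j
      by_cases hjk : j = k
      · rw [hjk, huk]; exact h1
      by_cases hjl : j = l
      · rw [hjl, hul]; exact h2
      rw [huo a b j hjk hjl]; exact h3 j hjk hjl
  have hsum : ∀ a b, ∑ j, c j • u a b j =
      c k • a + c l • b + ∑ j ∈ (Finset.univ.erase k).erase l, c j • x j := by
    intro a b
    rw [← Finset.add_sum_erase _ _ (Finset.mem_univ k), ← Finset.add_sum_erase _ _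
      (show l ∈ Finset.univ.erase k by simp [hkl.symm]), huk, hul, add_assoc]
    congr 2
    refine Finset.sum_congr rfl fun j hj => ?_
    simp only [Finset.mem_erase, Finset.mem_univ, and_true] at hj
    rw [huo a b j hj.2 hj.1]
  simp only [hall, hsum]
  by_cases hx : Q
  · have hR : ∫⁻ a, ∫⁻ b, ENNReal.ofReal ((√3 / 2) ^ n) * (if a ∈ P ∧ b ∈ P ∧
        Q then 1 else 0) =
        ENNReal.ofReal ((√3 / 2) ^ n) * (volume P * volume P) := by
      have : ∀ a b : Fin n → ℝ, ENNReal.ofReal ((√3 / 2) ^ n) * (if a ∈ P ∧ b ∈ P ∧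
        Q then 1 else 0) = ENNReal.ofReal ((√3 / 2) ^ n) *
          (P.indicator 1 a * P.indicator 1 b) := by
        intro a b
        by_cases ha : a ∈ P <;> by_cases hb : b ∈ P <;> simp [ha, hb, hx]
      simp only [this]
      have hi : Measurable (P.indicator (1 : (Fin n → ℝ) → ENNReal)) :=
        measurable_one.indicator hP
      have h2 : ∀ a : Fin n → ℝ, ∫⁻ b : Fin n → ℝ, ENNReal.ofReal ((√3 / 2) ^ n) *
          (P.indicator 1 a * P.indicator 1 b) = ENNReal.ofReal ((√3 / 2) ^ n) *
            (P.indicator 1 a * volume P) := by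
        intro a
        rw [lintegral_const_mul _ (hi.const_mul _), lintegral_const_mul _ hi,
          lintegral_indicator_one hP]
      simp only [h2]
      rw [lintegral_const_mul _ (hi.mul_const _), lintegral_mul_const _ hi,
        lintegral_indicator_one hP]
    rw [hR]
    refine le_trans (le_of_eq ?_) (lintegral_triple_le hP hk hl
      (∑ j ∈ (Finset.univ.erase k).erase l, c j • x j))
    refine lintegral_congr fun a => lintegral_congr fun b => ?_
    by_cases ha : a ∈ P <;> by_cases hb : b ∈ P <;> simp [ha, hb, hx]
  · simp [hx]

theorem lintegral_injIndicator_leftMul_le_of_int {P : Set (Fin n → ℝ)} (hP : MeasurableSet P)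
    (h0 : 0 ∉ P) (hneg : ∀ x ∈ P, -x ∉ P) {K : Matrix (Fin h) (Fin r) ℤ} {e : Fin r → Fin h}
    (hK : ∀ j k, K (e j) k = if j = k then 1 else 0) (hK1 : ∀ i k, |K i k| ≤ 1) (hrh : r < h) :
    ∫⁻ Y, injIndicator P (leftMul (K.map (Int.cast : ℤ → ℝ)) Y : Fin h → Fin n → ℝ) ≤
      ENNReal.ofReal ((√3 / 2) ^ n) * volume P ^ r := by
  obtain ⟨i, hi⟩ : ∃ i, i ∉ Set.range e := by
    by_contra hcon
    push Not at hcon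
    have := Fintype.card_le_of_surjective e hcon
    simp at this
    omega
  have hrow : ∀ j k, (K.map (Int.cast : ℤ → ℝ)) (e j) k = if j = k then 1 else 0 := by
    intro j k
    by_cases hjk : j = k <;> simp [hK, hjk]
  have hej : ∀ Y : Fin r → Fin n → ℝ, ∀ j,
      leftMul (K.map (Int.cast : ℤ → ℝ)) Y (e j) = Y j := fun Y j => by
    rw [leftMul_apply_of_row (hrow j), one_smul]
  by_cases htwo : ∃ k l, k ≠ l ∧ K i k ≠ 0 ∧ K i l ≠ 0
  · obtain ⟨k, l, hkl, hk, hl⟩ := htwo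
    have habs : ∀ k, K i k ≠ 0 → |((K.map (Int.cast : ℤ → ℝ)) i k)| = 1 := by
      intro k hk
      have h1 : |K i k| = 1 := le_antisymm (hK1 i k) (Int.one_le_abs hk)
      simp only [map_apply]
      exact_mod_cast h1
    refine le_trans (lintegral_mono fun Y => ?_)
      (lintegral_box_inter_le hP hkl (habs k hk) (habs l hl))
    simp only [injIndicator]
    by_cases h1 : (∀ i, (leftMul (K.map (Int.cast : ℤ → ℝ)) Y : Fin h → Fin n → ℝ) i ∈ P) ∧
        Function.Injective (leftMul (K.map (Int.cast : ℤ → ℝ)) Y)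
    · have h2 : ∀ j, Y j ∈ P := fun j => hej Y j ▸ h1.1 (e j)
      have h3 : ∑ j, (K.map (Int.cast : ℤ → ℝ)) i j • Y j ∈ P := h1.1 i
      rw [if_pos h1, if_pos ⟨h2, h3⟩]
    · simp [h1]
  · push Not at htwo
    suffices hs : ∀ Y : Fin r → Fin n → ℝ,
        injIndicator P (leftMul (K.map (Int.cast : ℤ → ℝ)) Y) = 0 by simp [hs]
    intro Y
    simp only [injIndicator, ite_eq_right_iff, one_ne_zero, imp_false, not_and]
    intro h1 h2
    have h3 : ∀ j, Y j ∈ P := fun j => hej Y j ▸ h1 (e j)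
    by_cases hz : ∃ k, K i k ≠ 0
    · obtain ⟨k, hk⟩ := hz
      have hkr : ∀ l, (K.map (Int.cast : ℤ → ℝ)) i l = if k = l then (K i k : ℝ) else 0 := by
        intro l
        by_cases hl : k = l
        · simp [hl]
        · simp [hl, htwo k l hl hk]
      have h4 := leftMul_apply_of_row hkr Y
      have h5 : |K i k| = 1 := le_antisymm (hK1 i k) (Int.one_le_abs hk)
      rcases (abs_eq zero_le_one).mp h5 with h6 | h6
      · rw [h6] at h4
        refine hi ⟨k, h2 ?_⟩
        rw [hej, h4]
        simp
      · rw [h6] at h4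
        refine hneg _ (h3 k) ?_
        have := h1 i
        rw [h4] at this
        simpa using this
    · push Not at hz
      refine h0 ?_
      have := h1 i
      simpa [leftMul, hz] using this

end ShapeIntegrals

section DependentSums

variable {n r h : ℕ}

/-- The matrices with entries at most `d` in absolute value whose rows indexed by `e` form `d`
times the identity. -/
noncomputable def shapeMats (e : Fin r ↪o Fin h) (d : ℕ) : Finset (Fin h → Fin r → ℤ) :=
  Fintype.piFinset fun i => if hi : ∃ j, e j = i then {Pi.single hi.choose (d : ℤ)} else
    Fintype.piFinset fun _ => Finset.Icc (-d : ℤ) d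

theorem mem_shapeMats {e : Fin r ↪o Fin h} {d : ℕ} {K : Fin h → Fin r → ℤ} :
    K ∈ shapeMats e d ↔ (∀ i k, |K i k| ≤ d) ∧
      ∀ j k, K (e j) k = if j = k then (d : ℤ) else 0 := by
  have hch : ∀ j, (⟨j, rfl⟩ : ∃ j', e j' = e j).choose = j := fun j =>
    e.injective (⟨j, rfl⟩ : ∃ j', e j' = e j).choose_spec
  simp only [shapeMats, Fintype.mem_piFinset]
  constructor
  · intro hK
    have h2 : ∀ j k, K (e j) k = if j = k then (d : ℤ) else 0 := by
      intro j k
      have := hK (e j)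
      rw [dif_pos ⟨j, rfl⟩, Finset.mem_singleton, hch j] at this
      rw [this, Pi.single_apply]
      simp only [eq_comm]
    refine ⟨fun i k => ?_, h2⟩
    by_cases hi : ∃ j, e j = i
    · obtain ⟨j, rfl⟩ := hi
      rw [h2]
      by_cases hjk : j = k <;> simp [hjk]
    · have := hK i
      rw [dif_neg hi, Fintype.mem_piFinset] at this
      have := this k
      rw [Finset.mem_Icc] at this
      exact abs_le.mpr this
  · rintro ⟨h1, h2⟩ i
    by_cases hi : ∃ j, e j = i
    · obtain ⟨j, rfl⟩ := hi
      rw [dif_pos ⟨j, rfl⟩, Finset.mem_singleton, hch j]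
      funext k
      rw [h2, Pi.single_apply]
      simp only [eq_comm]
    · rw [dif_neg hi, Fintype.mem_piFinset]
      intro k
      exact Finset.mem_Icc.mpr (abs_le.mp (h1 i k))

theorem card_shapeMats (e : Fin r ↪o Fin h) (d : ℕ) :
    (shapeMats e d).card = (2 * d + 1) ^ (r * (h - r)) := by
  rw [shapeMats, Fintype.card_piFinset]
  have h1 : ∀ i : Fin h, (if hi : ∃ j, e j = i then
      ({Pi.single hi.choose (d : ℤ)} : Finset (Fin r → ℤ)) else
      Fintype.piFinset fun _ => Finset.Icc (-d : ℤ) d).card =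
      if i ∈ (Finset.univ.image e) then 1 else (2 * d + 1) ^ r := by
    intro i
    by_cases hi : ∃ j, e j = i
    · have : i ∈ Finset.univ.image e := by simpa using hi
      rw [dif_pos hi, if_pos this, Finset.card_singleton]
    · have : i ∉ Finset.univ.image e := by simpa using hi
      rw [dif_neg hi, if_neg this, Fintype.card_piFinset]
      simp only [Int.card_Icc, Finset.prod_const, Finset.card_univ, Fintype.card_fin]
      congr 1
      omega
  rw [Finset.prod_congr rfl fun i _ => h1 i, Finset.prod_ite, Finset.prod_const_one, one_mul,
    Finset.prod_const, ← pow_mul]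
  congr 2
  have h2 : (Finset.univ.filter fun i => i ∉ Finset.univ.image e) = (Finset.univ.image e)ᶜ := by
    ext; simp
  rw [h2, Finset.card_compl, Finset.card_image_of_injective _ e.injective]
  simp

/-- The admissible index data `(r, e, d, K)` of dependent `h`-tuples, with `d` shifted by one. -/
abbrev ShapeIndex (h : ℕ) := Σ r : Fin h, Σ e : Fin r ↪o Fin h, Σ d : ℕ, shapeMats e (d + 1)

/-- The matrix of an index. -/
def ShapeIndex.mat (σ : ShapeIndex h) : Matrix (Fin h) (Fin σ.1) ℤ := σ.2.2.2.1

/-- The lattice sum dominating the contribution of dependent tuples of a given shape. -/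
noncomputable def shapeLatSum (F : (Fin h → Fin n → ℝ) → ENNReal) (σ : ShapeIndex h)
    (g : SLR n) : ENNReal :=
  if hB : ∃ B, IsTupleShape σ.2.1 (σ.2.2.1 + 1) σ.mat B then
    latSum (fun Y => F (leftMul (hB.choose.map (Int.cast : ℤ → ℝ)) Y)) g else 0

theorem tsum_tupleShape_le {e : Fin r → Fin h} {d : ℕ} (hd : 0 < d)
    {K B : Matrix (Fin h) (Fin r) ℤ} (hB : IsTupleShape e d K B)
    (F : (Fin h → Fin n → ℝ) → ENNReal) (g : SLR n) :
    ∑' m : Matrix (Fin h) (Fin n) ℤ, (if (d : ℤ) • m = K * m.submatrix e id ∧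
      LinearIndependent ℝ (castMat (m.submatrix e id)) then
        F (rowMul (g : Matrix (Fin n) (Fin n) ℝ) (castMat m)) else 0) ≤
    latSum (fun Y => F (leftMul (B.map (Int.cast : ℤ → ℝ)) Y)) g := by
  let T : Set (Matrix (Fin h) (Fin n) ℤ) := {m | (d : ℤ) • m = K * m.submatrix e id ∧
      LinearIndependent ℝ (castMat (m.submatrix e id))}
  have hN : ∀ m : T, ∃ N : Matrix (Fin r) (Fin n) ℤ, (m : Matrix (Fin h) (Fin n) ℤ) = B * N := by
    rintro ⟨m, hm1, hm2⟩
    have : ∀ l, ∃ w, (fun i => m i l) = B *ᵥ w := fun l => hB.exists_eq _ (by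
      funext i
      exact congrFun (congrFun hm1 i) l)
    choose N hN using this
    refine ⟨Matrix.of fun j l => N l j, ?_⟩
    ext i l
    exact congrFun (hN l) i
  choose N hN using hN
  have hinj : Function.Injective N := by
    intro m m' hmm
    apply Subtype.ext
    rw [hN m, hN m', hmm]
  have hdet : ((B.submatrix e id).map (Int.cast : ℤ → ℝ)).det ≠ 0 := by
    rw [det_map_intCast]
    have h1 : (B.submatrix e id).det ≠ 0 := by
      rw [← abs_pos, hB.det_eq]
      exact_mod_cast hd
    exact_mod_cast h1
  have hLI : ∀ m : T, LinearIndependent ℝ (castMat (N m)) := by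
    intro m
    have h1 : LinearIndependent ℝ
        (((m : Matrix (Fin h) (Fin n) ℤ).submatrix e id).map (Int.cast : ℤ → ℝ)).row := m.2.2
    have h2 : (m : Matrix (Fin h) (Fin n) ℤ).submatrix e id = B.submatrix e id * N m := by
      conv_lhs => rw [hN m]
      rfl
    rw [h2, intCast_map_mul] at h1
    exact (linearIndependent_mul_iff hdet _).mp h1
  let q : (Fin r → Fin n → ℤ) → ENNReal := fun N => if LinearIndependent ℝ (castMat N) then
    F (leftMul (B.map (Int.cast : ℤ → ℝ)) (rowMul (g : Matrix (Fin n) (Fin n) ℝ) (castMat N)))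
      else 0
  have hrow : ∀ N : Matrix (Fin r) (Fin n) ℤ,
      leftMul (B.map (Int.cast : ℤ → ℝ)) (rowMul (g : Matrix (Fin n) (Fin n) ℝ) (castMat N)) =
      rowMul (g : Matrix (Fin n) (Fin n) ℝ) (castMat (B * N : Matrix (Fin h) (Fin n) ℤ)) := by
    intro N
    funext i
    have : castMat (B * N : Matrix (Fin h) (Fin n) ℤ) i =
        ∑ k, (B.map (Int.cast : ℤ → ℝ)) i k • castMat N k := by
      funext l
      simp [castMat, mul_apply]
    simp only [leftMul, rowMul, this, sum_vecMul, smul_vecMul]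
  calc _ = ∑' m : Matrix (Fin h) (Fin n) ℤ, T.indicator (fun m =>
        F (rowMul (g : Matrix (Fin n) (Fin n) ℝ) (castMat m))) m := by
        refine tsum_congr fun m => ?_
        simp only [Set.indicator, T, Set.mem_ofPred_eq]
    _ = ∑' m : T, F (rowMul (g : Matrix (Fin n) (Fin n) ℝ)
          (castMat (m : Matrix (Fin h) (Fin n) ℤ))) := (tsum_subtype T _).symm
    _ = ∑' m : T, q (N m) := by
        refine tsum_congr fun m => ?_
        simp only [q, hLI m, if_true, hrow]
        rw [← hN m]
    _ ≤ ∑' N, q N := ENNReal.tsum_comp_le_tsum_of_injective hinj q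

/-- The sum of a function over all linearly dependent `h`-tuples in the lattice `ℤ^n g`. -/
noncomputable def depSum (F : (Fin h → Fin n → ℝ) → ENNReal) (g : SLR n) : ENNReal :=
  ∑' m : Fin h → Fin n → ℤ, if LinearIndependent ℝ (castMat m) then 0 else
    F (rowMul (g : Matrix (Fin n) (Fin n) ℝ) (castMat m))

theorem depSum_le (F : (Fin h → Fin n → ℝ) → ENNReal) (g : SLR n) :
    depSum F g ≤ ∑' σ, shapeLatSum F σ g := by
  let P : ShapeIndex h → Matrix (Fin h) (Fin n) ℤ → Prop := fun σ m =>
    ((σ.2.2.1 + 1 : ℕ) : ℤ) • m = σ.mat * m.submatrix σ.2.1 id ∧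
      LinearIndependent ℝ (castMat (m.submatrix σ.2.1 id))
  have h1 : depSum F g ≤ ∑' m : Fin h → Fin n → ℤ, ∑' σ : ShapeIndex h,
      if (∃ B, IsTupleShape σ.2.1 (σ.2.2.1 + 1) σ.mat B) ∧
        P σ m then F (rowMul (g : Matrix (Fin n) (Fin n) ℝ) (castMat m)) else 0 := by
    refine ENNReal.tsum_le_tsum fun m => ?_
    by_cases hm : LinearIndependent ℝ (castMat m)
    · simp [hm]
    obtain ⟨r, e, d, K, B, hd, hB, hK1, hK2, hK3, hK4⟩ := exists_isTupleShape m
    have hrh : r < h := by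
      by_contra hcon
      have hle : r ≤ h := by simpa using Fintype.card_le_of_embedding e.toEmbedding
      obtain rfl : r = h := by omega
      refine hm ?_
      exact (linearIndependent_equiv (Equiv.ofBijective e
        (Finite.injective_iff_bijective.mp e.injective))).mp hK4
    obtain ⟨d, rfl⟩ : ∃ d', d = d' + 1 := ⟨d - 1, by omega⟩
    refine le_trans (le_of_eq ?_)
      (ENNReal.le_tsum (⟨⟨r, hrh⟩, e, d, K, mem_shapeMats.mpr ⟨hK1, hK2⟩⟩ : ShapeIndex h))
    rw [if_neg hm, if_pos]
    exact ⟨⟨B, hB⟩, hK3, hK4⟩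
  rw [ENNReal.tsum_comm] at h1
  refine h1.trans (ENNReal.tsum_le_tsum fun σ => ?_)
  by_cases hB : ∃ B, IsTupleShape σ.2.1 (σ.2.2.1 + 1) σ.mat B
  · simp only [shapeLatSum, hB, dif_pos, true_and]
    exact tsum_tupleShape_le (Nat.succ_pos _) hB.choose_spec F g
  · simp [hB]

theorem lintegral_leftMul_tupleShape {e : Fin r → Fin h} {d : ℕ} (hd : 0 < d)
    {K B : Matrix (Fin h) (Fin r) ℤ} (hB : IsTupleShape e d K B)
    {F : (Fin h → Fin n → ℝ) → ENNReal} (hF : Measurable F) :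
    ∫⁻ Y, F (leftMul (B.map (Int.cast : ℤ → ℝ)) Y) = ENNReal.ofReal ((d : ℝ)⁻¹ ^ n) *
      ∫⁻ Y, F (leftMul ((d : ℝ)⁻¹ • K.map (Int.cast : ℤ → ℝ)) Y) := by
  have hd' : (d : ℝ) ≠ 0 := by exact_mod_cast hd.ne'
  have habs : |((B.submatrix e id).map (Int.cast : ℤ → ℝ)).det| = d := by
    rw [det_map_intCast]
    exact_mod_cast hB.det_eq
  have h1 : B.map (Int.cast : ℤ → ℝ) = ((d : ℝ)⁻¹ • K.map (Int.cast : ℤ → ℝ)) *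
      (B.submatrix e id).map (Int.cast : ℤ → ℝ) := by
    rw [Matrix.smul_mul, ← intCast_map_mul, ← hB.smul_eq]
    ext i j
    simp [hd']
  rw [h1]
  simp only [leftMul_mul]
  rw [lintegral_comp_leftMul (H := fun Y => F (leftMul ((d : ℝ)⁻¹ • K.map (Int.cast : ℤ → ℝ)) Y))
    _ (hF.comp (measurable_leftMul _)), habs]
  rw [← abs_pos, habs]
  exact_mod_cast hd

/-- The decay factor in the bound for the contribution of tuples of index `d`. -/
noncomputable def shapeFactor (n d : ℕ) : ENNReal :=
  if d = 1 then ENNReal.ofReal ((√3 / 2) ^ n) else ENNReal.ofReal ((d : ℝ)⁻¹ ^ n)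

theorem lintegral_injIndicator_tupleShape_le {P : Set (Fin n → ℝ)} (hP : MeasurableSet P)
    (h0 : 0 ∉ P) (hneg : ∀ x ∈ P, -x ∉ P) (hrh : r < h) {e : Fin r → Fin h} {d : ℕ} (hd : 0 < d)
    {K B : Matrix (Fin h) (Fin r) ℤ} (hB : IsTupleShape e d K B) (hK1 : ∀ i k, |K i k| ≤ d)
    (hK2 : ∀ j k, K (e j) k = if j = k then (d : ℤ) else 0) :
    ∫⁻ Y, injIndicator P (leftMul (B.map (Int.cast : ℤ → ℝ)) Y : Fin h → Fin n → ℝ) ≤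
      shapeFactor n d * volume P ^ r := by
  have hd' : (d : ℝ) ≠ 0 := by exact_mod_cast hd.ne'
  rw [lintegral_leftMul_tupleShape hd hB (measurable_injIndicator hP)]
  by_cases h1 : d = 1
  · subst h1
    simp only [shapeFactor, if_true, Nat.cast_one, inv_one, one_pow, ENNReal.ofReal_one, one_mul,
      one_smul]
    refine lintegral_injIndicator_leftMul_le_of_int hP h0 hneg (e := e) (fun j k => ?_) hK1 hrh
    simpa using hK2 j k
  · simp only [shapeFactor, h1, if_false]
    gcongr
    refine lintegral_injIndicator_leftMul_le hP (e := e) fun j k => ?_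
    by_cases hjk : j = k <;> simp [hK2, hjk, hd']

theorem lintegral_shapeLatSum_le {P : Set (Fin n → ℝ)} (hP : MeasurableSet P)
    (h0 : 0 ∉ P) (hneg : ∀ x ∈ P, -x ∉ P) (hn : h < n) (μ : Measure (LatSpace n))
    [IsProbabilityMeasure μ] (hinv : ∀ a : SLR n, μ.map (rTranslate n a) = μ)
    (σ : ShapeIndex h) :
    ∫⁻ x, shapeLatSum (injIndicator P) σ (latRep x) ∂μ ≤
      shapeFactor n (σ.2.2.1 + 1) * volume P ^ (σ.1 : ℕ) := by
  by_cases hB : ∃ B, IsTupleShape σ.2.1 (σ.2.2.1 + 1) σ.mat B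
  swap
  · simp [shapeLatSum, hB]
  simp only [shapeLatSum, hB, dif_pos]
  obtain ⟨hK1, hK2⟩ := mem_shapeMats.mp σ.2.2.2.2
  refine le_trans (le_of_eq ?_) (lintegral_injIndicator_tupleShape_le hP h0 hneg σ.1.2
    (Nat.succ_pos _) hB.choose_spec hK1 hK2)
  exact lintegral_latSum (σ.1.2.trans hn) μ hinv
    ((measurable_injIndicator hP).comp (measurable_leftMul _))

theorem measurable_shapeLatSum {F : (Fin h → Fin n → ℝ) → ENNReal} (hF : Measurable F)
    (σ : ShapeIndex h) : Measurable fun x => shapeLatSum F σ (latRep x) := by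
  by_cases hB : ∃ B, IsTupleShape σ.2.1 (σ.2.2.1 + 1) σ.mat B
  · simp only [shapeLatSum, hB, dif_pos]
    exact (isLatInvariant_latSum _).measurable
      (measurable_latSum (hF.comp (measurable_leftMul _)))
  · simp [shapeLatSum, hB]

theorem lintegral_depSum_le {P : Set (Fin n → ℝ)} (hP : MeasurableSet P)
    (h0 : 0 ∉ P) (hneg : ∀ x ∈ P, -x ∉ P) (hn : h < n) (μ : Measure (LatSpace n))
    [IsProbabilityMeasure μ] (hinv : ∀ a : SLR n, μ.map (rTranslate n a) = μ) :
    ∫⁻ x, depSum (injIndicator P : (Fin h → Fin n → ℝ) → ENNReal) (latRep x) ∂μ ≤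
      ∑ r : Fin h, (h.choose r : ENNReal) * volume P ^ (r : ℕ) *
        ∑' d : ℕ, (2 * (d + 1) + 1 : ENNReal) ^ ((r : ℕ) * (h - r)) * shapeFactor n (d + 1) := by
  calc _ ≤ ∫⁻ x, ∑' σ : ShapeIndex h, shapeLatSum (injIndicator P) σ (latRep x) ∂μ :=
        lintegral_mono fun x => depSum_le _ _
    _ = ∑' σ : ShapeIndex h, ∫⁻ x, shapeLatSum (injIndicator P) σ (latRep x) ∂μ :=
        lintegral_tsum fun σ => (measurable_shapeLatSum (measurable_injIndicator hP) σ).aemeasurable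
    _ ≤ ∑' σ : ShapeIndex h, shapeFactor n (σ.2.2.1 + 1) * volume P ^ (σ.1 : ℕ) :=
        ENNReal.tsum_le_tsum fun σ => lintegral_shapeLatSum_le hP h0 hneg hn μ hinv σ
    _ ≤ _ := by
        rw [ENNReal.tsum_sigma', tsum_fintype]
        refine Finset.sum_le_sum fun r _ => ?_
        rw [ENNReal.tsum_sigma', tsum_fintype]
        have hcard : Fintype.card (Fin r ↪o Fin h) ≤ h.choose r := by
          have h1 := Fintype.card_le_of_injective
            (β := ((Finset.univ : Finset (Fin h)).powersetCard r))
            (fun e : Fin r ↪o Fin h => ⟨Finset.univ.image e, by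
              rw [Finset.mem_powersetCard]
              refine ⟨Finset.subset_univ _, ?_⟩
              rw [Finset.card_image_of_injective _ e.injective]
              simp⟩) (by
              intro e e' hee
              have h2 := congrArg Subtype.val hee
              have h3 := congrArg (fun s : Finset (Fin h) => (s : Set (Fin h))) h2
              simp only [Finset.coe_image, Finset.coe_univ, Set.image_univ] at h3
              exact OrderEmbedding.range_inj.mp h3)
          simpa using h1
        have hterm : ∀ e : Fin r ↪o Fin h,
            ∑' σ : (Σ d : ℕ, shapeMats e (d + 1)),
              shapeFactor n (σ.1 + 1) * volume P ^ (r : ℕ) =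
            volume P ^ (r : ℕ) * ∑' d : ℕ, (2 * (d + 1) + 1 : ENNReal) ^ ((r : ℕ) * (h - r)) *
              shapeFactor n (d + 1) := by
          intro e
          rw [ENNReal.tsum_sigma', ← ENNReal.tsum_mul_left]
          refine tsum_congr fun d => ?_
          rw [tsum_fintype]
          change ∑ _ : shapeMats e (d + 1), shapeFactor n (d + 1) * volume P ^ (r : ℕ) = _
          rw [Finset.sum_const, Finset.card_univ, Fintype.card_coe, card_shapeMats]
          simp only [nsmul_eq_mul]
          push_cast
          ring
        refine le_trans (le_of_eq (Finset.sum_congr rfl fun e _ => hterm e)) ?_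
        rw [Finset.sum_const, Finset.card_univ, nsmul_eq_mul, mul_assoc]
        gcongr

end DependentSums

section DependentBound

variable {n r h : ℕ}

theorem tsum_ofReal_inv_mul_succ_le :
    ∑' d : ℕ, ENNReal.ofReal (1 / (((d : ℝ) + 1) * (d + 2))) ≤ 1 := by
  rw [ENNReal.tsum_eq_iSup_nat]
  refine iSup_le fun N => ?_
  rw [← ENNReal.ofReal_sum_of_nonneg fun d _ => by positivity, ← ENNReal.ofReal_one]
  refine ENNReal.ofReal_le_ofReal ?_
  have h1 : ∀ N : ℕ, ∑ d ∈ Finset.range N, 1 / (((d : ℝ) + 1) * (d + 2)) = 1 - 1 / (N + 1) := by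
    intro N
    induction N with
    | zero => simp
    | succ N ih =>
      rw [Finset.sum_range_succ, ih]
      push_cast
      field_simp
      ring
  rw [h1]
  have : (0 : ℝ) ≤ 1 / (N + 1) := by positivity
  linarith

theorem shape_count_le {k e : ℕ} (he : e ≤ k) (hk : k + 3 ≤ n) {x : ℝ} (hx : 2 ≤ x) :
    (2 * x + 1) ^ e * x⁻¹ ^ n ≤ 8 * 5 ^ k * (1 / 2) ^ n * (1 / ((x - 1) * x)) := by
  obtain ⟨j, rfl⟩ := Nat.exists_eq_add_of_le hk
  have hx0 : 0 < x := by linarith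
  have h1 : (2 * x + 1) ^ e ≤ (5 / 2 * x) ^ k :=
    (pow_le_pow_right₀ (by linarith) he).trans (pow_le_pow_left₀ (by linarith) (by linarith) _)
  have h2 : x⁻¹ ≤ 1 / 2 := by
    rw [one_div]
    exact inv_anti₀ two_pos hx
  have h3 : x⁻¹ ^ 3 ≤ 1 / ((x - 1) * x) := by
    rw [inv_pow, ← one_div]
    refine one_div_le_one_div_of_le (mul_pos (by linarith) hx0) ?_
    nlinarith [mul_pos hx0 hx0]
  calc (2 * x + 1) ^ e * x⁻¹ ^ (k + 3 + j) ≤ (5 / 2 * x) ^ k * x⁻¹ ^ (k + 3 + j) := by gcongr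
    _ = (5 / 2) ^ k * x⁻¹ ^ j * x⁻¹ ^ 3 := by
      rw [pow_add, pow_add, mul_pow, inv_pow x k]
      field_simp
    _ ≤ (5 / 2) ^ k * (1 / 2) ^ j * (1 / ((x - 1) * x)) := by gcongr
    _ = _ := by
      rw [pow_add, pow_add, div_pow, div_pow, div_pow, one_pow, one_pow]
      ring

theorem mul_sub_le_sq_div_four (hr : r ≤ h) : r * (h - r) ≤ h ^ 2 / 4 := by
  obtain ⟨s, rfl⟩ := Nat.exists_eq_add_of_le hr
  rw [Nat.le_div_iff_mul_le (by norm_num), Nat.add_sub_cancel_left]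
  zify
  nlinarith [sq_nonneg ((r : ℤ) - s)]

theorem tsum_shape_count_le (hr : r ≤ h) (hn : h ^ 2 / 4 + 3 ≤ n) :
    ∑' d : ℕ, (2 * (d + 1) + 1 : ENNReal) ^ (r * (h - r)) * shapeFactor n (d + 1) ≤
      ENNReal.ofReal (3 ^ (h ^ 2 / 4) * (√3 / 2) ^ n + 8 * 5 ^ (h ^ 2 / 4) * (1 / 2) ^ n) := by
  have he := mul_sub_le_sq_div_four hr
  generalize h ^ 2 / 4 = k at *
  generalize r * (h - r) = e at *
  rw [tsum_eq_zero_add' ENNReal.summable, ENNReal.ofReal_add (by positivity) (by positivity)]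
  refine add_le_add ?_ ?_
  · have h3 : (2 * ((0 : ℕ) + 1) + 1 : ENNReal) = ENNReal.ofReal 3 := by
      norm_num
    rw [h3]
    simp only [shapeFactor, zero_add, if_true]
    rw [← ENNReal.ofReal_pow (by norm_num), ← ENNReal.ofReal_mul (by positivity)]
    refine ENNReal.ofReal_le_ofReal ?_
    gcongr
    norm_num
  · have h4 : ∀ d : ℕ, (2 * (((d + 1 : ℕ) : ENNReal) + 1) + 1) ^ e * shapeFactor n (d + 1 + 1) ≤
        ENNReal.ofReal (8 * 5 ^ k * (1 / 2) ^ n) *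
          ENNReal.ofReal (1 / (((d : ℝ) + 1) * (d + 2))) := by
      intro d
      have h5 : (2 * (((d + 1 : ℕ) : ENNReal) + 1) + 1) =
          ENNReal.ofReal (2 * ((d : ℝ) + 2) + 1) := by
        have : (2 * ((d : ℝ) + 2) + 1) = ((2 * (d + 2) + 1 : ℕ) : ℝ) := by push_cast; ring
        rw [this, ENNReal.ofReal_natCast]
        push_cast
        ring
      have h6 : shapeFactor n (d + 1 + 1) = ENNReal.ofReal (((d : ℝ) + 2)⁻¹ ^ n) := by
        have h7 : (((d + 1 + 1 : ℕ) : ℝ)) = (d : ℝ) + 2 := by push_cast; ring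
        rw [shapeFactor, if_neg (by omega), h7]
      rw [h5, h6, ← ENNReal.ofReal_pow (by positivity), ← ENNReal.ofReal_mul (by positivity),
        ← ENNReal.ofReal_mul (by positivity)]
      refine ENNReal.ofReal_le_ofReal ?_
      have := shape_count_le he hn (x := (d : ℝ) + 2) (by linarith [d.cast_nonneg (α := ℝ)])
      convert this using 4
      ring
    refine (ENNReal.tsum_le_tsum h4).trans ?_
    rw [ENNReal.tsum_mul_left]
    exact mul_le_of_le_one_right zero_le tsum_ofReal_inv_mul_succ_le

theorem sum_choose_mul_pow_le (v : ENNReal) :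
    ∑ r : Fin h, (h.choose r : ENNReal) * v ^ (r : ℕ) ≤ (v + 1) ^ h := by
  rw [add_pow, Fin.sum_univ_eq_sum_range (fun r => (h.choose r : ENNReal) * v ^ r),
    Finset.sum_range_succ]
  refine le_add_right (le_of_eq (Finset.sum_congr rfl fun r _ => ?_))
  rw [one_pow, mul_one, mul_comm]

theorem lintegral_depSum_le_of_volume {P : Set (Fin n → ℝ)} (hP : MeasurableSet P)
    (h0 : 0 ∉ P) (hneg : ∀ x ∈ P, -x ∉ P) (hn : h < n) (hhn : h ^ 2 / 4 + 3 ≤ n)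
    (μ : Measure (LatSpace n)) [IsProbabilityMeasure μ]
    (hinv : ∀ a : SLR n, μ.map (rTranslate n a) = μ) {v : ℝ} (hv : 0 ≤ v)
    (hPv : volume P = ENNReal.ofReal v) :
    ∫⁻ x, depSum (injIndicator P : (Fin h → Fin n → ℝ) → ENNReal) (latRep x) ∂μ ≤
      ENNReal.ofReal ((2 * 3 ^ (h ^ 2 / 4) * (√3 / 2) ^ n + 21 * 5 ^ (h ^ 2 / 4) * (1 / 2) ^ n) *
        (v + 1) ^ h) := by
  refine (lintegral_depSum_le hP h0 hneg hn μ hinv).trans ?_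
  calc _ ≤ ∑ r : Fin h, (h.choose r : ENNReal) * volume P ^ (r : ℕ) *
        ENNReal.ofReal (3 ^ (h ^ 2 / 4) * (√3 / 2) ^ n + 8 * 5 ^ (h ^ 2 / 4) * (1 / 2) ^ n) := by
        gcongr with r
        exact tsum_shape_count_le r.2.le hhn
    _ ≤ (ENNReal.ofReal v + 1) ^ h *
        ENNReal.ofReal (3 ^ (h ^ 2 / 4) * (√3 / 2) ^ n + 8 * 5 ^ (h ^ 2 / 4) * (1 / 2) ^ n) := by
        rw [← Finset.sum_mul, hPv]
        gcongr
        exact sum_choose_mul_pow_le _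
    _ ≤ _ := by
        rw [← ENNReal.ofReal_one, ← ENNReal.ofReal_add hv zero_le_one,
          ← ENNReal.ofReal_pow (by positivity), ← ENNReal.ofReal_mul (by positivity), mul_comm]
        refine ENNReal.ofReal_le_ofReal ?_
        gcongr
        · have : (0 : ℝ) ≤ 3 ^ (h ^ 2 / 4) := by positivity
          linarith
        · norm_num

end DependentBound

section Main

variable {n r h : ℕ}

theorem zero_notMem_posHalf (S : Set (Fin n → ℝ)) : 0 ∉ posHalf n S := by
  rintro ⟨-, i, hi, -⟩
  simp at hi

theorem neg_notMem_posHalf {S : Set (Fin n → ℝ)} {x : Fin n → ℝ} (hx : x ∈ posHalf n S) :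
    -x ∉ posHalf n S := by
  rintro ⟨-, j, hj, hj'⟩
  obtain ⟨-, i, hi, hi'⟩ := hx
  simp only [Pi.neg_apply, neg_eq_zero] at hj hj'
  rcases lt_trichotomy i j with h | h | h
  · exact hi.ne' (hj' i h)
  · subst h
    linarith
  · have := hi' j h
    linarith

theorem measurableSet_posHalf {S : Set (Fin n → ℝ)} (hS : MeasurableSet S) :
    MeasurableSet (posHalf n S) := by
  have : posHalf n S = S ∩ ⋃ i : Fin n, ({x | 0 < x i} ∩ ⋂ j : Fin n, {x | j < i → x j = 0}) := by
    ext x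
    simp [posHalf]
  rw [this]
  refine hS.inter (MeasurableSet.iUnion fun i => MeasurableSet.inter
    (measurableSet_lt measurable_const (measurable_pi_apply i)) (MeasurableSet.iInter fun j => ?_))
  by_cases hji : j < i
  · simp only [hji, true_imp_iff]
    exact measurableSet_eq_fun (measurable_pi_apply j) measurable_const
  · simp [hji]

theorem volume_posHalf (hn : 2 ≤ n) {S : Set (Fin n → ℝ)} (hS : MeasurableSet S)
    (hsymm : ∀ x, x ∈ S ↔ -x ∈ S) {V : ℝ} (hV : volume S = ENNReal.ofReal V) :
    volume (posHalf n S) = ENNReal.ofReal (V / 2) := by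
  have hP := measurableSet_posHalf hS
  have h1 : S \ {0} = posHalf n S ∪ -posHalf n S := by
    ext x
    constructor
    · rintro ⟨hx, hx0⟩
      have hex : ∃ i, x i ≠ 0 := Function.ne_iff.mp hx0
      let i := Finset.min' (Finset.univ.filter fun i => x i ≠ 0) (by
        obtain ⟨k, hk⟩ := hex
        exact ⟨k, by simp [hk]⟩)
      have hi : x i ≠ 0 := by
        have := Finset.min'_mem (Finset.univ.filter fun i => x i ≠ 0) (by
          obtain ⟨k, hk⟩ := hex
          exact ⟨k, by simp [hk]⟩)
        simpa using this
      have hlt : ∀ j < i, x j = 0 := by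
        intro j hj
        by_contra hne
        exact absurd (Finset.min'_le (Finset.univ.filter fun i => x i ≠ 0) j (by simp [hne]))
          (not_le.mpr hj)
      rcases lt_or_gt_of_ne hi with h | h
      · refine Or.inr ⟨(hsymm x).mp hx, i, by simpa using h, fun j hj => by simp [hlt j hj]⟩
      · exact Or.inl ⟨hx, i, h, hlt⟩
    · rintro (hx | hx)
      · refine ⟨hx.1, fun h0 => zero_notMem_posHalf S ?_⟩
        rw [Set.mem_singleton_iff] at h0
        rwa [← h0]
      · refine ⟨(hsymm x).mpr hx.1, fun h0 => zero_notMem_posHalf S ?_⟩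
        rw [Set.mem_singleton_iff] at h0
        rw [h0] at hx
        simpa using hx
  have h2 : volume (S \ {0}) = volume S := by
    have : Nonempty (Fin n) := ⟨⟨0, by omega⟩⟩
    exact measure_sdiff_null (measure_singleton 0)
  have hdisj : Disjoint (posHalf n S) (-posHalf n S) := by
    rw [Set.disjoint_left]
    intro x hx hx'
    exact neg_notMem_posHalf hx hx'
  rw [h1, measure_union hdisj hP.neg, Measure.measure_neg, hV] at h2
  have h3 : volume (posHalf n S) * 2 = ENNReal.ofReal V := by rw [mul_two, h2]
  rw [ENNReal.ofReal_div_of_pos two_pos, ← h3]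
  rw [ENNReal.ofReal_ofNat, ENNReal.mul_div_cancel_right two_ne_zero ENNReal.ofNat_ne_top]

theorem measurable_box {P : Set (Fin n → ℝ)} (hP : MeasurableSet P) :
    Measurable fun Y : Fin r → Fin n → ℝ => if ∀ j, Y j ∈ P then (1 : ENNReal) else 0 := by
  refine Measurable.ite ?_ measurable_const measurable_const
  have : {Y : Fin r → Fin n → ℝ | ∀ j, Y j ∈ P} = ⋂ i, (fun X => X i) ⁻¹' P := by
    ext; simp
  rw [this]
  exact MeasurableSet.iInter fun i => measurable_pi_apply i hP

theorem latSum_injIndicator (P : Set (Fin n → ℝ)) (g : SLR n) :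
    latSum (injIndicator P : (Fin h → Fin n → ℝ) → ENNReal) g =
      latSum (fun Y : Fin h → Fin n → ℝ => if ∀ j, Y j ∈ P then (1 : ENNReal) else 0) g := by
  refine tsum_congr fun N => ?_
  by_cases hN : LinearIndependent ℝ (castMat N)
  · have hg : (g : Matrix (Fin n) (Fin n) ℝ).det ≠ 0 := by
      rw [g.det_coe]
      exact one_ne_zero
    have h1 := ((linearIndependent_rowMul hg).mpr hN).injective
    simp [hN, injIndicator, h1]
  · simp [hN]

theorem lt_of_sq_div_four_add_three_le (hhn : h ^ 2 / 4 + 3 ≤ n) : h < n := by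
  have h1 : h ≤ h ^ 2 / 4 + 1 := by
    have : h - 1 ≤ h ^ 2 / 4 := by
      rw [Nat.le_div_iff_mul_le (by norm_num)]
      rcases Nat.eq_zero_or_pos h with h0 | h0
      · simp [h0]
      · zify [h0]
        nlinarith [sq_nonneg ((h : ℤ) - 2)]
    omega
  omega

end Main

/-- **Proposition (Rogers-type moment estimate).** Let `n, h` be positive integers with
`n ≥ ⌊h²/4⌋ + 3` and let `S ⊆ ℝ^n` be Borel measurable, symmetric about the origin, of
Lebesgue measure `V`. Then
`(V/2)^h ≤ ∫_{X_n} Σ_{x_1,…,x_h ∈ L∖{0}} ρ_{S',h}(x_1,…,x_h) dμ_n(L)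
  ≤ (V/2)^h + (2·3^{⌊h²/4⌋}(√3/2)^n + 21·5^{⌊h²/4⌋}(1/2)^n)(V/2+1)^h`,
where `ρ_{S',h}(x_1,…,x_h) = ∏ χ_{S'}(x_i)` if the `x_i` are pairwise distinct and `0`
otherwise.  (The sum over the `x_i ∈ L∖{0}` is parametrized by tuples of integer
vectors; tuples with a repeated or zero entry, or an entry outside `S'`, contribute
`0` since points of `S'` are nonzero.) -/
theorem stmt2 (n h : ℕ) (hn : 2 ≤ n) (hh : 0 < h) (hnh : h ^ 2 / 4 + 3 ≤ n)
    (S : Set (Fin n → ℝ)) (hSmeas : MeasurableSet S)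
    (hSsymm : ∀ x, x ∈ S ↔ -x ∈ S)
    (V : ℝ) (hV0 : 0 ≤ V) (hvol : MeasureTheory.volume S = ENNReal.ofReal V)
    (μ : MeasureTheory.Measure (LatSpace n)) [MeasureTheory.IsProbabilityMeasure μ]
    (hinv : ∀ a : SLR n, μ.map (rTranslate n a) = μ)
    (f : LatSpace n → ENNReal)
    (hf : ∀ g : SLR n, f (latMk n g) =
      ∑' m : Fin h → (Fin n → ℤ),
        (if (∀ i, Matrix.vecMul (fun j => ((m i j : ℝ))) (g : Matrix (Fin n) (Fin n) ℝ)
                ∈ posHalf n S) ∧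
            Function.Injective (fun i =>
              Matrix.vecMul (fun j => ((m i j : ℝ))) (g : Matrix (Fin n) (Fin n) ℝ))
          then (1 : ENNReal) else 0)) :
    ENNReal.ofReal ((V / 2) ^ h) ≤ ∫⁻ x, f x ∂μ ∧
    ∫⁻ x, f x ∂μ ≤ ENNReal.ofReal ((V / 2) ^ h +
      (2 * 3 ^ (h ^ 2 / 4) * (Real.sqrt 3 / 2) ^ n + 21 * 5 ^ (h ^ 2 / 4) * (1 / 2 : ℝ) ^ n) *
        (V / 2 + 1) ^ h) := by
  have hlt : h < n := lt_of_sq_div_four_add_three_le hnh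
  have hP := measurableSet_posHalf hSmeas
  have hvP := volume_posHalf hn hSmeas hSsymm hvol
  have hsplit : ∀ x, f x = latSum (injIndicator (posHalf n S) : (Fin h → Fin n → ℝ) → ENNReal)
      (latRep x) + depSum (injIndicator (posHalf n S) : (Fin h → Fin n → ℝ) → ENNReal)
        (latRep x) := by
    intro x
    conv_lhs => rw [← latMk_latRep x, hf]
    rw [latSum, depSum, ← ENNReal.tsum_add]
    refine tsum_congr fun m => ?_
    by_cases hm : LinearIndependent ℝ (castMat m)
    · rw [if_pos hm, if_pos hm, add_zero]
      rfl
    · rw [if_neg hm, if_neg hm, zero_add]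
      rfl
  have hmain : ∫⁻ x, latSum (injIndicator (posHalf n S) : (Fin h → Fin n → ℝ) → ENNReal)
      (latRep x) ∂μ = ENNReal.ofReal ((V / 2) ^ h) := by
    simp only [latSum_injIndicator]
    rw [lintegral_latSum hlt μ hinv (measurable_box hP), lintegral_box _ hP, hvP,
      ENNReal.ofReal_pow (by positivity)]
  have htotal : ∫⁻ x, f x ∂μ = ENNReal.ofReal ((V / 2) ^ h) +
      ∫⁻ x, depSum (injIndicator (posHalf n S) : (Fin h → Fin n → ℝ) → ENNReal)
        (latRep x) ∂μ := by
    rw [← hmain, ← lintegral_add_left ((isLatInvariant_latSum _).measurable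
      (measurable_latSum (measurable_injIndicator hP)))]
    exact lintegral_congr hsplit
  rw [htotal]
  refine ⟨le_add_right le_rfl, ?_⟩
  rw [ENNReal.ofReal_add (by positivity) (by positivity)]
  gcongr
  exact lintegral_depSum_le_of_volume hP (zero_notMem_posHalf S)
    (fun x hx => neg_notMem_posHalf hx) hlt hnh μ hinv (by positivity) hvP
end

section
/- Let T be a finite set, and for subsets R ⊆ S ⊆ T define μ_S(R) = (−1)^{|S ∖ R|}. Then for any positive integer k, the double sum Σ_{S ⊆ T, |S| ≥ k} Σ_{R ⊆ S, |R| ≥ k} μ_S(R) equals 1 if |T| ≥ k and equals 0 otherwise. -/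
open scoped Classical

/-- The alternating sum over a Boolean interval `[R, T]` vanishes unless `R = T`. -/
theorem Finset.sum_Icc_neg_one_pow_card_sdiff {α : Type*} [DecidableEq α] {R T : Finset α}
    (h : R ⊆ T) :
    ∑ S ∈ Finset.Icc R T, (-1 : ℤ) ^ (S \ R).card = if R = T then 1 else 0 := by
  have sdiff_union {U : Finset α} (hU : U ∈ (T \ R).powerset) : (R ∪ U) \ R = U := by
    rw [Finset.union_sdiff_cancel_left]
    exact (Finset.disjoint_sdiff (s := R)).mono_right (Finset.mem_powerset.mp hU)
  rw [Finset.Icc_eq_image_powerset h, Finset.sum_image]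
  · rw [Finset.sum_congr rfl fun U hU => by rw [sdiff_union hU],
      Finset.sum_powerset_neg_one_pow_card]
    exact if_congr (Finset.sdiff_eq_empty_iff_subset.trans
      ⟨h.antisymm, fun e => e.ge⟩) rfl rfl
  · intro U hU V hV hUV
    rw [← sdiff_union hU, ← sdiff_union hV]
    exact congrArg (· \ R) hUV

/-- **Lemma (Möbius double sum).** Let `T` be a finite set, and for `R ⊆ S ⊆ T` let
`μ_S(R) = (−1)^{|S∖R|}`. Then for any positive integer `k`, the double sum
`Σ_{S ⊆ T, |S| ≥ k} Σ_{R ⊆ S, |R| ≥ k} μ_S(R)` equals `1` if `|T| ≥ k` and `0` otherwise. -/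
theorem stmt5 {α : Type*} (T : Finset α) (k : ℕ) (hk : 0 < k) :
    ∑ S ∈ T.powerset.filter (fun S => k ≤ S.card),
        ∑ R ∈ S.powerset.filter (fun R => k ≤ R.card), ((-1 : ℤ)) ^ ((S \ R).card)
      = if k ≤ T.card then 1 else 0 := by
  rw [Finset.sum_comm' (t' := T.powerset.filter fun R => k ≤ R.card)
    (s' := fun R => Finset.Icc R T)]
  · rw [Finset.sum_congr rfl fun R hR => Finset.sum_Icc_neg_one_pow_card_sdiff
      (Finset.mem_powerset.mp (Finset.mem_filter.mp hR).1), Finset.sum_ite_eq']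
    simp
  · intro S R
    simp only [Finset.mem_filter, Finset.mem_powerset, Finset.mem_Icc]
    exact ⟨fun ⟨⟨hST, _⟩, hRS, hR⟩ => ⟨⟨hRS, hST⟩, hRS.trans hST, hR⟩,
      fun ⟨⟨hRS, hST⟩, _, hR⟩ => ⟨⟨hST, hR.trans (Finset.card_le_card hRS)⟩, hRS, hR⟩⟩
end
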